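/- Let k be a field with char(k) ≠ 3, C ⊂ ℙ² a smooth plane cubic, and S_C the blow up of (ℙ²)∨ at the nine points corresponding to the inflection lines of C. Then the anticanonical divisor −K_{S_C} is nef and linearly equivalent to an effective divisor, and the linear system |−2K_{S_C}| is base-point free. Moreover, after extending the ground field if necessary, |−2K_{S_C}| contains a connected reduced divisor, unless char(k) = 2 and j(C) = 0. -/

import Mathlib

/-!
STATEMENT 5 (Pacini–Testa, Lemma `tu`): let `k` be a field with `char k ≠ 3`, `C ⊂ ℙ²`
a smooth plane cubic and `S_C` the blow up of `(ℙ²)∨` at the nine points `T_C` dual to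
the inflection lines of `C`.  Then `−K_{S_C}` is nef and linearly equivalent to an
effective divisor, and `|−2K_{S_C}|` is base-point free.  Moreover, after extending the
ground field if necessary (we pass to the algebraic closure), `|−2K_{S_C}|` contains a
connected and reduced divisor, unless `char k = 2` and `j(C) = 0`.

Divisor classes on the blow up `S_C` are translated into plane-curve data:
* effective divisors in `|−K_{S_C}|` = nonzero cubics through `T_C`;
* effective divisors in `|−2K_{S_C}|` = nonzero sextics with points of multiplicity
  `≥ 2` at all points of `T_C`;
* nefness of `−K_{S_C}` = every irreducible curve of degree `d` (over the algebraic
  closure) has total multiplicity at most `3d` at the points of `T_C`;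
* base-point freeness of `|−2K_{S_C}|` = the members have no common point outside
  `T_C`, and at each point of `T_C` no common tangent direction (no base point on the
  exceptional curves);
* a member is connected and reduced if the sextic is squarefree and any splitting of it
  into two factors has a common zero away from the blown-up locus `T_C`.
-/

open MvPolynomial Polynomial

noncomputable section

namespace Infl

variable {K : Type*} [Field K]

def dotv (w p : Fin 3 → K) : K := ∑ i, w i * p i

def lineRestrict (F : MvPolynomial (Fin 3) K) (a b : Fin 3 → K) : Polynomial K :=
  MvPolynomial.aeval (fun i => Polynomial.C (a i) + Polynomial.C (b i) * Polynomial.X) F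

def contactAt (F : MvPolynomial (Fin 3) K) (a b : Fin 3 → K) : ℕ :=
  (lineRestrict F a b).rootMultiplicity 0

def IsSmoothCurve (F : MvPolynomial (Fin 3) K) (d : ℕ) : Prop :=
  F.IsHomogeneous d ∧ F ≠ 0 ∧
    ∀ p : Fin 3 → K, p ≠ 0 → eval p F = 0 → ∃ i, eval p (pderiv i F) ≠ 0

def IsInflLine (F : MvPolynomial (Fin 3) K) (w : Fin 3 → K) : Prop :=
  w ≠ 0 ∧ ∃ a b : Fin 3 → K, dotv w a = 0 ∧ dotv w b = 0 ∧
    LinearIndependent K ![a, b] ∧ lineRestrict F a b ≠ 0 ∧ 3 ≤ contactAt F a b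

def SingAt (F : MvPolynomial (Fin 3) K) (p : Fin 3 → K) : Prop :=
  eval p F = 0 ∧ ∀ i, eval p (pderiv i F) = 0

def planeSubst (F : MvPolynomial (Fin 3) K) (p v u : Fin 3 → K) : MvPolynomial (Fin 2) K :=
  MvPolynomial.aeval
    (fun i => MvPolynomial.C (p i) + MvPolynomial.C (v i) * X 0 + MvPolynomial.C (u i) * X 1) F

/-- The multiplicity of the point `p` on the plane curve `{G = 0}`. -/
def multAt (G : MvPolynomial (Fin 3) K) (p : Fin 3 → K) : ℕ :=
  sInf {n | ∃ v u, LinearIndependent K ![p, v, u] ∧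
    MvPolynomial.homogeneousComponent n (planeSubst G p v u) ≠ 0}

variable {k : Type*} [Field k]

def bar (F : MvPolynomial (Fin 3) k) : MvPolynomial (Fin 3) (AlgebraicClosure k) :=
  MvPolynomial.map (algebraMap k (AlgebraicClosure k)) F

def wpoly (W : WeierstrassCurve K) : MvPolynomial (Fin 3) K :=
  X 1 ^ 2 * X 2 + MvPolynomial.C W.a₁ * X 0 * X 1 * X 2 + MvPolynomial.C W.a₃ * X 1 * X 2 ^ 2
    - X 0 ^ 3 - MvPolynomial.C W.a₂ * X 0 ^ 2 * X 2 - MvPolynomial.C W.a₄ * X 0 * X 2 ^ 2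
    - MvPolynomial.C W.a₆ * X 2 ^ 3

def transformPoly (g : Matrix (Fin 3) (Fin 3) K) (F : MvPolynomial (Fin 3) K) :
    MvPolynomial (Fin 3) K :=
  MvPolynomial.aeval (fun i => ∑ j, MvPolynomial.C (g i j) * X j) F

def HasJZero (F : MvPolynomial (Fin 3) k) : Prop :=
  ∃ (W : WeierstrassCurve (AlgebraicClosure k)) (hW : W.IsElliptic)
    (g : GL (Fin 3) (AlgebraicClosure k)) (c : (AlgebraicClosure k)ˣ),
      (letI := hW; W.j = 0) ∧
      transformPoly (g : Matrix (Fin 3) (Fin 3) (AlgebraicClosure k)) (bar F) =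
        (c : AlgebraicClosure k) • wpoly W

/-- `G` is (an equation over `k` of) an effective divisor in `|−2K_{S_C}|`:
a sextic with a point of multiplicity at least 2 at each point of `T_C`. -/
def InAntiBicanonical (F G : MvPolynomial (Fin 3) k) : Prop :=
  G ≠ 0 ∧ G.IsHomogeneous 6 ∧
    ∀ w : Fin 3 → AlgebraicClosure k, IsInflLine (bar F) w → SingAt (bar G) w

theorem lr_eval (F : MvPolynomial (Fin 3) K) (a b : Fin 3 → K) (t : K) :
    (lineRestrict F a b).eval t = MvPolynomial.eval (fun i => a i + b i * t) F := by
  unfold lineRestrict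
  rw [← Polynomial.coe_evalRingHom, MvPolynomial.aeval_def, MvPolynomial.hom_eval₂]
  simp only [Polynomial.coe_evalRingHom, Polynomial.eval_add, Polynomial.eval_mul,
    Polynomial.eval_C, Polynomial.eval_X]
  rw [MvPolynomial.eval, MvPolynomial.coe_eval₂Hom]
  congr 1
  ext x; simp

theorem lr_coeff_zero (F : MvPolynomial (Fin 3) K) (a b : Fin 3 → K) :
    (lineRestrict F a b).coeff 0 = MvPolynomial.eval a F := by
  rw [Polynomial.coeff_zero_eq_eval_zero, lr_eval]; simp

theorem lr_coeff_one (F : MvPolynomial (Fin 3) K) (a b : Fin 3 → K) :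
    (lineRestrict F a b).coeff 1 = ∑ i, b i * MvPolynomial.eval a (pderiv i F) := by
  induction F using MvPolynomial.induction_on with
  | C r => simp [lineRestrict, Polynomial.coeff_C]
  | add p q hp hq =>
    simp only [lineRestrict, map_add, Polynomial.coeff_add] at *
    rw [hp, hq, ← Finset.sum_add_distrib]
    exact Finset.sum_congr rfl fun i _ => by ring
  | mul_X p j hp =>
    have h0 := lr_coeff_zero p a b
    simp only [lineRestrict, map_mul, MvPolynomial.aeval_X] at *
    rw [Polynomial.mul_coeff_one, hp, h0]
    simp only [Derivation.leibniz, map_add, smul_eq_mul, map_mul, MvPolynomial.eval_X]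
    simp only [mul_add, Finset.sum_add_distrib, pderiv_X]
    simp [Finset.sum_mul, Pi.single_apply, apply_ite]
    congr 1
    · ring
    · exact Finset.sum_congr rfl fun i _ => by ring

theorem singAt_iff (F : MvPolynomial (Fin 3) K) (w : Fin 3 → K) :
    SingAt F w ↔ ∀ v, (lineRestrict F w v).coeff 0 = 0 ∧ (lineRestrict F w v).coeff 1 = 0 := by
  constructor
  · rintro ⟨h0, h1⟩ v
    rw [lr_coeff_zero, lr_coeff_one]
    exact ⟨h0, by simp [h1]⟩
  · intro h
    refine ⟨by rw [← lr_coeff_zero F w 0]; exact (h 0).1, fun i => ?_⟩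
    have := (h (Pi.single i 1)).2
    rw [lr_coeff_one] at this
    simpa [Pi.single_apply] using this

theorem eval_transformPoly (g : Matrix (Fin 3) (Fin 3) K) (F : MvPolynomial (Fin 3) K)
    (p : Fin 3 → K) :
    MvPolynomial.eval p (transformPoly g F) = MvPolynomial.eval (g.mulVec p) F := by
  unfold transformPoly
  rw [MvPolynomial.aeval_def, ← MvPolynomial.coe_eval₂Hom, MvPolynomial.map_eval₂Hom]
  rw [MvPolynomial.eval]
  congr 2
  · ext x; simp
  · ext i
    simp [Matrix.mulVec, dotProduct]

theorem aeval_transformPoly {A : Type*} [CommRing A] [Algebra K A]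
    (g : Matrix (Fin 3) (Fin 3) K) (F : MvPolynomial (Fin 3) K) (γ : Fin 3 → A) :
    MvPolynomial.aeval γ (transformPoly g F) =
      MvPolynomial.aeval (fun i => ∑ j, algebraMap K A (g i j) * γ j) F := by
  unfold transformPoly
  rw [← AlgHom.comp_apply, MvPolynomial.comp_aeval]
  simp

theorem lr_transformPoly (g : Matrix (Fin 3) (Fin 3) K) (F : MvPolynomial (Fin 3) K)
    (a b : Fin 3 → K) :
    lineRestrict (transformPoly g F) a b = lineRestrict F (g.mulVec a) (g.mulVec b) := by
  unfold lineRestrict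
  rw [aeval_transformPoly]
  congr 2
  ext1 i
  simp only [Polynomial.algebraMap_eq, Matrix.mulVec, dotProduct, map_sum, map_mul,
    Finset.sum_mul, ← Finset.sum_add_distrib]
  exact Finset.sum_congr rfl fun j _ => by ring

theorem transformPoly_mul (g h : Matrix (Fin 3) (Fin 3) K) (F : MvPolynomial (Fin 3) K) :
    transformPoly h (transformPoly g F) = transformPoly (g * h) F := by
  unfold transformPoly
  rw [← AlgHom.comp_apply, MvPolynomial.comp_aeval]
  congr 2
  ext1 i
  simp only [MvPolynomial.aeval_X, MvPolynomial.aeval_C, Matrix.mul_apply, map_sum, map_mul, Finset.mul_sum, Finset.sum_mul,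
    MvPolynomial.algebraMap_eq]
  rw [Finset.sum_comm]
  exact Finset.sum_congr rfl fun j _ => Finset.sum_congr rfl fun l _ => by ring

theorem transformPoly_one (F : MvPolynomial (Fin 3) K) : transformPoly 1 F = F := by
  unfold transformPoly
  have : (fun i => ∑ j, MvPolynomial.C ((1 : Matrix (Fin 3) (Fin 3) K) i j) *
      (MvPolynomial.X j : MvPolynomial (Fin 3) K)) = MvPolynomial.X := by
    ext1 i
    simp [Matrix.one_apply, apply_ite]
  rw [this]; simp

theorem transformPoly_smul (g : Matrix (Fin 3) (Fin 3) K) (c : K) (F : MvPolynomial (Fin 3) K) :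
    transformPoly g (c • F) = c • transformPoly g F := by
  unfold transformPoly; simp

theorem transformPoly_homog (g : Matrix (Fin 3) (Fin 3) K) {F : MvPolynomial (Fin 3) K} {n : ℕ}
    (hF : F.IsHomogeneous n) : (transformPoly g F).IsHomogeneous n := by
  have := hF.aeval (fun i => ∑ j, MvPolynomial.C (g i j) * MvPolynomial.X j) (n := 1)
    (fun i => MvPolynomial.IsHomogeneous.sum _ _ _ fun j _ => by
      simpa using (MvPolynomial.isHomogeneous_C (Fin 3) (g i j)).mul
        (MvPolynomial.isHomogeneous_X K j))
  simpa [transformPoly] using this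

theorem smooth_iff (F : MvPolynomial (Fin 3) K) (d : ℕ) : IsSmoothCurve F d ↔
    F.IsHomogeneous d ∧ F ≠ 0 ∧ ∀ p : Fin 3 → K, p ≠ 0 → MvPolynomial.eval p F = 0 →
      ∃ v, (lineRestrict F p v).coeff 1 ≠ 0 := by
  unfold IsSmoothCurve
  refine and_congr Iff.rfl (and_congr Iff.rfl (forall_congr' fun p => forall_congr' fun hp =>
    forall_congr' fun h0 => ?_))
  have := singAt_iff F p
  have h2 : (∀ i, MvPolynomial.eval p (pderiv i F) = 0) ↔
      ∀ v, (lineRestrict F p v).coeff 1 = 0 := by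
    simp only [SingAt, h0, lr_coeff_zero, true_and] at this
    exact this
  constructor
  · intro h; by_contra! hcon
    obtain ⟨i, hi⟩ := h
    exact hi (h2.2 hcon i)
  · intro h; by_contra! hcon
    obtain ⟨i, hi⟩ := h
    exact hi (h2.1 hcon i)

/-- `g` is invertible with inverse `h`. -/
theorem mulVec_ne_zero {g h : Matrix (Fin 3) (Fin 3) K} (hg : h * g = 1) {p : Fin 3 → K}
    (hp : p ≠ 0) : g.mulVec p ≠ 0 := by
  intro h0
  apply hp
  have : h.mulVec (g.mulVec p) = p := by rw [Matrix.mulVec_mulVec, hg, Matrix.one_mulVec]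
  rw [← this, h0, Matrix.mulVec_zero]

theorem smooth_transform {g h : Matrix (Fin 3) (Fin 3) K} (hg : h * g = 1)
    {F : MvPolynomial (Fin 3) K} {d : ℕ} (hF : IsSmoothCurve F d) :
    IsSmoothCurve (transformPoly g F) d := by
  have hg' : g * h = 1 := mul_eq_one_comm.1 hg
  rw [smooth_iff] at *
  obtain ⟨h1, h2, h3⟩ := hF
  refine ⟨transformPoly_homog g h1, fun h0 => h2 ?_, fun p hp h0 => ?_⟩
  · rw [← transformPoly_one F, ← hg', ← transformPoly_mul, h0]
    simp [transformPoly]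
  · rw [eval_transformPoly] at h0
    obtain ⟨v, hv⟩ := h3 _ (mulVec_ne_zero hg hp) h0
    refine ⟨h.mulVec v, ?_⟩
    rwa [lr_transformPoly, Matrix.mulVec_mulVec, hg', Matrix.one_mulVec]

theorem mulVec_linInd2 {g h : Matrix (Fin 3) (Fin 3) K} (hg : h * g = 1) {a b : Fin 3 → K}
    (hab : LinearIndependent K ![a, b]) :
    LinearIndependent K ![g.mulVec a, g.mulVec b] := by
  rw [LinearIndependent.pair_iff] at *
  intro s t hst
  apply hab
  rw [← Matrix.mulVec_smul, ← Matrix.mulVec_smul, ← Matrix.mulVec_add] at hst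
  by_contra hne
  exact mulVec_ne_zero hg hne hst

theorem dotv_mulVec (g : Matrix (Fin 3) (Fin 3) K) (w a : Fin 3 → K) :
    dotv w (g.mulVec a) = dotv (g.transpose.mulVec w) a := by
  simp only [dotv, Matrix.mulVec, dotProduct, Fin.sum_univ_three, Matrix.transpose_apply]
  ring

theorem infl_transform {g h : Matrix (Fin 3) (Fin 3) K} (hg : h * g = 1)
    {F : MvPolynomial (Fin 3) K} {w : Fin 3 → K}
    (hw : IsInflLine (transformPoly g F) (g.transpose.mulVec w)) : IsInflLine F w := by
  obtain ⟨h0, a, b, ha, hb, hab, h1, h2⟩ := hw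
  refine ⟨?_, g.mulVec a, g.mulVec b, ?_, ?_, mulVec_linInd2 hg hab, ?_, ?_⟩
  · rintro rfl; simp at h0
  · rwa [dotv_mulVec]
  · rwa [dotv_mulVec]
  · rwa [← lr_transformPoly]
  · unfold contactAt at *; rwa [← lr_transformPoly]

theorem infl_transform_iff {g h : Matrix (Fin 3) (Fin 3) K} (hg : h * g = 1)
    {F : MvPolynomial (Fin 3) K} {w : Fin 3 → K} :
    IsInflLine (transformPoly g F) (g.transpose.mulVec w) ↔ IsInflLine F w := by
  have hg' : g * h = 1 := mul_eq_one_comm.1 hg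
  refine ⟨infl_transform hg, fun hw => infl_transform hg' ?_⟩
  rw [transformPoly_mul, hg', transformPoly_one, Matrix.mulVec_mulVec, ← Matrix.transpose_mul, hg']
  simpa using hw

theorem infl_smul_iff {c : K} (hc : c ≠ 0) {F : MvPolynomial (Fin 3) K} {w : Fin 3 → K} :
    IsInflLine (c • F) w ↔ IsInflLine F w := by
  have key : ∀ a b, lineRestrict (c • F) a b = Polynomial.C c * lineRestrict F a b := by
    intro a b; simp [lineRestrict, Polynomial.smul_eq_C_mul]
  have hC : Polynomial.C c ≠ 0 := by simpa using hc
  unfold IsInflLine contactAt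
  refine and_congr Iff.rfl (exists_congr fun a => exists_congr fun b => and_congr Iff.rfl
    (and_congr Iff.rfl (and_congr Iff.rfl ?_)))
  rw [key]
  have h1 : Polynomial.C c * lineRestrict F a b ≠ 0 ↔ lineRestrict F a b ≠ 0 := by simp [hc]
  rw [h1]
  refine and_congr_right fun h => ?_
  rw [Polynomial.rootMultiplicity_mul (h1.2 h), Polynomial.rootMultiplicity_C, zero_add]

/-- the flex conditions in terms of coefficients -/
theorem infl_coeffs {F : MvPolynomial (Fin 3) K} {a b : Fin 3 → K}
    (h : 3 ≤ contactAt F a b) : ∀ n < 3, (lineRestrict F a b).coeff n = 0 := by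
  have h1 : (Polynomial.X - Polynomial.C (0 : K)) ^ 3 ∣ lineRestrict F a b :=
    (pow_dvd_pow _ h).trans (Polynomial.pow_rootMultiplicity_dvd _ _)
  rw [Polynomial.C_0, sub_zero, Polynomial.X_pow_dvd_iff] at h1
  exact h1

theorem infl_of_coeffs {F : MvPolynomial (Fin 3) K} {a b : Fin 3 → K}
    (h0 : lineRestrict F a b ≠ 0)
    (h : ∀ n < 3, (lineRestrict F a b).coeff n = 0) : 3 ≤ contactAt F a b := by
  unfold contactAt
  rw [Polynomial.le_rootMultiplicity_iff h0, Polynomial.C_0, sub_zero, Polynomial.X_pow_dvd_iff]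
  exact h

/-- The general ternary cubic. -/
def cubic (a b c d e f g h i m : K) : MvPolynomial (Fin 3) K :=
  MvPolynomial.C a * MvPolynomial.X 0 ^ 3 + MvPolynomial.C b * MvPolynomial.X 1 ^ 3
  + MvPolynomial.C c * MvPolynomial.X 2 ^ 3 + MvPolynomial.C d * MvPolynomial.X 0 ^ 2 * MvPolynomial.X 1
  + MvPolynomial.C e * MvPolynomial.X 0 ^ 2 * MvPolynomial.X 2
  + MvPolynomial.C f * MvPolynomial.X 1 ^ 2 * MvPolynomial.X 0
  + MvPolynomial.C g * MvPolynomial.X 1 ^ 2 * MvPolynomial.X 2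
  + MvPolynomial.C h * MvPolynomial.X 2 ^ 2 * MvPolynomial.X 0
  + MvPolynomial.C i * MvPolynomial.X 2 ^ 2 * MvPolynomial.X 1
  + MvPolynomial.C m * MvPolynomial.X 0 * MvPolynomial.X 1 * MvPolynomial.X 2

theorem exists_cubic {F : MvPolynomial (Fin 3) K} (hF : F.IsHomogeneous 3) :
    ∃ a b c d e f g h i m, F = cubic a b c d e f g h i m := by
  rw [F.as_sum]
  refine Finset.sum_induction _ (fun F => ∃ a b c d e f g h i m, F = cubic a b c d e f g h i m)
    ?_ ?_ ?_
  · rintro _ _ ⟨a, b, c, d, e, f, g, h, i, m, rfl⟩ ⟨a', b', c', d', e', f', g', h', i', m', rfl⟩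
    exact ⟨a+a', b+b', c+c', d+d', e+e', f+f', g+g', h+h', i+i', m+m', by
      simp only [cubic, map_add]; ring⟩
  · exact ⟨0, 0, 0, 0, 0, 0, 0, 0, 0, 0, by simp [cubic]⟩
  · intro s hs
    have h1 : s.degree = 3 := by
      have := hF (MvPolynomial.mem_support_iff.1 hs)
      simpa [Finsupp.weight_apply, Finsupp.degree_eq_sum, Finsupp.sum_fintype] using this
    have h2 : s 0 + s 1 + s 2 = 3 := by
      rw [Finsupp.degree_eq_sum, Fin.sum_univ_three] at h1
      exact h1
    generalize MvPolynomial.coeff s F = r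
    have h3 : MvPolynomial.monomial s r = MvPolynomial.C r * (MvPolynomial.X 0 ^ s 0 *
        MvPolynomial.X 1 ^ s 1 * MvPolynomial.X 2 ^ s 2) := by
      rw [MvPolynomial.monomial_eq, Finsupp.prod_fintype, Fin.prod_univ_three]
      simp
    rw [h3]
    have h4 : s 0 ≤ 3 := by omega
    have h5 : s 1 ≤ 3 := by omega
    generalize s 0 = A at *
    generalize s 1 = B at *
    generalize s 2 = D at *
    have h6 : D = 3 - A - B := by omega
    subst h6
    clear h3 h1 hs
    interval_cases A <;> interval_cases B
    all_goals first
      | (exfalso; omega)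
      | skip
    · exact ⟨0, 0, r, 0, 0, 0, 0, 0, 0, 0, by simp [cubic]⟩
    · exact ⟨0, 0, 0, 0, 0, 0, 0, 0, r, 0, by simp [cubic]; ring⟩
    · exact ⟨0, 0, 0, 0, 0, 0, r, 0, 0, 0, by simp [cubic]; ring⟩
    · exact ⟨0, r, 0, 0, 0, 0, 0, 0, 0, 0, by simp [cubic]⟩
    · exact ⟨0, 0, 0, 0, 0, 0, 0, r, 0, 0, by simp [cubic]; ring⟩
    · exact ⟨0, 0, 0, 0, 0, 0, 0, 0, 0, r, by simp [cubic]; ring⟩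
    · exact ⟨0, 0, 0, 0, 0, r, 0, 0, 0, 0, by simp [cubic]; ring⟩
    · exact ⟨0, 0, 0, 0, r, 0, 0, 0, 0, 0, by simp [cubic]; ring⟩
    · exact ⟨0, 0, 0, r, 0, 0, 0, 0, 0, 0, by simp [cubic]; ring⟩
    · exact ⟨r, 0, 0, 0, 0, 0, 0, 0, 0, 0, by simp [cubic]⟩

theorem eval_cubic (a b c d e f g h i m : K) (p : Fin 3 → K) :
    MvPolynomial.eval p (cubic a b c d e f g h i m) = a * p 0 ^ 3 + b * p 1 ^ 3 + c * p 2 ^ 3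
      + d * p 0 ^ 2 * p 1 + e * p 0 ^ 2 * p 2 + f * p 1 ^ 2 * p 0 + g * p 1 ^ 2 * p 2
      + h * p 2 ^ 2 * p 0 + i * p 2 ^ 2 * p 1 + m * p 0 * p 1 * p 2 := by
  simp [cubic]

theorem lr_cubic (a b c d e f g h i m : K) (p v : Fin 3 → K) :
    lineRestrict (cubic a b c d e f g h i m) p v =
      Polynomial.C (MvPolynomial.eval p (cubic a b c d e f g h i m))
      + Polynomial.C ((3*a*p 0^2+2*d*p 0*p 1+2*e*p 0*p 2+f*p 1^2+h*p 2^2+m*p 1*p 2) * v 0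
        + (3*b*p 1^2+2*f*p 0*p 1+2*g*p 1*p 2+d*p 0^2+i*p 2^2+m*p 0*p 2) * v 1
        + (3*c*p 2^2+2*h*p 0*p 2+2*i*p 1*p 2+e*p 0^2+g*p 1^2+m*p 0*p 1) * v 2) * Polynomial.X
      + Polynomial.C ((3*a*p 0+d*p 1+e*p 2)*v 0^2 + (3*b*p 1+f*p 0+g*p 2)*v 1^2
        + (3*c*p 2+h*p 0+i*p 1)*v 2^2 + (2*d*p 0+2*f*p 1+m*p 2)*v 0*v 1
        + (2*e*p 0+2*h*p 2+m*p 1)*v 0*v 2 + (2*g*p 1+2*i*p 2+m*p 0)*v 1*v 2) * Polynomial.X ^ 2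
      + Polynomial.C (MvPolynomial.eval v (cubic a b c d e f g h i m)) * Polynomial.X ^ 3 := by
  rw [eval_cubic, eval_cubic]
  simp only [lineRestrict, cubic, map_add, map_mul, map_pow, MvPolynomial.aeval_X,
    MvPolynomial.aeval_C, Polynomial.algebraMap_eq, map_ofNat]
  ring

theorem cf0 (p q r s : K) : (Polynomial.C p + Polynomial.C q * Polynomial.X
    + Polynomial.C r * Polynomial.X ^ 2 + Polynomial.C s * Polynomial.X ^ 3).coeff 0 = p := by
  simp
theorem cf1 (p q r s : K) : (Polynomial.C p + Polynomial.C q * Polynomial.X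
    + Polynomial.C r * Polynomial.X ^ 2 + Polynomial.C s * Polynomial.X ^ 3).coeff 1 = q := by
  simp [Polynomial.coeff_C, Polynomial.coeff_X_pow]
theorem cf2 (p q r s : K) : (Polynomial.C p + Polynomial.C q * Polynomial.X
    + Polynomial.C r * Polynomial.X ^ 2 + Polynomial.C s * Polynomial.X ^ 3).coeff 2 = r := by
  simp [Polynomial.coeff_C, Polynomial.coeff_X_pow, Polynomial.coeff_X]
theorem cf3 (p q r s : K) : (Polynomial.C p + Polynomial.C q * Polynomial.X
    + Polynomial.C r * Polynomial.X ^ 2 + Polynomial.C s * Polynomial.X ^ 3).coeff 3 = s := by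
  simp [Polynomial.coeff_C, Polynomial.coeff_X_pow, Polynomial.coeff_X]

theorem exists_third {a b : Fin 3 → K} (h : LinearIndependent K ![a, b]) :
    ∃ u, LinearIndependent K ![a, b, u] := by
  obtain ⟨u, hu⟩ := exists_linearIndependent_snoc_of_lt_finrank h (by simp)
  refine ⟨u, ?_⟩
  have : (![a, b, u] : Fin 3 → Fin 3 → K) = Fin.snoc ![a, b] u := by
    ext i j; fin_cases i <;> rfl
  rw [this]
  exact hu

theorem exists_inv {a b u : Fin 3 → K} (h : LinearIndependent K ![a, b, u]) :
    ∃ h : Matrix (Fin 3) (Fin 3) K, h * (Matrix.of ![a, b, u]).transpose = 1 := by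
  have h1 : LinearIndependent K (Matrix.of ![a, b, u]).row := h
  rw [Matrix.linearIndependent_rows_iff_isUnit] at h1
  obtain ⟨g, hg⟩ := h1.exists_right_inv
  refine ⟨g.transpose, ?_⟩
  rw [← Matrix.transpose_mul, hg, Matrix.transpose_one]

theorem common_zero [IsAlgClosed K] (F G : MvPolynomial (Fin 3) K)
    (hF : MvPolynomial.eval 0 F = 0) (hG : MvPolynomial.eval 0 G = 0) :
    ∃ p : Fin 3 → K, p ≠ 0 ∧ MvPolynomial.eval p F = 0 ∧ MvPolynomial.eval p G = 0 := by
  by_contra! hcon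
  have hz : MvPolynomial.zeroLocus K (Ideal.span {F, G}) = {0} := by
    rw [MvPolynomial.zeroLocus_span]
    ext x
    simp only [Set.mem_insert_iff, Set.mem_singleton_iff, forall_eq_or_imp, forall_eq,
      Set.mem_ofPred_eq, MvPolynomial.aeval_eq_eval]
    constructor
    · rintro ⟨h1, h2⟩
      by_contra hx
      exact hcon x hx h1 h2
    · rintro rfl
      exact ⟨hF, hG⟩
  have hrad := MvPolynomial.vanishingIdeal_zeroLocus_eq_radical (K := K) (Ideal.span {F, G})
  rw [hz] at hrad
  set m : Ideal (MvPolynomial (Fin 3) K) := MvPolynomial.vanishingIdeal K {(0 : Fin 3 → K)} with hm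
  have hmp : m.IsPrime := by rw [hm]; infer_instance
  have hmin : m ∈ (Ideal.span {F, G}).minimalPrimes := by
    refine ⟨⟨hmp, by rw [hrad]; exact Ideal.le_radical⟩, fun q hq _ => ?_⟩
    rw [hrad]
    exact hq.1.radical_le_iff.2 hq.2
  have hle := Ideal.height_le_card_of_mem_minimalPrimes_span (by simp) hmin
  have hcard : ({F, G} : Set (MvPolynomial (Fin 3) K)).ncard ≤ 2 := Set.ncard_insert_le F {G} |>.trans (by simp)
  have hle2 : m.height ≤ 2 := hle.trans (by exact_mod_cast hcard)
  -- the chain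
  let φ1 : MvPolynomial (Fin 3) K →ₐ[K] MvPolynomial (Fin 3) K :=
    MvPolynomial.aeval ![0, MvPolynomial.X 1, MvPolynomial.X 2]
  let φ2 : MvPolynomial (Fin 3) K →ₐ[K] MvPolynomial (Fin 3) K :=
    MvPolynomial.aeval ![0, 0, MvPolynomial.X 2]
  let P1 := RingHom.ker φ1
  let P2 := RingHom.ker φ2
  have hP1 : P1.IsPrime := RingHom.ker_isPrime _
  have hP2 : P2.IsPrime := RingHom.ker_isPrime _
  have h01 : (⊥ : Ideal (MvPolynomial (Fin 3) K)) < P1 := by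
    rw [bot_lt_iff_ne_bot]
    intro h0
    have : (MvPolynomial.X 0 : MvPolynomial (Fin 3) K) ∈ P1 := by
      simp [P1, RingHom.mem_ker, φ1]
    rw [h0] at this
    exact MvPolynomial.X_ne_zero _ this
  have h12 : P1 < P2 := by
    refine lt_of_le_of_ne ?_ ?_
    · intro x hx
      have h1 : φ2.comp φ1 = φ2 := by
        ext i; fin_cases i <;> simp [φ1, φ2]
      simp only [P1, P2, RingHom.mem_ker] at *
      rw [← h1, AlgHom.comp_apply, hx, map_zero]
    · intro h0
      have : (MvPolynomial.X 1 : MvPolynomial (Fin 3) K) ∈ P2 := by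
        simp [P2, RingHom.mem_ker, φ2]
      rw [← h0] at this
      simp [P1, RingHom.mem_ker, φ1] at this
  have h23 : P2 < m := by
    refine lt_of_le_of_ne ?_ ?_
    · intro x hx
      have h1 : (MvPolynomial.aeval (0 : Fin 3 → K)).comp φ2 = MvPolynomial.aeval (0 : Fin 3 → K) := by
        ext i; fin_cases i <;> simp [φ2]
      rw [hm, MvPolynomial.mem_vanishingIdeal_singleton_iff]
      simp only [P2, RingHom.mem_ker] at hx
      rw [← h1, AlgHom.comp_apply, hx, map_zero]
    · intro h0
      have : (MvPolynomial.X 2 : MvPolynomial (Fin 3) K) ∈ m := by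
        rw [hm, MvPolynomial.mem_vanishingIdeal_singleton_iff]; simp
      rw [← h0] at this
      simp [P2, RingHom.mem_ker, φ2] at this
  have a1 := Ideal.height_strict_mono_of_isPrime_of_isPrime h01
  have a2 := Ideal.height_strict_mono_of_isPrime_of_isPrime h12
  have a3 := Ideal.height_strict_mono_of_isPrime_of_isPrime h23
  have b3 : P2.height < 2 := a3.trans_le hle2
  have b2 : P1.height < 1 := by
    have := Order.add_one_le_of_lt a2
    have h5 := this.trans_lt b3
    rw [show (2 : ℕ∞) = 1 + 1 by norm_num] at h5
    exact lt_of_add_lt_add_right h5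
  rw [Order.lt_one_iff] at b2
  rw [b2] at a1
  simp at a1

/-- The (suitably normalised, integral) Hessian covariant of a cubic. -/
def hess (a b c d e f g h i m : K) : MvPolynomial (Fin 3) K :=
  cubic
    (3*a*f*h - a*m^2 - d^2*h + d*e*m - e^2*f)
    (3*b*d*i - b*m^2 - d*g^2 - f^2*i + f*g*m)
    (3*c*e*g - c*m^2 - e*i^2 - g*h^2 + h*i*m)
    (9*a*b*h + 3*a*f*i - 3*a*g*m - 3*b*e^2 - d^2*i + 2*d*e*g - d*f*h)
    (9*a*c*f + 3*a*g*h - 3*a*i*m - 3*c*d^2 + 2*d*e*i - e^2*g - e*f*h)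
    (9*a*b*i - 3*a*g^2 + 3*b*d*h - 3*b*e*m - d*f*i + 2*e*f*g - f^2*h)
    (9*b*c*d + 3*b*e*i - 3*b*h*m - 3*c*f^2 - d*g*i - e*g^2 + 2*f*g*h)
    (9*a*c*g - 3*a*i^2 - 3*c*d*m + 3*c*e*f + 2*d*h*i - e*g*h - f*h^2)
    (9*b*c*e - 3*b*h^2 + 3*c*d*g - 3*c*f*m - d*i^2 - e*g*i + 2*f*h*i)
    (27*a*b*c - 3*a*g*i - 3*b*e*h - 3*c*d*f + 3*d*g*h - d*i*m + 3*e*f*i - e*g*m - f*h*m)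

theorem linInd_of {p v : Fin 3 → K} (j : Fin 3) (hp : p j ≠ 0) (hv : v j = 0) (hv0 : v ≠ 0) :
    LinearIndependent K ![p, v] := by
  rw [LinearIndependent.pair_iff]
  intro s t hst
  have h1 := congrFun hst j
  simp only [Pi.add_apply, Pi.smul_apply, smul_eq_mul, hv, mul_zero, add_zero, Pi.zero_apply] at h1
  have hs : s = 0 := by simpa [hp] using h1
  subst hs
  simp only [zero_smul, zero_add] at hst
  exact ⟨rfl, (smul_eq_zero.1 hst).resolve_right hv0⟩

theorem exists_flex [IsAlgClosed K] {F : MvPolynomial (Fin 3) K} (hF : IsSmoothCurve F 3) :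
    ∃ p v : Fin 3 → K, LinearIndependent K ![p, v] ∧ ∀ n < 3, (lineRestrict F p v).coeff n = 0 := by
  obtain ⟨a, b, c, d, e, f, g, h, i, m, rfl⟩ := exists_cubic hF.1
  obtain ⟨p, hp, h1, h2⟩ := common_zero (cubic a b c d e f g h i m) (hess a b c d e f g h i m)
    (by rw [eval_cubic]; simp) (by rw [hess, eval_cubic]; simp)
  obtain ⟨-, -, hsm⟩ := (smooth_iff _ _).1 hF
  obtain ⟨w, hw⟩ := hsm p hp h1
  rw [lr_cubic, cf1] at hw
  rw [hess, eval_cubic] at h2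
  have h1' := h1
  rw [eval_cubic] at h1
  set n0 := 3*a*p 0^2+2*d*p 0*p 1+2*e*p 0*p 2+f*p 1^2+h*p 2^2+m*p 1*p 2 with hn0
  set n1 := 3*b*p 1^2+2*f*p 0*p 1+2*g*p 1*p 2+d*p 0^2+i*p 2^2+m*p 0*p 2 with hn1
  set n2 := 3*c*p 2^2+2*h*p 0*p 2+2*i*p 1*p 2+e*p 0^2+g*p 1^2+m*p 0*p 1 with hn2
  have heul : p 0 * n0 + p 1 * n1 + p 2 * n2 = 0 := by
    rw [hn0, hn1, hn2]; linear_combination 3 * h1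
  have hex : ∃ j, p j ≠ 0 := by
    by_contra! hh; exact hp (funext hh)
  obtain ⟨j, hj⟩ := hex
  have key : ∀ v : Fin 3 → K, n0 * v 0 + n1 * v 1 + n2 * v 2 = 0 →
      ((3*a*p 0+d*p 1+e*p 2)*v 0^2 + (3*b*p 1+f*p 0+g*p 2)*v 1^2
        + (3*c*p 2+h*p 0+i*p 1)*v 2^2 + (2*d*p 0+2*f*p 1+m*p 2)*v 0*v 1
        + (2*e*p 0+2*h*p 2+m*p 1)*v 0*v 2 + (2*g*p 1+2*i*p 2+m*p 0)*v 1*v 2) = 0 →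
      ∀ n < 3, (lineRestrict (cubic a b c d e f g h i m) p v).coeff n = 0 := by
    intro v hv1 hv2 n hn
    rw [lr_cubic]
    interval_cases n
    · rw [cf0]; exact h1'
    · rw [cf1]; exact hv1
    · rw [cf2]; exact hv2
  fin_cases j
  · simp only [Fin.zero_eta] at hj
    refine ⟨p, ![0, n2, -n1], linInd_of 0 hj (by simp) ?_, key _ ?_ ?_⟩
    · intro h0
      have e1 := congrFun h0 1
      have e2 := congrFun h0 2
      simp at e1 e2
      rw [e1, e2] at heul
      have : n0 = 0 := by simpa [hj] using heul
      apply hw; rw [e1, e2, this]; ring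
    · simp; ring
    · simp [hn1, hn2]
      linear_combination (27*b*c*p 1*p 2 + 9*b*h*p 0*p 1 + 9*b*i*p 1^2 + 9*c*f*p 0*p 2 + 9*c*g*p 2^2 + 3*f*h*p 0^2 + 3*f*i*p 0*p 1 - 3*g^2*p 1^2 + 3*g*h*p 0*p 2 - 3*g*i*p 1*p 2 - 3*g*m*p 0*p 1 - 3*i^2*p 2^2 - 3*i*m*p 0*p 2 - m^2*p 0^2) * h1 - p 0 ^ 2 * h2
  · simp only [Fin.mk_one] at hj
    refine ⟨p, ![n2, 0, -n0], linInd_of 1 hj (by simp) ?_, key _ ?_ ?_⟩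
    · intro h0
      have e1 := congrFun h0 0
      have e2 := congrFun h0 2
      simp at e1 e2
      rw [e1, e2] at heul
      have : n1 = 0 := by simpa [hj] using heul
      apply hw; rw [e1, e2, this]; ring
    · simp; ring
    · simp [hn0, hn2]
      linear_combination (27*a*c*p 0*p 2 + 9*a*h*p 0^2 + 9*a*i*p 0*p 1 + 9*c*d*p 1*p 2 + 9*c*e*p 2^2 + 3*d*h*p 0*p 1 + 3*d*i*p 1^2 - 3*e^2*p 0^2 - 3*e*h*p 0*p 2 + 3*e*i*p 1*p 2 - 3*e*m*p 0*p 1 - 3*h^2*p 2^2 - 3*h*m*p 1*p 2 - m^2*p 1^2) * h1 - p 1 ^ 2 * h2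
  · simp only [Fin.reduceFinMk] at hj
    refine ⟨p, ![n1, -n0, 0], linInd_of 2 hj (by simp) ?_, key _ ?_ ?_⟩
    · intro h0
      have e1 := congrFun h0 0
      have e2 := congrFun h0 1
      simp at e1 e2
      rw [e1, e2] at heul
      have : n2 = 0 := by simpa [hj] using heul
      apply hw; rw [e1, e2, this]; ring
    · simp; ring
    · simp [hn0, hn1]
      linear_combination (27*a*b*p 0*p 1 + 9*a*f*p 0^2 + 9*a*g*p 0*p 2 + 9*b*d*p 1^2 + 9*b*e*p 1*p 2 - 3*d^2*p 0^2 - 3*d*f*p 0*p 1 + 3*d*g*p 1*p 2 - 3*d*m*p 0*p 2 + 3*e*f*p 0*p 2 + 3*e*g*p 2^2 - 3*f^2*p 1^2 - 3*f*m*p 1*p 2 - m^2*p 2^2) * h1 - p 2 ^ 2 * h2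

theorem smooth_cubic_false {a b c d e f g h i m : K}
    (hs : IsSmoothCurve (cubic a b c d e f g h i m) 3) (x y z : K) (hne : x ≠ 0 ∨ y ≠ 0 ∨ z ≠ 0)
    (h0 : a*x^3+b*y^3+c*z^3+d*x^2*y+e*x^2*z+f*y^2*x+g*y^2*z+h*z^2*x+i*z^2*y+m*x*y*z = 0)
    (h1 : 3*a*x^2+2*d*x*y+2*e*x*z+f*y^2+h*z^2+m*y*z = 0)
    (h2 : 3*b*y^2+2*f*x*y+2*g*y*z+d*x^2+i*z^2+m*x*z = 0)
    (h3 : 3*c*z^2+2*h*x*z+2*i*y*z+e*x^2+g*y^2+m*x*y = 0) : False := by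
  obtain ⟨-, -, hsm⟩ := (smooth_iff _ _).1 hs
  obtain ⟨v, hv⟩ := hsm ![x, y, z] (by
      intro h0
      have e0 := congrFun h0 0
      have e1 := congrFun h0 1
      have e2 := congrFun h0 2
      simp at e0 e1 e2
      simp [e0, e1, e2] at hne) (by rw [eval_cubic]; simpa using h0)
  rw [lr_cubic, cf1] at hv
  simp [h1, h2, h3] at hv

theorem inv_of_det {g : Matrix (Fin 3) (Fin 3) K} (hd : g.det ≠ 0) : ∃ h, h * g = 1 :=
  ⟨g⁻¹, Matrix.nonsing_inv_mul _ (isUnit_iff_ne_zero.2 hd)⟩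

theorem exists_root_of (P : Polynomial K) [IsAlgClosed K] (n : ℕ) (hn : 0 < n)
    (h : P.coeff n ≠ 0) : ∃ x, P.eval x = 0 := by
  apply IsAlgClosed.exists_root
  have := Polynomial.le_degree_of_ne_zero h
  intro h0
  rw [h0] at this
  have h1 : n ≤ 0 := by exact_mod_cast this
  omega

theorem transform_step {F F' F'' : MvPolynomial (Fin 3) K} {g h g' h' : Matrix (Fin 3) (Fin 3) K}
    {c : K} (hg : h * g = 1) (hg' : h' * g' = 1) (e1 : transformPoly g F = F')
    (e2 : transformPoly g' F' = c • F'') :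
    (h' * h) * (g * g') = 1 ∧ transformPoly (g * g') F = c • F'' := by
  refine ⟨?_, ?_⟩
  · rw [Matrix.mul_assoc, ← Matrix.mul_assoc h, hg, Matrix.one_mul, hg']
  · rw [← transformPoly_mul, e1, e2]

theorem nf1 [IsAlgClosed K] {F : MvPolynomial (Fin 3) K} (hF : IsSmoothCurve F 3) :
    ∃ g h a c e y x z m, h * g = 1 ∧ a ≠ 0 ∧ y ≠ 0 ∧
      transformPoly g F = cubic a 0 c 0 e 0 y x z m := by
  obtain ⟨p, v, hpv, hc⟩ := exists_flex hF
  have hvp : LinearIndependent K ![v, p] := by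
    rw [LinearIndependent.pair_iff] at *
    intro s t hst
    exact (hpv t s (by rw [add_comm]; exact hst)).symm
  obtain ⟨u, hu⟩ := exists_third hvp
  obtain ⟨k, hk⟩ := exists_inv hu
  set G := (Matrix.of ![v, p, u]).transpose with hG
  have hs := smooth_transform hk hF
  obtain ⟨a, b, c, d, e, f, g, h, i, m, hcub⟩ := exists_cubic hs.1
  have h0 : G.mulVec ![1, 0, 0] = v := by
    ext j; simp [hG, Matrix.mulVec, dotProduct, Fin.sum_univ_three]
  have h1 : G.mulVec ![0, 1, 0] = p := by
    ext j; simp [hG, Matrix.mulVec, dotProduct, Fin.sum_univ_three]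
  rw [← h0, ← h1, ← lr_transformPoly, hcub, lr_cubic, eval_cubic, eval_cubic] at hc
  have c0 := hc 0 (by norm_num)
  have c1 := hc 1 (by norm_num)
  have c2 := hc 2 (by norm_num)
  rw [cf0] at c0
  rw [cf1] at c1
  rw [cf2] at c2
  simp at c0 c1 c2
  subst c0 c1 c2
  rw [hcub] at hs
  refine ⟨G, k, a, c, e, g, h, i, m, hk, ?_, ?_, hcub⟩
  · rintro rfl
    by_cases he : e = 0
    · subst he
      exact smooth_cubic_false hs 1 0 0 (by simp) (by simp) (by simp) (by simp) (by simp)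
    · obtain ⟨x, hx⟩ := exists_root_of (Polynomial.C e * Polynomial.X ^ 2
        + Polynomial.C m * Polynomial.X + Polynomial.C g) 2 (by norm_num)
        (by simp [Polynomial.coeff_X, Polynomial.coeff_C, he])
      simp at hx
      exact smooth_cubic_false hs x 1 0 (by simp) (by simp) (by simp) (by simp)
        (by linear_combination hx)
  · rintro rfl
    exact smooth_cubic_false hs 0 1 0 (by simp) (by simp) (by simp) (by simp) (by simp)

theorem nf2 [IsAlgClosed K] (h3 : (3 : K) ≠ 0) {a c e g h i m : K}
    (hs : IsSmoothCurve (cubic a 0 c 0 e 0 g h i m) 3) (ha : a ≠ 0) (hg : g ≠ 0) :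
    ∃ G H A B, H * G = 1 ∧ A ≠ 0 ∧
      transformPoly G (cubic a 0 c 0 e 0 g h i m) = cubic a 0 0 0 0 0 g 0 A B := by
  obtain ⟨x, hx⟩ := exists_root_of (Polynomial.C (-3*a^2*g) * Polynomial.X ^ 4
    + Polynomial.C (-4*a*e*g+a*m^2) * Polynomial.X ^ 3
    + Polynomial.C (-6*a*g*h+3*a*i*m) * Polynomial.X ^ 2
    + Polynomial.C (-12*a*c*g+3*a*i^2) * Polynomial.X
    + Polynomial.C (-4*c*e*g+c*m^2+e*i^2+g*h^2-h*i*m)) 4 (by norm_num)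
    (by
      rw [Polynomial.coeff_add, Polynomial.coeff_add, Polynomial.coeff_add, Polynomial.coeff_add]
      rw [Polynomial.coeff_C_mul_X_pow, Polynomial.coeff_C_mul_X_pow, Polynomial.coeff_C_mul_X_pow,
        Polynomial.coeff_C_mul_X, Polynomial.coeff_C]
      simp [ha, hg, h3])
  obtain ⟨y, hy⟩ := exists_root_of (Polynomial.C g * Polynomial.X ^ 2
        + Polynomial.C (m*x+i) * Polynomial.X + Polynomial.C (a*x^3+e*x^2+h*x+c)) 2 (by norm_num)
        (by
          rw [Polynomial.coeff_add, Polynomial.coeff_add]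
          rw [Polynomial.coeff_C_mul_X_pow, Polynomial.coeff_C_mul_X, Polynomial.coeff_C]
          simp [hg])
  simp only [Polynomial.eval_add, Polynomial.eval_mul, Polynomial.eval_C, Polynomial.eval_pow,
    Polynomial.eval_X] at hx hy
  set A := 2*g*y+m*x+i with hA
  set B := 3*a*x^2+m*y+2*e*x+h with hB
  have hPhi : g*B^2-m*A*B+(3*a*x+e)*A^2 = 0 := by
    rw [hA, hB]; linear_combination hx + (12*a*g*x+4*e*g-m^2) * hy
  have hA0 : A ≠ 0 := by
    intro h0
    rw [h0] at hPhi
    have hB0 : B = 0 := by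
      have : g * B ^ 2 = 0 := by linear_combination hPhi
      simpa [hg] using this
    refine smooth_cubic_false hs x y 1 (by simp) ?_ ?_ ?_ ?_
    · linear_combination hy
    · linear_combination hB0 - hB
    · linear_combination h0 - hA
    · rw [hB] at hB0; rw [hA] at h0
      linear_combination 3 * hy - x * hB0 - y * h0
  set s := - B / A with hs'
  have hsA : s * A = - B := by rw [hs']; field_simp
  have hq : g*s^2+m*s+3*a*x+e = 0 := by
    have : A^2 * (g*s^2+m*s+3*a*x+e) = 0 := by
      linear_combination hPhi + (g * (s*A-B) + m*A) * hsA
    simpa [hA0] using this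
  obtain ⟨H, hH⟩ := inv_of_det (g := !![1,0,x; s,1,y; 0,0,1]) (by simp [Matrix.det_fin_three])
  refine ⟨_, H, A, m+2*g*s, hH, hA0, ?_⟩
  have : Infinite K := IsAlgClosed.instInfinite
  apply MvPolynomial.funext
  intro p
  rw [eval_transformPoly, eval_cubic, eval_cubic]
  simp [Matrix.mulVec, dotProduct, Fin.sum_univ_three]
  rw [hA, hB] at hsA
  rw [hA]
  linear_combination p 2 ^ 3 * hy + p 0 ^ 2 * p 2 * hq + p 0 * p 2 ^ 2 * hsA

/-- The Hesse pencil. -/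
def hesse (l : K) : MvPolynomial (Fin 3) K := cubic 1 1 1 0 0 0 0 0 0 (-3 * l)

theorem exists_omega [IsAlgClosed K] : ∃ w : K, w ^ 2 + w + 1 = 0 := by
  obtain ⟨x, hx⟩ := exists_root_of (Polynomial.C (1 : K) * Polynomial.X ^ 2
    + Polynomial.C 1 * Polynomial.X + Polynomial.C 1) 2 (by norm_num)
    (by
      rw [Polynomial.coeff_add, Polynomial.coeff_add]
      rw [Polynomial.coeff_C_mul_X_pow, Polynomial.coeff_C_mul_X, Polynomial.coeff_C]
      simp)
  refine ⟨x, ?_⟩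
  simpa using hx

theorem omega_ne (h3 : (3 : K) ≠ 0) {w : K} (hw : w ^ 2 + w + 1 = 0) : w ≠ 0 ∧ w ≠ 1 := by
  refine ⟨?_, ?_⟩
  · rintro rfl; simp at hw
  · rintro rfl; apply h3; linear_combination hw

theorem omega_prod {w : K} (hw : w ^ 2 + w + 1 = 0) (x B C : K) :
    (x + B + C) * (x + w * B + w ^ 2 * C) * (2 * x + B + C + w * B + w ^ 2 * C - 3 * x)
      = - (x ^ 3 + B ^ 3 + C ^ 3 - 3 * x * B * C) := by
  grind

theorem nf3 [IsAlgClosed K] (h3 : (3 : K) ≠ 0) {a b c α : K}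
    (hs : IsSmoothCurve (cubic a 0 0 0 0 0 b 0 c α) 3) (hb : b ≠ 0) (hc : c ≠ 0) :
    ∃ G H, ∃ l r : K, H * G = 1 ∧ r ≠ 0 ∧
      transformPoly G (cubic a 0 0 0 0 0 b 0 c α) = r • hesse l := by
  obtain ⟨w, hw⟩ := exists_omega (K := K)
  obtain ⟨hw0, hw1⟩ := omega_ne h3 hw
  obtain ⟨t, rfl⟩ : ∃ t, α = -3 * t := ⟨-α/3, by field_simp⟩
  have hκ : a * b * c - t ^ 3 ≠ 0 := by
    intro h0
    have h1 : a = t ^ 3 / (b * c) := by field_simp; linear_combination h0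
    subst h1
    refine smooth_cubic_false hs 1 (t / b) (t / c) (by simp) ?_ ?_ ?_ ?_
    all_goals field_simp; ring
  obtain ⟨r, hr⟩ := IsAlgClosed.exists_pow_nat_eq (t^3-a*b*c) (n := 3) (by norm_num)
  have hr0 : r ≠ 0 := by
    rintro rfl
    apply hκ; linear_combination hr
  have ha : a = (t ^ 3 - r ^ 3) / (b * c) := by rw [hr]; field_simp; ring
  obtain ⟨H, hH⟩ := inv_of_det (g := !![1/r,0,0; t/(r*b),1/b,1/b; t/(r*c),w/c,w^2/c]) (by
    have h0 : w * (w - 1) / (r * b * c) ≠ 0 :=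
      div_ne_zero (mul_ne_zero hw0 (sub_ne_zero.2 hw1)) (mul_ne_zero (mul_ne_zero hr0 hb) hc)
    convert h0 using 1
    simp only [Matrix.det_fin_three, Matrix.of_apply, Matrix.cons_val]
    field_simp; ring)
  refine ⟨_, H, t / r, -1/(b*c), hH, by simp [hb, hc], ?_⟩
  have : Infinite K := IsAlgClosed.instInfinite
  apply MvPolynomial.funext
  intro p
  rw [eval_transformPoly, MvPolynomial.smul_eval, hesse, eval_cubic, eval_cubic]
  simp only [Matrix.mulVec, dotProduct, Fin.sum_univ_three, Matrix.of_apply, Matrix.cons_val]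
  obtain ⟨P, hP⟩ : ∃ P, p 0 = r * P := ⟨p 0 / r, by field_simp⟩
  have key := omega_prod hw (t * P) (p 1) (p 2)
  have hX : 1 / r * p 0 + 0 * p 1 + 0 * p 2 = P := by rw [hP]; field_simp; ring
  have hY : t / (r * b) * p 0 + 1 / b * p 1 + 1 / b * p 2 = (t * P + p 1 + p 2) / b := by
    rw [hP]; field_simp
  have hZ : t / (r * c) * p 0 + w / c * p 1 + w ^ 2 / c * p 2
      = (t * P + w * p 1 + w ^ 2 * p 2) / c := by
    rw [hP]; field_simp
  rw [hX, hY, hZ, ha, hP]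
  field_simp
  linear_combination b ^ 2 * c ^ 2 * key

theorem normal_form [IsAlgClosed K] (h3 : (3 : K) ≠ 0) {F : MvPolynomial (Fin 3) K}
    (hF : IsSmoothCurve F 3) :
    ∃ g h, ∃ l c : K, h * g = 1 ∧ c ≠ 0 ∧ l ^ 3 ≠ 1 ∧ (l ≠ 0 ∨ (2 : K) = 0) ∧
      transformPoly g F = c • hesse l := by
  have key : ∃ g h, ∃ l c : K, h * g = 1 ∧ c ≠ 0 ∧ transformPoly g F = c • hesse l := by
    obtain ⟨g, h, a, c, e, y, x, z, m, hg, ha, hy, e1⟩ := nf1 hF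
    have hF1 := smooth_transform hg hF
    rw [e1] at hF1
    obtain ⟨g', h', A, B, hg', hA, e2⟩ := nf2 h3 hF1 ha hy
    have hF2 := smooth_transform hg' hF1
    rw [e2] at hF2
    obtain ⟨g'', h'', l, r, hg'', hr, e3⟩ := nf3 h3 hF2 hy hA
    obtain ⟨i1, i2⟩ := transform_step (F'' := cubic a 0 0 0 0 0 y 0 A B) hg hg' e1 (c := 1)
      (by rw [one_smul]; exact e2)
    rw [one_smul] at i2
    obtain ⟨i3, i4⟩ := transform_step i1 hg'' i2 e3
    exact ⟨_, _, l, r, i3, hr, i4⟩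
  have key2 : ∀ g h : Matrix (Fin 3) (Fin 3) K, ∀ l c : K, h * g = 1 → c ≠ 0 →
      transformPoly g F = c • hesse l → l ^ 3 ≠ 1 := by
    intro g h l c hg hc e hl
    have hs := smooth_transform hg hF
    have e' : c • hesse l = cubic c c c 0 0 0 0 0 0 (-3 * c * l) := by
      simp only [hesse, cubic, MvPolynomial.smul_eq_C_mul]
      simp; ring
    rw [e, e'] at hs
    refine smooth_cubic_false hs (l^2) 1 1 (by simp) ?_ ?_ ?_ ?_
    · linear_combination (c * l ^ 3 - 2 * c) * hl
    · linear_combination 3 * c * l * hl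
    · linear_combination - 3 * c * hl
    · linear_combination - 3 * c * hl
  obtain ⟨g, h, l, c, hg, hc, e⟩ := key
  by_cases hl : l ≠ 0 ∨ (2 : K) = 0
  · exact ⟨g, h, l, c, hg, hc, key2 g h l c hg hc e, hl, e⟩
  · push Not at hl
    obtain ⟨rfl, h2⟩ := hl
    obtain ⟨w, hw⟩ := exists_omega (K := K)
    obtain ⟨hw0, hw1⟩ := omega_ne h3 hw
    have hw3 : w ^ 3 = 1 := by linear_combination (w - 1) * hw
    obtain ⟨H, hH⟩ := inv_of_det (g := !![1,1,1; 1,w,w^2; 1,w^2,w]) (by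
      have h0 : 3 * (w * (w - 1)) ≠ 0 :=
        mul_ne_zero h3 (mul_ne_zero hw0 (sub_ne_zero.2 hw1))
      convert h0 using 1
      simp only [Matrix.det_fin_three, Matrix.of_apply, Matrix.cons_val]
      linear_combination (- w) * hw3)
    have hT : transformPoly !![1,1,1; 1,w,w^2; 1,w^2,w] (c • hesse 0) = (3 * c) • hesse (-2) := by
      have : Infinite K := IsAlgClosed.instInfinite
      apply MvPolynomial.funext
      intro p
      rw [eval_transformPoly, MvPolynomial.smul_eval, MvPolynomial.smul_eval, hesse, hesse,
        eval_cubic, eval_cubic]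
      simp only [Matrix.mulVec, dotProduct, Fin.sum_univ_three, Matrix.of_apply, Matrix.cons_val]
      grind
    obtain ⟨i1, i2⟩ := transform_step hg hH e hT
    exact ⟨_, _, -2, 3 * c, i1, mul_ne_zero h3 hc, key2 _ _ _ _ i1 (mul_ne_zero h3 hc) i2,
      Or.inl (by simpa using h2), i2⟩

/-- The nine inflection lines of the Hesse cubic, up to scalars. -/
def InT (l : K) (w : Fin 3 → K) : Prop :=
  ∃ s η : K, s ≠ 0 ∧ η ^ 3 = 1 ∧ (w = ![s * l, s * η, s * η ^ 2] ∨
    w = ![s * η ^ 2, s * l, s * η] ∨ w = ![s * η, s * η ^ 2, s * l])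

theorem hesse_infl_of {l : K} (hl : l ^ 3 ≠ 1) {w a b : Fin 3 → K} (hw : w ≠ 0)
    (h1 : dotv w a = 0) (h2 : dotv w b = 0) (j : Fin 3) (ha : a j ≠ 0) (hb : b j = 0)
    (e0 : a 0 ^ 3 + a 1 ^ 3 + a 2 ^ 3 - 3 * l * (a 0 * a 1 * a 2) = 0)
    (e1 : (a 0 ^ 2 - l * a 1 * a 2) * b 0 + (a 1 ^ 2 - l * a 0 * a 2) * b 1
      + (a 2 ^ 2 - l * a 0 * a 1) * b 2 = 0)
    (e2 : a 0 * b 0 ^ 2 + a 1 * b 1 ^ 2 + a 2 * b 2 ^ 2 - l * (a 2 * b 0 * b 1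
      + a 1 * b 0 * b 2 + a 0 * b 1 * b 2) = 0)
    (e3 : b 0 ^ 3 + b 1 ^ 3 + b 2 ^ 3 - 3 * l * (b 0 * b 1 * b 2) = 1 - l ^ 3) :
    IsInflLine (hesse l) w := by
  have hb0 : b ≠ 0 := by
    rintro rfl
    simp at e3
    exact hl (by linear_combination e3)
  have hne : lineRestrict (hesse l) a b ≠ 0 := by
    intro h0
    have := congrArg (fun P => P.coeff 3) h0
    simp only [hesse, lr_cubic, cf3, eval_cubic, Polynomial.coeff_zero] at this
    apply hl; linear_combination e3 - this
  refine ⟨hw, a, b, h1, h2, linInd_of j ha hb hb0, hne, infl_of_coeffs hne ?_⟩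
  intro n hn
  rw [hesse, lr_cubic]
  interval_cases n
  · rw [cf0, eval_cubic]; linear_combination e0
  · rw [cf1]; linear_combination 3 * e1
  · rw [cf2]; linear_combination 3 * e2

theorem infl_of_inT {l : K} (hl : l ^ 3 ≠ 1) {w : Fin 3 → K} (h : InT l w) :
    IsInflLine (hesse l) w := by
  obtain ⟨s, η, hs, hη, hw⟩ := h
  have hη0 : η ≠ 0 := by rintro rfl; simp at hη
  rcases hw with rfl | rfl | rfl
  · refine hesse_infl_of (a := ![0, η, -1]) (b := ![η, -l, 0]) hl ?_ ?_ ?_ 2 ?_ ?_ ?_ ?_ ?_ ?_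
    · intro h0; have := congrFun h0 1; simp [hs, hη0] at this
    all_goals simp [dotv, Fin.sum_univ_three]
    all_goals try ring
    · linear_combination hη
    · linear_combination hη
  · refine hesse_infl_of (a := ![-1, 0, η]) (b := ![0, η, -l]) hl ?_ ?_ ?_ 0 ?_ ?_ ?_ ?_ ?_ ?_
    · intro h0; have := congrFun h0 2; simp [hs, hη0] at this
    all_goals simp [dotv, Fin.sum_univ_three]
    all_goals try ring
    · linear_combination hη
    · linear_combination hη
  · refine hesse_infl_of (a := ![η, -1, 0]) (b := ![-l, 0, η]) hl ?_ ?_ ?_ 1 ?_ ?_ ?_ ?_ ?_ ?_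
    · intro h0; have := congrFun h0 0; simp [hs, hη0] at this
    all_goals simp [dotv, Fin.sum_univ_three]
    all_goals try ring
    · linear_combination hη
    · linear_combination hη

theorem perp_cross {a b n : Fin 3 → K} (hab : LinearIndependent K ![a, b])
    (h1 : dotv n a = 0) (h2 : dotv n b = 0) :
    ∃ r : K, n 0 = r * (a 1 * b 2 - a 2 * b 1) ∧ n 1 = r * (a 2 * b 0 - a 0 * b 2) ∧
      n 2 = r * (a 0 * b 1 - a 1 * b 0) := by
  rw [← crossProduct_ne_zero_iff_linearIndependent, cross_apply] at hab
  simp only [dotv, Fin.sum_univ_three] at h1 h2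
  by_cases c0 : a 1 * b 2 - a 2 * b 1 = 0
  · by_cases c1 : a 2 * b 0 - a 0 * b 2 = 0
    · have c2 : a 0 * b 1 - a 1 * b 0 ≠ 0 := by
        intro c2; apply hab; rw [c0, c1, c2]; ext i; fin_cases i <;> rfl
      refine ⟨n 2 / (a 0 * b 1 - a 1 * b 0), ?_, ?_, ?_⟩ <;> field_simp
      · linear_combination b 1 * h1 - a 1 * h2
      · linear_combination a 0 * h2 - b 0 * h1
    · refine ⟨n 1 / (a 2 * b 0 - a 0 * b 2), ?_, ?_, ?_⟩ <;> field_simp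
      · linear_combination a 2 * h2 - b 2 * h1
      · linear_combination b 0 * h1 - a 0 * h2
  · refine ⟨n 0 / (a 1 * b 2 - a 2 * b 1), ?_, ?_, ?_⟩ <;> field_simp
    · linear_combination b 2 * h1 - a 2 * h2
    · linear_combination a 1 * h2 - b 1 * h1

set_option maxHeartbeats 1000000 in
theorem inT_of_infl (h3 : (3 : K) ≠ 0) {l : K} (hl : l ^ 3 ≠ 1) {w : Fin 3 → K}
    (h : IsInflLine (hesse l) w) : InT l w := by
  obtain ⟨hw, a, b, wa, wb, hab, hne, hc⟩ := h
  have hc := infl_coeffs hc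
  have c0 := hc 0 (by norm_num)
  have c1 := hc 1 (by norm_num)
  have c2 := hc 2 (by norm_num)
  rw [hesse, lr_cubic] at c0 c1 c2
  rw [cf0, eval_cubic] at c0
  rw [cf1] at c1
  rw [cf2] at c2
  set n : Fin 3 → K := ![a 0 ^ 2 - l * a 1 * a 2, a 1 ^ 2 - l * a 0 * a 2,
    a 2 ^ 2 - l * a 0 * a 1] with hn
  have na : dotv n a = 0 := by
    simp only [dotv, Fin.sum_univ_three, hn, Matrix.cons_val]
    linear_combination c0
  have nb : dotv n b = 0 := by
    have : 3 * dotv n b = 0 := by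
      simp only [dotv, Fin.sum_univ_three, hn, Matrix.cons_val]
      linear_combination c1
    simpa [h3] using this
  have c2' : a 0 * b 0 ^ 2 + a 1 * b 1 ^ 2 + a 2 * b 2 ^ 2 - l * (a 2 * b 0 * b 1
      + a 1 * b 0 * b 2 + a 0 * b 1 * b 2) = 0 := by
    have : 3 * (a 0 * b 0 ^ 2 + a 1 * b 1 ^ 2 + a 2 * b 2 ^ 2 - l * (a 2 * b 0 * b 1
      + a 1 * b 0 * b 2 + a 0 * b 1 * b 2)) = 0 := by linear_combination c2
    simpa [h3] using this
  obtain ⟨r, r0, r1, r2⟩ := perp_cross hab na nb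
  obtain ⟨q, q0, q1, q2⟩ := perp_cross hab wa wb
  simp only [hn, Matrix.cons_val] at r0 r1 r2
  have hQ : a 1 * (r * (a 0 * b 1 - a 1 * b 0)) ^ 2 + a 2 * (r * (a 2 * b 0 - a 0 * b 2)) ^ 2
      + l * a 0 * (r * (a 0 * b 1 - a 1 * b 0)) * (r * (a 2 * b 0 - a 0 * b 2)) = 0 := by
    simp only [dotv, Fin.sum_univ_three, hn, Matrix.cons_val] at nb
    linear_combination r ^ 2 * a 0 ^ 2 * c2' + r ^ 2 * b 0 ^ 2 * c0 - 2 * r ^ 2 * a 0 * b 0 * nb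
  rw [← r1, ← r2] at hQ
  have hxyz : a 0 ^ 3 * a 1 * a 2 * (l ^ 3 - 1) = 0 := by
    linear_combination hQ - a 1 * a 2 * c0
  have hq : q ≠ 0 := by
    rintro rfl
    apply hw; ext i; fin_cases i
    · simpa using q0
    · simpa using q1
    · simpa using q2
  have hl' : l ^ 3 - 1 ≠ 0 := sub_ne_zero.2 hl
  have ha : a ≠ 0 := by
    have := hab.ne_zero 0; simpa using this
  have hcase : a 0 = 0 ∨ a 1 = 0 ∨ a 2 = 0 := by
    by_contra! hh
    exact mul_ne_zero (mul_ne_zero (mul_ne_zero (pow_ne_zero 3 hh.1) hh.2.1) hh.2.2) hl' hxyz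
  have fin : ∀ A B : K, A ^ 3 + B ^ 3 = 0 → (A ≠ 0 ∨ B ≠ 0) → A ≠ 0 ∧ B ≠ 0 := by
    intro A B hAB hor
    constructor
    · rintro rfl; simp at hAB hor; exact hor hAB
    · rintro rfl; simp at hAB hor; exact hor hAB
  have hr : ∀ j, n j ≠ 0 → r ≠ 0 := by
    rintro j hj rfl
    apply hj
    fin_cases j
    · simp [hn]; linear_combination r0
    · simp [hn]; linear_combination r1
    · simp [hn]; linear_combination r2
  have hwq : ∀ i, r * w i = q * n i := by
    intro i; fin_cases i
    · simp [hn]; rw [q0, r0]; ring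
    · simp [hn]; rw [q1, r1]; ring
    · simp [hn]; rw [q2, r2]; ring
  have w0 := hwq 0
  have w1 := hwq 1
  have w2 := hwq 2
  simp only [hn, Matrix.cons_val] at w0 w1 w2
  rcases hcase with h0 | h0 | h0
  · rw [h0] at c0 w0 w1 w2
    have e0 : a 1 ^ 3 + a 2 ^ 3 = 0 := by linear_combination c0
    obtain ⟨hA, hB⟩ := fin _ _ e0 (by
      by_contra! hh; apply ha; ext i; fin_cases i
      · exact h0
      · exact hh.1
      · exact hh.2)
    have hr0 : r ≠ 0 := hr 1 (by simp [hn, h0, hA])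
    refine ⟨- a 1 * a 2 * q / r, - a 1 / a 2, by simp [hA, hB, hq, hr0], ?_, Or.inl ?_⟩
    · field_simp; linear_combination -e0
    · ext i; fin_cases i
      · simp; field_simp; linear_combination w0
      · simp; field_simp; linear_combination w1
      · simp; field_simp; linear_combination a 2 * w2 + q * e0
  · rw [h0] at c0 w0 w1 w2
    have e0 : a 2 ^ 3 + a 0 ^ 3 = 0 := by linear_combination c0
    obtain ⟨hA, hB⟩ := fin _ _ e0 (by
      by_contra! hh; apply ha; ext i; fin_cases i
      · exact hh.2
      · exact h0
      · exact hh.1)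
    have hr0 : r ≠ 0 := hr 2 (by simp [hn, h0, hA])
    refine ⟨- a 2 * a 0 * q / r, - a 2 / a 0, by simp [hA, hB, hq, hr0], ?_, Or.inr (Or.inl ?_)⟩
    · field_simp; linear_combination -e0
    · ext i; fin_cases i
      · simp; field_simp; linear_combination a 0 * w0 + q * e0
      · simp; field_simp; linear_combination w1
      · simp; field_simp; linear_combination w2
  · rw [h0] at c0 w0 w1 w2
    have e0 : a 0 ^ 3 + a 1 ^ 3 = 0 := by linear_combination c0
    obtain ⟨hA, hB⟩ := fin _ _ e0 (by
      by_contra! hh; apply ha; ext i; fin_cases i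
      · exact hh.1
      · exact hh.2
      · exact h0)
    have hr0 : r ≠ 0 := hr 0 (by simp [hn, h0, hA])
    refine ⟨- a 0 * a 1 * q / r, - a 0 / a 1, by simp [hA, hB, hq, hr0], ?_, Or.inr (Or.inr ?_)⟩
    · field_simp; linear_combination -e0
    · ext i; fin_cases i
      · simp; field_simp; linear_combination w0
      · simp; field_simp; linear_combination a 1 * w1 + q * e0
      · simp; field_simp; linear_combination w2

/-- The three conics of the sextic `pG`. -/
def fG {R : Type*} [CommRing R] (l x y z : R) : R :=
  (l * x ^ 2 - y * z) * (l * y ^ 2 - z * x) * (l * z ^ 2 - x * y)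

def fD {R : Type*} [CommRing R] (l x y z : R) : R :=
  (x ^ 3 + y ^ 3 + z ^ 3) ^ 2 - 2 * (l ^ 3 + 2) * (x ^ 3 * y ^ 3 + y ^ 3 * z ^ 3 + z ^ 3 * x ^ 3)
    + 3 * l * (l ^ 3 + 2) * (x * y * z) ^ 2 - 6 * l * fG l x y z

def pG (l : K) : MvPolynomial (Fin 3) K :=
  fG (MvPolynomial.C l) (MvPolynomial.X 0) (MvPolynomial.X 1) (MvPolynomial.X 2)

def pD (l : K) : MvPolynomial (Fin 3) K :=
  fD (MvPolynomial.C l) (MvPolynomial.X 0) (MvPolynomial.X 1) (MvPolynomial.X 2)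

theorem aeval_pG {A : Type*} [CommRing A] [Algebra K A] (l : K) (γ : Fin 3 → A) :
    MvPolynomial.aeval γ (pG l) = fG (algebraMap K A l) (γ 0) (γ 1) (γ 2) := by
  simp [pG, fG]

theorem aeval_pD {A : Type*} [CommRing A] [Algebra K A] (l : K) (γ : Fin 3 → A) :
    MvPolynomial.aeval γ (pD l) = fD (algebraMap K A l) (γ 0) (γ 1) (γ 2) := by
  simp [pD, fD, fG]

theorem eval_pG (l : K) (γ : Fin 3 → K) :
    MvPolynomial.eval γ (pG l) = fG l (γ 0) (γ 1) (γ 2) := by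
  simp [pG, fG]

theorem eval_pD (l : K) (γ : Fin 3 → K) :
    MvPolynomial.eval γ (pD l) = fD l (γ 0) (γ 1) (γ 2) := by
  simp [pD, fD, fG]

theorem homog_aux (l : K) (i j k : Fin 3) :
    (MvPolynomial.C l * MvPolynomial.X i ^ 2 - MvPolynomial.X j * MvPolynomial.X k :
      MvPolynomial (Fin 3) K).IsHomogeneous 2 := by
  apply MvPolynomial.IsHomogeneous.sub
  · simpa using (MvPolynomial.isHomogeneous_C (Fin 3) l).mul (MvPolynomial.isHomogeneous_X_pow i 2)
  · exact (MvPolynomial.isHomogeneous_X K j).mul (MvPolynomial.isHomogeneous_X K k)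

theorem homog_pG (l : K) : (pG l).IsHomogeneous 6 :=
  ((homog_aux l 0 1 2).mul (homog_aux l 1 2 0)).mul (homog_aux l 2 0 1)

theorem homog_pD (l : K) : (pD l).IsHomogeneous 6 := by
  have hX : ∀ i : Fin 3, (MvPolynomial.X i ^ 3 : MvPolynomial (Fin 3) K).IsHomogeneous 3 :=
    fun i => MvPolynomial.isHomogeneous_X_pow i 3
  have hC : ∀ (r : K) {P : MvPolynomial (Fin 3) K}, P.IsHomogeneous 6 →
      (MvPolynomial.C r * P).IsHomogeneous 6 := fun r P hP => by
    simpa using (MvPolynomial.isHomogeneous_C (Fin 3) r).mul hP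
  have e : pD l = (MvPolynomial.X 0 ^ 3 + MvPolynomial.X 1 ^ 3 + MvPolynomial.X 2 ^ 3) ^ 2
      - MvPolynomial.C (2 * (l ^ 3 + 2)) * (MvPolynomial.X 0 ^ 3 * MvPolynomial.X 1 ^ 3
        + MvPolynomial.X 1 ^ 3 * MvPolynomial.X 2 ^ 3 + MvPolynomial.X 2 ^ 3 * MvPolynomial.X 0 ^ 3)
      + MvPolynomial.C (3 * l * (l ^ 3 + 2)) * (MvPolynomial.X 0 * MvPolynomial.X 1
        * MvPolynomial.X 2) ^ 2 - MvPolynomial.C (6 * l) * pG l := by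
    simp only [pD, fD, pG, map_mul, map_add, map_pow, map_ofNat]
  rw [e]
  refine ((MvPolynomial.IsHomogeneous.sub ?_ (hC _ ?_)).add (hC _ ?_)).sub (hC _ (homog_pG l))
  · exact (((hX 0).add (hX 1)).add (hX 2)).pow 2
  · exact ((((hX 0).mul (hX 1)).add ((hX 1).mul (hX 2))).add ((hX 2).mul (hX 0)))
  · exact (((MvPolynomial.isHomogeneous_X K 0).mul (MvPolynomial.isHomogeneous_X K 1)).mul
      (MvPolynomial.isHomogeneous_X K 2)).pow 2

theorem fD_rot {R : Type*} [CommRing R] (l x y z : R) : fD l x y z = fD l y z x := by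
  simp only [fD, fG]; ring

theorem fG_rot {R : Type*} [CommRing R] (l x y z : R) : fG l x y z = fG l y z x := by
  simp only [fG]; ring

theorem fD_tors {R : Type*} [CommRing R] (l x y z η : R) (h : η ^ 3 = 1) :
    fD l x (η * y) (η ^ 2 * z) = fD l x y z := by
  have e1 : (η * y) ^ 3 = y ^ 3 := by linear_combination y ^ 3 * h
  have e2 : (η ^ 2 * z) ^ 3 = z ^ 3 := by linear_combination (η ^ 3 + 1) * z ^ 3 * h
  have e3 : x * (η * y) * (η ^ 2 * z) = x * y * z := by linear_combination x * y * z * h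
  have hg : ∀ x y z : R, fG l x y z = l * (x * y * z) * (x ^ 3 + y ^ 3 + z ^ 3)
    - l ^ 2 * (x ^ 3 * y ^ 3 + y ^ 3 * z ^ 3 + z ^ 3 * x ^ 3) + (l ^ 3 - 1) * (x * y * z) ^ 2 := by
    intro x y z; simp only [fG]; ring
  simp only [fD, hg]
  rw [e1, e2, e3]

theorem fG_tors {R : Type*} [CommRing R] (l x y z η : R) (h : η ^ 3 = 1) :
    fG l x (η * y) (η ^ 2 * z) = fG l x y z := by
  have e1 : (η * y) ^ 3 = y ^ 3 := by linear_combination y ^ 3 * h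
  have e2 : (η ^ 2 * z) ^ 3 = z ^ 3 := by linear_combination (η ^ 3 + 1) * z ^ 3 * h
  have e3 : x * (η * y) * (η ^ 2 * z) = x * y * z := by linear_combination x * y * z * h
  have hg : ∀ x y z : R, fG l x y z = l * (x * y * z) * (x ^ 3 + y ^ 3 + z ^ 3)
    - l ^ 2 * (x ^ 3 * y ^ 3 + y ^ 3 * z ^ 3 + z ^ 3 * x ^ 3) + (l ^ 3 - 1) * (x * y * z) ^ 2 := by
    intro x y z; simp only [fG]; ring
  simp only [hg]
  rw [e1, e2, e3]

theorem tr_mul {R : Type*} [CommRing R] {t A B a0 a1 a2 b0 b1 b2 : R}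
    (hA : ∃ r, A = a0 + a1 * t + a2 * t ^ 2 + r * t ^ 3)
    (hB : ∃ r, B = b0 + b1 * t + b2 * t ^ 2 + r * t ^ 3) :
    ∃ r, A * B = (a0 * b0) + (a0 * b1 + a1 * b0) * t + (a0 * b2 + a1 * b1 + a2 * b0) * t ^ 2
      + r * t ^ 3 := by
  obtain ⟨r, rfl⟩ := hA
  obtain ⟨q, rfl⟩ := hB
  exact ⟨a0 * q + r * b0 + a1 * b2 + a2 * b1 + (a1 * q + r * b1 + a2 * b2) * t
    + (a2 * q + r * b2) * t ^ 2 + r * q * t ^ 3, by ring⟩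

theorem tr_cube {R : Type*} [CommRing R] (x a t : R) :
    ∃ r, (x + a * t) ^ 3 = x ^ 3 + (3 * x ^ 2 * a) * t + (3 * x * a ^ 2) * t ^ 2 + r * t ^ 3 :=
  ⟨a ^ 3, by ring⟩

theorem fG_expand {R : Type*} [CommRing R] (l s a b c t : R) : ∃ r,
    fG l (s * l + a * t) (s + b * t) (s + c * t) =
      (s ^ 4 * (l ^ 3 - 1) * (a + l * c - 2 * l * b) * (a + l * b - 2 * l * c)) * t ^ 2
        + r * t ^ 3 := by
  have key : ∀ u0 u1 v0 v1 w0 w1 : R, (w0 + w1 * t) * (t * (u0 + u1 * t)) * (t * (v0 + v1 * t)) =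
      (w0 * u0 * v0) * t ^ 2 +
        (u1 * (v0 + v1 * t) * (w0 + w1 * t) + u0 * v1 * (w0 + w1 * t) + u0 * v0 * w1) * t ^ 3 := by
    intros; ring
  have k := key (s * (2 * l * b - a - l * c)) (l * b ^ 2 - a * c)
    (s * (2 * l * c - a - l * b)) (l * c ^ 2 - a * b) (s ^ 2 * (l ^ 3 - 1))
    (s * (2 * l ^ 2 * a - b - c) + (l * a ^ 2 - b * c) * t)
  rw [show s ^ 2 * (l ^ 3 - 1) * (s * (2 * l * b - a - l * c)) * (s * (2 * l * c - a - l * b)) =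
    s ^ 4 * (l ^ 3 - 1) * (a + l * c - 2 * l * b) * (a + l * b - 2 * l * c) by ring] at k
  refine ⟨_, Eq.trans ?_ k⟩
  simp only [fG]
  congr 1
  · congr 1 <;> ring
  · ring

theorem fD_expand {R : Type*} [CommRing R] (l s a b c t : R) : ∃ r,
    fD l (s * l + a * t) (s + b * t) (s + c * t) =
      (9 * s ^ 4 * (l ^ 3 - 1) ^ 2 * (b - c) ^ 2) * t ^ 2 + r * t ^ 3 := by
  obtain ⟨g, hg⟩ := fG_expand l s a b c t
  have hx := tr_cube (s * l) a t
  have hy := tr_cube s b t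
  have hz := tr_cube s c t
  obtain ⟨r1, h1⟩ := tr_mul hx hy
  obtain ⟨r2, h2⟩ := tr_mul hy hz
  obtain ⟨r3, h3⟩ := tr_mul hz hx
  have hp : ∃ r, (s * l + a * t) * (s + b * t) * (s + c * t) = s ^ 3 * l
      + (s ^ 2 * (a + l * b + l * c)) * t + (s * (a * b + a * c + l * b * c)) * t ^ 2 + r * t ^ 3 :=
    ⟨a * b * c, by ring⟩
  obtain ⟨r4, h4⟩ := tr_mul hp hp
  have hE : ∃ r, (s * l + a * t) ^ 3 + (s + b * t) ^ 3 + (s + c * t) ^ 3 = s ^ 3 * (l ^ 3 + 2)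
      + (3 * s ^ 2 * (l ^ 2 * a + b + c)) * t + (3 * s * (l * a ^ 2 + b ^ 2 + c ^ 2)) * t ^ 2
      + r * t ^ 3 := ⟨a ^ 3 + b ^ 3 + c ^ 3, by ring⟩
  obtain ⟨r5, h5⟩ := tr_mul hE hE
  refine ⟨r5 - 2 * (l ^ 3 + 2) * (r1 + r2 + r3) + 3 * l * (l ^ 3 + 2) * r4 - 6 * l * g, ?_⟩
  unfold fD
  rw [hg]
  rw [pow_two (_ + _ + _), h5, h1, h2, h3, pow_two (_ * _ * _), h4]
  ring

theorem core_D (l s η v0 v1 v2 : K) (h : η ^ 3 = 1) : ∃ R : Polynomial K,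
    fD (Polynomial.C l) (Polynomial.C (s * l) + Polynomial.C v0 * Polynomial.X)
      (Polynomial.C (s * η) + Polynomial.C v1 * Polynomial.X)
      (Polynomial.C (s * η ^ 2) + Polynomial.C v2 * Polynomial.X) =
    Polynomial.C (9 * s ^ 4 * (l ^ 3 - 1) ^ 2 * (η ^ 2 * v1 - η * v2) ^ 2) * Polynomial.X ^ 2
      + R * Polynomial.X ^ 3 := by
  have h' : (Polynomial.C η) ^ 3 = 1 := by rw [← Polynomial.C_pow, h, Polynomial.C_1]
  obtain ⟨r, e⟩ := fD_expand (Polynomial.C l) (Polynomial.C s) (Polynomial.C v0)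
    (Polynomial.C (η ^ 2 * v1)) (Polynomial.C (η * v2)) Polynomial.X
  rw [← fD_tors _ _ _ _ (Polynomial.C η) h'] at e
  refine ⟨r, Eq.trans ?_ (e.trans ?_)⟩
  · congr 1
    · simp
    · simp only [map_mul, map_pow]; linear_combination (- Polynomial.C v1 * Polynomial.X) * h'
    · simp only [map_mul, map_pow]; linear_combination (- Polynomial.C v2 * Polynomial.X) * h'
  · simp only [map_mul, map_add, map_sub, map_pow, map_ofNat, map_one]

theorem core_G (l s η v0 v1 v2 : K) (h : η ^ 3 = 1) : ∃ R : Polynomial K,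
    fG (Polynomial.C l) (Polynomial.C (s * l) + Polynomial.C v0 * Polynomial.X)
      (Polynomial.C (s * η) + Polynomial.C v1 * Polynomial.X)
      (Polynomial.C (s * η ^ 2) + Polynomial.C v2 * Polynomial.X) =
    Polynomial.C (s ^ 4 * (l ^ 3 - 1) * (v0 + l * (η * v2) - 2 * l * (η ^ 2 * v1)) *
      (v0 + l * (η ^ 2 * v1) - 2 * l * (η * v2))) * Polynomial.X ^ 2
      + R * Polynomial.X ^ 3 := by
  have h' : (Polynomial.C η) ^ 3 = 1 := by rw [← Polynomial.C_pow, h, Polynomial.C_1]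
  obtain ⟨r, e⟩ := fG_expand (Polynomial.C l) (Polynomial.C s) (Polynomial.C v0)
    (Polynomial.C (η ^ 2 * v1)) (Polynomial.C (η * v2)) Polynomial.X
  rw [← fG_tors _ _ _ _ (Polynomial.C η) h'] at e
  refine ⟨r, Eq.trans ?_ (e.trans ?_)⟩
  · congr 1
    · simp
    · simp only [map_mul, map_pow]; linear_combination (- Polynomial.C v1 * Polynomial.X) * h'
    · simp only [map_mul, map_pow]; linear_combination (- Polynomial.C v2 * Polynomial.X) * h'
  · simp only [map_mul, map_add, map_sub, map_pow, map_ofNat, map_one]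

theorem coeff_aux (c : K) (R : Polynomial K) :
    (Polynomial.C c * Polynomial.X ^ 2 + R * Polynomial.X ^ 3).coeff 0 = 0 ∧
    (Polynomial.C c * Polynomial.X ^ 2 + R * Polynomial.X ^ 3).coeff 1 = 0 ∧
    (Polynomial.C c * Polynomial.X ^ 2 + R * Polynomial.X ^ 3).coeff 2 = c := by
  refine ⟨?_, ?_, ?_⟩ <;>
    simp [Polynomial.coeff_mul_X_pow', Polynomial.coeff_X_pow]

theorem lr_pD (l : K) (w v : Fin 3 → K) : lineRestrict (pD l) w v =
    fD (Polynomial.C l) (Polynomial.C (w 0) + Polynomial.C (v 0) * Polynomial.X)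
      (Polynomial.C (w 1) + Polynomial.C (v 1) * Polynomial.X)
      (Polynomial.C (w 2) + Polynomial.C (v 2) * Polynomial.X) := by
  rw [lineRestrict, aeval_pD]; rfl

theorem lr_pG (l : K) (w v : Fin 3 → K) : lineRestrict (pG l) w v =
    fG (Polynomial.C l) (Polynomial.C (w 0) + Polynomial.C (v 0) * Polynomial.X)
      (Polynomial.C (w 1) + Polynomial.C (v 1) * Polynomial.X)
      (Polynomial.C (w 2) + Polynomial.C (v 2) * Polynomial.X) := by
  rw [lineRestrict, aeval_pG]; rfl

theorem sing_pD {l : K} {w : Fin 3 → K} (h : InT l w) : SingAt (pD l) w := by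
  rw [singAt_iff]
  intro v
  obtain ⟨s, η, hs, hη, rfl | rfl | rfl⟩ := h
  · obtain ⟨R, hR⟩ := core_D l s η (v 0) (v 1) (v 2) hη
    rw [lr_pD]; simp only [Matrix.cons_val]; rw [hR]
    exact ⟨(coeff_aux _ R).1, (coeff_aux _ R).2.1⟩
  · obtain ⟨R, hR⟩ := core_D l s η (v 1) (v 2) (v 0) hη
    rw [lr_pD]; simp only [Matrix.cons_val]; rw [fD_rot, hR]
    exact ⟨(coeff_aux _ R).1, (coeff_aux _ R).2.1⟩
  · obtain ⟨R, hR⟩ := core_D l s η (v 2) (v 0) (v 1) hη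
    rw [lr_pD]; simp only [Matrix.cons_val]; rw [fD_rot, fD_rot, hR]
    exact ⟨(coeff_aux _ R).1, (coeff_aux _ R).2.1⟩

theorem sing_pG {l : K} {w : Fin 3 → K} (h : InT l w) : SingAt (pG l) w := by
  rw [singAt_iff]
  intro v
  obtain ⟨s, η, hs, hη, rfl | rfl | rfl⟩ := h
  · obtain ⟨R, hR⟩ := core_G l s η (v 0) (v 1) (v 2) hη
    rw [lr_pG]; simp only [Matrix.cons_val]; rw [hR]
    exact ⟨(coeff_aux _ R).1, (coeff_aux _ R).2.1⟩
  · obtain ⟨R, hR⟩ := core_G l s η (v 1) (v 2) (v 0) hη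
    rw [lr_pG]; simp only [Matrix.cons_val]; rw [fG_rot, hR]
    exact ⟨(coeff_aux _ R).1, (coeff_aux _ R).2.1⟩
  · obtain ⟨R, hR⟩ := core_G l s η (v 2) (v 0) (v 1) hη
    rw [lr_pG]; simp only [Matrix.cons_val]; rw [fG_rot, fG_rot, hR]
    exact ⟨(coeff_aux _ R).1, (coeff_aux _ R).2.1⟩

theorem tangent_aux (h3 : (3 : K) ≠ 0) {l s η : K} (hl : l ^ 3 ≠ 1) (hs : s ≠ 0) (hη : η ^ 3 = 1)
    (v0 v1 v2 : K)
    (hD : 9 * s ^ 4 * (l ^ 3 - 1) ^ 2 * (η ^ 2 * v1 - η * v2) ^ 2 = 0)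
    (hG : s ^ 4 * (l ^ 3 - 1) * (v0 + l * (η * v2) - 2 * l * (η ^ 2 * v1)) *
      (v0 + l * (η ^ 2 * v1) - 2 * l * (η * v2)) = 0) :
    ∃ r : K, v0 = r * (s * l) ∧ v1 = r * (s * η) ∧ v2 = r * (s * η ^ 2) := by
  have hl' : l ^ 3 - 1 ≠ 0 := sub_ne_zero.2 hl
  have h9 : (9 : K) ≠ 0 := by rw [show (9 : K) = 3 * 3 by norm_num]; exact mul_ne_zero h3 h3
  have e1 : η ^ 2 * v1 - η * v2 = 0 := by simpa [h9, hs, hl'] using hD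
  have e2 : v0 = l * (η ^ 2 * v1) := by
    have : s ^ 4 * (l ^ 3 - 1) * (v0 - l * (η ^ 2 * v1)) ^ 2 = 0 := by
      have e3 : η * v2 = η ^ 2 * v1 := by linear_combination - e1
      rw [e3] at hG; linear_combination hG
    have : v0 - l * (η ^ 2 * v1) = 0 := by simpa [hs, hl'] using this
    linear_combination this
  refine ⟨η ^ 2 * v1 / s, ?_, ?_, ?_⟩
  · field_simp; linear_combination e2
  · field_simp; linear_combination - v1 * hη
  · field_simp; linear_combination -η ^ 2 * e1 - v2 * hη

theorem tangent (h3 : (3 : K) ≠ 0) {l : K} (hl : l ^ 3 ≠ 1) {w v : Fin 3 → K} (h : InT l w)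
    (hv : LinearIndependent K ![w, v]) :
    (lineRestrict (pD l) w v).coeff 2 ≠ 0 ∨ (lineRestrict (pG l) w v).coeff 2 ≠ 0 := by
  by_contra! hcon
  obtain ⟨hD, hG⟩ := hcon
  rw [LinearIndependent.pair_iff] at hv
  have fin : ∀ r : K, ¬ (∀ i, v i = r * w i) := by
    intro r hr
    have := hv r (-1) (by ext i; simp [hr i])
    simp at this
  obtain ⟨s, η, hs, hη, rfl | rfl | rfl⟩ := h
  · obtain ⟨R, hR⟩ := core_D l s η (v 0) (v 1) (v 2) hη
    obtain ⟨R', hR'⟩ := core_G l s η (v 0) (v 1) (v 2) hη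
    rw [lr_pD] at hD; simp only [Matrix.cons_val] at hD; rw [hR, (coeff_aux _ R).2.2] at hD
    rw [lr_pG] at hG; simp only [Matrix.cons_val] at hG; rw [hR', (coeff_aux _ R').2.2] at hG
    obtain ⟨r, h0, h1, h2⟩ := tangent_aux h3 hl hs hη _ _ _ hD hG
    refine fin r (fun i => ?_)
    fin_cases i
    · exact h0
    · exact h1
    · exact h2
  · obtain ⟨R, hR⟩ := core_D l s η (v 1) (v 2) (v 0) hη
    obtain ⟨R', hR'⟩ := core_G l s η (v 1) (v 2) (v 0) hη
    rw [lr_pD] at hD; simp only [Matrix.cons_val] at hD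
    rw [fD_rot, hR, (coeff_aux _ R).2.2] at hD
    rw [lr_pG] at hG; simp only [Matrix.cons_val] at hG
    rw [fG_rot, hR', (coeff_aux _ R').2.2] at hG
    obtain ⟨r, h0, h1, h2⟩ := tangent_aux h3 hl hs hη _ _ _ hD hG
    refine fin r (fun i => ?_)
    fin_cases i
    · exact h2
    · exact h0
    · exact h1
  · obtain ⟨R, hR⟩ := core_D l s η (v 2) (v 0) (v 1) hη
    obtain ⟨R', hR'⟩ := core_G l s η (v 2) (v 0) (v 1) hη
    rw [lr_pD] at hD; simp only [Matrix.cons_val] at hD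
    rw [fD_rot, fD_rot, hR, (coeff_aux _ R).2.2] at hD
    rw [lr_pG] at hG; simp only [Matrix.cons_val] at hG
    rw [fG_rot, fG_rot, hR', (coeff_aux _ R').2.2] at hG
    obtain ⟨r, h0, h1, h2⟩ := tangent_aux h3 hl hs hη _ _ _ hD hG
    refine fin r (fun i => ?_)
    fin_cases i
    · exact h1
    · exact h2
    · exact h0

/-- The base points of the pencil spanned by the two sextics are the inflection lines. -/
theorem base_points {l x y z : K} (hne : ¬ (x = 0 ∧ y = 0 ∧ z = 0))
    (hD : fD l x y z = 0) (hG : fG l x y z = 0) : InT l ![x, y, z] := by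
  have hsq : (l * (x ^ 3 + y ^ 3 + z ^ 3) - (l ^ 3 + 2) * (x * y * z)) ^ 2 = 0 := by
    simp only [fD, fG] at hD hG
    linear_combination l ^ 2 * hD + (6 * l ^ 3 - 2 * (l ^ 3 + 2)) * hG
  have h1 : l * (x ^ 3 + y ^ 3 + z ^ 3) = (l ^ 3 + 2) * (x * y * z) := by
    have := pow_eq_zero_iff (two_ne_zero) |>.1 hsq
    linear_combination this
  have h2 : l ^ 2 * (x ^ 3 * y ^ 3 + y ^ 3 * z ^ 3 + z ^ 3 * x ^ 3)
      = (2 * l ^ 3 + 1) * (x * y * z) ^ 2 := by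
    simp only [fG] at hG
    linear_combination - hG + (x * y * z) * h1
  by_cases hl : l = 0
  · subst hl
    have ha : x * y * z = 0 := by
      have : (x * y * z) ^ 2 = 0 := by linear_combination - h2
      exact pow_eq_zero_iff (two_ne_zero) |>.1 this
    have key : ∀ A B : K, A ≠ 0 ∨ B ≠ 0 → (A ^ 3 - B ^ 3) ^ 2 = 0 → A ≠ 0 ∧ B ≠ 0 ∧ B ^ 3 = A ^ 3 := by
      intro A B hAB h
      have h' : A ^ 3 - B ^ 3 = 0 := pow_eq_zero_iff (two_ne_zero) |>.1 h
      refine ⟨?_, ?_, by linear_combination - h'⟩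
      · rintro rfl; simp at h' hAB; exact hAB h'
      · rintro rfl; simp at h' hAB; exact hAB h'
    simp only [mul_eq_zero, or_assoc] at ha
    simp only [fD] at hD
    rcases ha with rfl | rfl | rfl
    · obtain ⟨hA, hB, e⟩ := key y z (by by_contra! hh; exact hne ⟨rfl, hh.1, hh.2⟩)
        (by linear_combination hD)
      refine ⟨y ^ 2 / z, z / y, by simp [hA, hB], by field_simp; exact e, Or.inl ?_⟩
      ext i; fin_cases i <;> simp <;> field_simp
    · obtain ⟨hA, hB, e⟩ := key z x (by by_contra! hh; exact hne ⟨hh.2, rfl, hh.1⟩)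
        (by linear_combination hD)
      refine ⟨z ^ 2 / x, x / z, by simp [hA, hB], by field_simp; exact e, Or.inr (Or.inl ?_)⟩
      ext i; fin_cases i <;> simp <;> field_simp
    · obtain ⟨hA, hB, e⟩ := key x y (by by_contra! hh; exact hne ⟨hh.1, hh.2, rfl⟩)
        (by linear_combination hD)
      refine ⟨x ^ 2 / y, y / x, by simp [hA, hB], by field_simp; exact e, Or.inr (Or.inr ?_)⟩
      ext i; fin_cases i <;> simp <;> field_simp
  · have hroot : ∀ X Y Z : K, l * (X ^ 3 + Y ^ 3 + Z ^ 3) = (l ^ 3 + 2) * (X * Y * Z) →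
        l ^ 2 * (X ^ 3 * Y ^ 3 + Y ^ 3 * Z ^ 3 + Z ^ 3 * X ^ 3) = (2 * l ^ 3 + 1) * (X * Y * Z) ^ 2 →
        (l * X ^ 3 - l ^ 3 * (X * Y * Z)) * (l * X ^ 3 - X * Y * Z) ^ 2 = 0 := by
      intro X Y Z g1 g2
      linear_combination (l * X ^ 3) ^ 2 * g1 - l * X ^ 3 * g2
    have ha : x * y * z ≠ 0 := by
      intro ha
      have e1 := hroot x y z h1 h2
      have e2 := hroot y z x (by linear_combination h1) (by linear_combination h2)
      have e3 := hroot z x y (by linear_combination h1) (by linear_combination h2)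
      rw [show y * z * x = x * y * z by ring] at e2
      rw [show z * x * y = x * y * z by ring] at e3
      rw [ha] at e1 e2 e3
      simp [hl] at e1 e2 e3
      exact hne ⟨e1, e2, e3⟩
    have hx : x ≠ 0 := by rintro rfl; simp at ha
    have hy : y ≠ 0 := by rintro rfl; simp at ha
    have hz : z ≠ 0 := by rintro rfl; simp at ha
    have fin : ∀ X Y Z : K, X ≠ 0 → Y ≠ 0 → l * X ^ 3 = l ^ 3 * (X * Y * Z) →
        l * Y ^ 3 = X * Y * Z → X / l ≠ 0 ∧ (l * Y / X) ^ 3 = 1 ∧ X = X / l * l ∧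
          Y = X / l * (l * Y / X) ∧ Z = X / l * (l * Y / X) ^ 2 := by
      intro X Y Z hX hY g1 g2
      refine ⟨div_ne_zero hX hl, ?_, by field_simp, by field_simp, ?_⟩
      · field_simp
        have : l * (l ^ 3 * Y ^ 3) = l * X ^ 3 := by linear_combination l ^ 3 * g2 - g1
        simpa [hl] using this
      · field_simp
        have : Y * (Z * X) = Y * (l * Y ^ 2) := by linear_combination - g2
        simpa [hY] using this
    -- the case `l x^3 = l^3 xyz`
    have caseA : ∀ X Y Z : K, X * Y * Z ≠ 0 →
        l * (X ^ 3 + Y ^ 3 + Z ^ 3) = (l ^ 3 + 2) * (X * Y * Z) →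
        l * X ^ 3 = l ^ 3 * (X * Y * Z) → l * Y ^ 3 = X * Y * Z ∧ l * Z ^ 3 = X * Y * Z := by
      intro X Y Z hne g1 g3
      have hX3 : X ^ 3 = l ^ 2 * (X * Y * Z) := by
        have : l * (X ^ 3) = l * (l ^ 2 * (X * Y * Z)) := by linear_combination g3
        simpa [hl] using this
      have hYZ : l ^ 2 * (Y ^ 3 * Z ^ 3) = (X * Y * Z) ^ 2 := by
        have : (X * Y * Z) * (l ^ 2 * (Y ^ 3 * Z ^ 3)) = (X * Y * Z) * (X * Y * Z) ^ 2 := by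
          linear_combination - Y ^ 3 * Z ^ 3 * hX3
        exact mul_left_cancel₀ hne this
      have e : (l * Y ^ 3 - X * Y * Z) ^ 2 = 0 := by
        linear_combination l * Y ^ 3 * (g1 - g3) - hYZ
      have e' : l * Y ^ 3 - X * Y * Z = 0 := pow_eq_zero_iff (two_ne_zero) |>.1 e
      exact ⟨by linear_combination e', by linear_combination g1 - g3 - e'⟩
    have hone : l * x ^ 3 = l ^ 3 * (x * y * z) ∨ l * y ^ 3 = l ^ 3 * (x * y * z) ∨
        l * z ^ 3 = l ^ 3 * (x * y * z) := by
      by_contra! hh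
      have f1 : l * x ^ 3 = x * y * z := by
        have := hroot x y z h1 h2
        rcases mul_eq_zero.1 this with g | g
        · exact absurd (by linear_combination g) hh.1
        · have := pow_eq_zero_iff (two_ne_zero) |>.1 g
          linear_combination this
      have f2 : l * y ^ 3 = x * y * z := by
        have := hroot y z x (by linear_combination h1) (by linear_combination h2)
        rcases mul_eq_zero.1 this with g | g
        · exact absurd (by linear_combination g) hh.2.1
        · have := pow_eq_zero_iff (two_ne_zero) |>.1 g
          linear_combination this
      exact hh.2.2 (by linear_combination h1 - f1 - f2)
    rcases hone with g | g | g
    · obtain ⟨g2, g3⟩ := caseA x y z ha h1 g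
      obtain ⟨k1, k2, k3, k4, k5⟩ := fin x y z hx hy g g2
      refine ⟨x / l, l * y / x, k1, k2, Or.inl ?_⟩
      rw [← k3, ← k4, ← k5]
    · obtain ⟨g2, g3⟩ := caseA y z x (by rw [show y * z * x = x * y * z by ring]; exact ha)
        (by linear_combination h1) (by linear_combination g)
      obtain ⟨k1, k2, k3, k4, k5⟩ := fin y z x hy hz (by linear_combination g) g2
      refine ⟨y / l, l * z / y, k1, k2, Or.inr (Or.inl ?_)⟩
      rw [← k3, ← k4, ← k5]
    · obtain ⟨g2, g3⟩ := caseA z x y (by rw [show z * x * y = x * y * z by ring]; exact ha)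
        (by linear_combination h1) (by linear_combination g)
      obtain ⟨k1, k2, k3, k4, k5⟩ := fin z x y hz hx (by linear_combination g) g2
      refine ⟨z / l, l * x / z, k1, k2, Or.inr (Or.inr ?_)⟩
      rw [← k3, ← k4, ← k5]

/-- A cubic through the nine inflection lines. -/
theorem exists_cubic_T (l : K) : ∃ G : MvPolynomial (Fin 3) K, G ≠ 0 ∧ G.IsHomogeneous 3 ∧
    ∀ w, InT l w → MvPolynomial.eval w G = 0 := by
  have hom : ∀ a b : K, (cubic a a a 0 0 0 0 0 0 b).IsHomogeneous 3 := by
    intro a b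
    have hX : ∀ i : Fin 3, (MvPolynomial.C a * MvPolynomial.X i ^ 3 :
        MvPolynomial (Fin 3) K).IsHomogeneous 3 := fun i => by
      simpa using (MvPolynomial.isHomogeneous_C (Fin 3) a).mul (MvPolynomial.isHomogeneous_X_pow i 3)
    have hY : (MvPolynomial.C b * MvPolynomial.X 0 * MvPolynomial.X 1 * MvPolynomial.X 2 :
        MvPolynomial (Fin 3) K).IsHomogeneous 3 := by
      simpa using (((MvPolynomial.isHomogeneous_C (Fin 3) b).mul (MvPolynomial.isHomogeneous_X K 0)).mul
        (MvPolynomial.isHomogeneous_X K 1)).mul (MvPolynomial.isHomogeneous_X K 2)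
    simpa [cubic] using (((hX 0).add (hX 1)).add (hX 2)).add hY
  by_cases hl : l = 0
  · refine ⟨cubic 0 0 0 0 0 0 0 0 0 1, ?_, hom 0 1, ?_⟩
    · intro h0
      have := congrArg (MvPolynomial.eval ![1, 1, 1]) h0
      rw [eval_cubic] at this
      simp at this
    · rintro w ⟨s, η, hs, hη, rfl | rfl | rfl⟩ <;> rw [eval_cubic] <;> simp [hl]
  · refine ⟨cubic l l l 0 0 0 0 0 0 (- (l ^ 3 + 2)), ?_, hom _ _, ?_⟩
    · intro h0
      have := congrArg (MvPolynomial.eval ![1, 0, 0]) h0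
      rw [eval_cubic] at this
      simp at this
      exact hl this
    · rintro w ⟨s, η, hs, hη, rfl | rfl | rfl⟩ <;> rw [eval_cubic] <;> simp <;>
        linear_combination (s ^ 3 * l * (η ^ 3 + 2) - s ^ 3 * l * (l ^ 3 + 2)) * hη

theorem multAt_zero (H : MvPolynomial (Fin 3) K) {p v u : Fin 3 → K} {n : ℕ} (hn : n < multAt H p)
    (hli : LinearIndependent K ![p, v, u]) :
    MvPolynomial.homogeneousComponent n (planeSubst H p v u) = 0 := by
  by_contra hne
  exact Nat.notMem_of_lt_sInf hn ⟨v, u, hli, hne⟩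

/-- The coefficients of the dehomogenization. -/
theorem coeff_dehom {P : MvPolynomial (Fin 3) K} {d : ℕ} (hP : P.IsHomogeneous d)
    (s : Fin 3 →₀ ℕ) (hs : MvPolynomial.coeff s P ≠ 0) (e : Fin 2 →₀ ℕ) (e0 : e 0 = s 1)
    (e1 : e 1 = s 2) :
    MvPolynomial.coeff e (MvPolynomial.aeval
      (![1, MvPolynomial.X 0, MvPolynomial.X 1] : Fin 3 → MvPolynomial (Fin 2) K) P) =
      MvPolynomial.coeff s P := by
  have hdeg : ∀ s : Fin 3 →₀ ℕ, MvPolynomial.coeff s P ≠ 0 → s 0 + s 1 + s 2 = d := by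
    intro s hs
    have := hP hs
    rw [← this]
    simp [Finsupp.weight_apply, Finsupp.sum_fintype, Fin.sum_univ_three]
  rw [MvPolynomial.aeval_def, MvPolynomial.eval₂_eq', MvPolynomial.coeff_sum]
  rw [Finset.sum_eq_single s]
  · rw [MvPolynomial.algebraMap_eq, MvPolynomial.coeff_C_mul]
    simp only [Fin.prod_univ_three, Matrix.cons_val, one_pow, one_mul]
    have : (MvPolynomial.X 0 ^ s 1 * MvPolynomial.X 1 ^ s 2 : MvPolynomial (Fin 2) K)
        = MvPolynomial.monomial e 1 := by
      rw [MvPolynomial.monomial_eq]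
      simp [Finsupp.prod_fintype, Fin.prod_univ_two, e0, e1]
    rw [this, MvPolynomial.coeff_monomial]; simp
  · intro s' hs' hne
    rw [MvPolynomial.mem_support_iff] at hs'
    rw [MvPolynomial.algebraMap_eq, MvPolynomial.coeff_C_mul]
    simp only [Fin.prod_univ_three, Matrix.cons_val, one_pow, one_mul]
    have : (MvPolynomial.X 0 ^ s' 1 * MvPolynomial.X 1 ^ s' 2 : MvPolynomial (Fin 2) K)
        = MvPolynomial.monomial (Finsupp.single 0 (s' 1) + Finsupp.single 1 (s' 2)) 1 := by
      rw [MvPolynomial.monomial_eq]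
      simp [Finsupp.prod_fintype, Fin.prod_univ_two]
    rw [this, MvPolynomial.coeff_monomial, if_neg, mul_zero]
    intro h
    apply hne
    have h0 := DFunLike.congr_fun h 0
    have h1 := DFunLike.congr_fun h 1
    simp [e0, e1] at h0 h1
    have d1 := hdeg s' hs'
    have d2 := hdeg s hs
    ext i
    fin_cases i
    · simp; omega
    · exact h0
    · exact h1
  · intro h
    exact absurd (MvPolynomial.mem_support_iff.2 hs) h

/-- A parametrized curve through `p` meets `H` with multiplicity at least `multAt H p`. -/
theorem multAt_dvd {H : MvPolynomial (Fin 3) K} {d : ℕ} (hH : H.IsHomogeneous d)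
    {p : Fin 3 → K} (hp : p ≠ 0) (γ : Fin 3 → Polynomial K) (t c : K)
    (hγ : ∀ i, (γ i).eval t = c * p i) :
    (Polynomial.X - Polynomial.C t) ^ multAt H p ∣ MvPolynomial.aeval γ H := by
  obtain ⟨v, hv⟩ : ∃ v, LinearIndependent K ![p, v] := by
    obtain ⟨j, hj⟩ := Function.ne_iff.1 hp
    refine ⟨Pi.single (j + 1) 1, linInd_of j hj ?_ ?_⟩
    · fin_cases j <;> simp
    · simp
  obtain ⟨u, hu⟩ := exists_third hv
  obtain ⟨h, hh⟩ := exists_inv hu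
  set g := (Matrix.of ![p, v, u]).transpose with hg
  have hgh : g * h = 1 := mul_eq_one_comm.1 hh
  let B : Fin 3 → Polynomial K := fun i => ∑ j, Polynomial.C (h i j) * γ j
  have hB : MvPolynomial.aeval γ H = MvPolynomial.aeval B (transformPoly g H) := by
    rw [aeval_transformPoly]
    congr 2
    funext i
    have : ∀ j, algebraMap K (Polynomial K) (g i j) * B j =
        ∑ m, Polynomial.C (g i j * h j m) * γ m := by
      intro j
      simp only [B, Finset.mul_sum, map_mul, Polynomial.algebraMap_eq, mul_assoc]
    simp only [this]
    rw [Finset.sum_comm]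
    simp only [← Finset.sum_mul, ← map_sum]
    have e : ∀ m, ∑ j, g i j * h j m = (1 : Matrix (Fin 3) (Fin 3) K) i m := by
      intro m; rw [← hgh, Matrix.mul_apply]
    simp only [e, Matrix.one_apply]
    simp
  have hev : ∀ i, (B i).eval t = c * (1 : Matrix (Fin 3) (Fin 3) K) i 0 := by
    intro i
    simp only [B, Polynomial.eval_finsetSum, Polynomial.eval_mul, Polynomial.eval_C, hγ]
    rw [← hh, Matrix.mul_apply, Finset.mul_sum]
    apply Finset.sum_congr rfl
    intro j _
    have : g j 0 = p j := by simp [hg]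
    rw [this]; ring
  have hd1 : (Polynomial.X - Polynomial.C t) ∣ B 1 := by
    rw [Polynomial.dvd_iff_isRoot, Polynomial.IsRoot, hev]; simp
  have hd2 : (Polynomial.X - Polynomial.C t) ∣ B 2 := by
    rw [Polynomial.dvd_iff_isRoot, Polynomial.IsRoot, hev]; simp
  have hPh : (transformPoly g H).IsHomogeneous d := transformPoly_homog g hH
  have hpl : planeSubst H p v u = MvPolynomial.aeval
      (![1, MvPolynomial.X 0, MvPolynomial.X 1] : Fin 3 → MvPolynomial (Fin 2) K)
      (transformPoly g H) := by
    rw [aeval_transformPoly, planeSubst]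
    congr 2
    funext i
    simp [Fin.sum_univ_three, hg]
  rw [hB, MvPolynomial.aeval_def, MvPolynomial.eval₂_eq']
  apply Finset.dvd_sum
  intro s hs
  rw [MvPolynomial.mem_support_iff] at hs
  apply Dvd.dvd.mul_left
  have hm : multAt H p ≤ s 1 + s 2 := by
    by_contra! hlt
    have h0 := multAt_zero H hlt hu
    have h1 := congrArg (MvPolynomial.coeff
      (Finsupp.single 0 (s 1) + Finsupp.single 1 (s 2) : Fin 2 →₀ ℕ)) h0
    rw [MvPolynomial.coeff_homogeneousComponent, if_pos, hpl,
      coeff_dehom hPh s hs _ (by simp) (by simp)] at h1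
    · exact hs (by simpa using h1)
    · simp only [map_add, Finsupp.degree_single]
  refine (pow_dvd_pow _ hm).trans ?_
  rw [Fin.prod_univ_three, pow_add, mul_assoc]
  exact Dvd.dvd.mul_left (mul_dvd_mul (pow_dvd_pow_of_dvd hd1 _) (pow_dvd_pow_of_dvd hd2 _)) _

theorem multAt_smul_le {H : MvPolynomial (Fin 3) K} {d : ℕ} (hH : H.IsHomogeneous d)
    (p : Fin 3 → K) {c : K} (hc : c ≠ 0) :
    {n | ∃ v u, LinearIndependent K ![p, v, u] ∧
      MvPolynomial.homogeneousComponent n (planeSubst H p v u) ≠ 0} ⊆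
    {n | ∃ v u, LinearIndependent K ![c • p, v, u] ∧
      MvPolynomial.homogeneousComponent n (planeSubst H (c • p) v u) ≠ 0} := by
  rintro n ⟨v, u, hli, hn⟩
  refine ⟨c • v, c • u, ?_, ?_⟩
  · have := hli.units_smul (fun _ => Units.mk0 c hc)
    convert this using 1
    funext i
    fin_cases i <;> rfl
  · have : planeSubst H (c • p) (c • v) (c • u) = c ^ d • planeSubst H p v u := by
      unfold planeSubst
      rw [MvPolynomial.aeval_def, MvPolynomial.aeval_def, MvPolynomial.eval₂_eq',
        MvPolynomial.eval₂_eq', Finset.smul_sum]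
      apply Finset.sum_congr rfl
      intro s hs
      rw [MvPolynomial.mem_support_iff] at hs
      have hdeg : s 0 + s 1 + s 2 = d := by
        rw [← hH hs]
        simp [Finsupp.weight_apply, Finsupp.sum_fintype, Fin.sum_univ_three]
      have e : ∀ i, (MvPolynomial.C ((c • p) i) + MvPolynomial.C ((c • v) i) * MvPolynomial.X 0 +
          MvPolynomial.C ((c • u) i) * MvPolynomial.X 1 : MvPolynomial (Fin 2) K) =
          MvPolynomial.C c * (MvPolynomial.C (p i) + MvPolynomial.C (v i) * MvPolynomial.X 0 +
          MvPolynomial.C (u i) * MvPolynomial.X 1) := by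
        intro i; simp; ring
      simp only [e, mul_pow, Fin.prod_univ_three]
      rw [MvPolynomial.smul_eq_C_mul, ← hdeg, map_pow]
      ring
    rw [this, map_smul]
    exact smul_ne_zero (pow_ne_zero _ hc) hn

theorem multAt_smul {H : MvPolynomial (Fin 3) K} {d : ℕ} (hH : H.IsHomogeneous d)
    (p : Fin 3 → K) {c : K} (hc : c ≠ 0) : multAt H (c • p) = multAt H p := by
  unfold multAt
  congr 1
  apply le_antisymm
  · have := multAt_smul_le hH (c • p) (inv_ne_zero hc)
    rwa [smul_smul, inv_mul_cancel₀ hc, one_smul] at this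
  · exact multAt_smul_le hH p hc

theorem sum_le_natDegree {ι : Type*} (s : Finset ι) (q : Polynomial K) (hq : q ≠ 0)
    (t : ι → K) (ht : Function.Injective t) (m : ι → ℕ)
    (hm : ∀ i, (Polynomial.X - Polynomial.C (t i)) ^ m i ∣ q) {N : ℕ} (hN : q.natDegree ≤ N) :
    ∑ i ∈ s, m i ≤ N := by
  have hdvd : ∏ i ∈ s, (Polynomial.X - Polynomial.C (t i)) ^ m i ∣ q := by
    apply Finset.prod_dvd_of_coprime
    · intro i _ j _ hij
      exact (Polynomial.isCoprime_X_sub_C_of_isUnit_sub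
        (sub_ne_zero.2 (fun h => hij (ht h))).isUnit).pow
    · intro i _; exact hm i
  have := Polynomial.natDegree_le_of_dvd hdvd hq
  rw [Polynomial.natDegree_prod _ _ (fun i _ => pow_ne_zero _ (Polynomial.X_sub_C_ne_zero _))] at this
  simp only [Polynomial.natDegree_pow, Polynomial.natDegree_X_sub_C, mul_one] at this
  exact this.trans hN

theorem natDegree_aeval_le {H : MvPolynomial (Fin 3) K} {d : ℕ} (hH : H.IsHomogeneous d)
    (γ : Fin 3 → Polynomial K) (n : ℕ) (hγ : ∀ i, (γ i).natDegree ≤ n) :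
    (MvPolynomial.aeval γ H).natDegree ≤ n * d := by
  rw [MvPolynomial.aeval_def, MvPolynomial.eval₂_eq']
  apply Polynomial.natDegree_sum_le_of_forall_le
  intro s hs
  rw [MvPolynomial.mem_support_iff] at hs
  have hdeg : s 0 + s 1 + s 2 = d := by
    rw [← hH hs]
    simp [Finsupp.weight_apply, Finsupp.sum_fintype, Fin.sum_univ_three]
  refine (Polynomial.natDegree_C_mul_le _ _).trans ?_
  rw [Fin.prod_univ_three]
  refine Polynomial.natDegree_mul_le.trans ?_
  refine (Nat.add_le_add_right Polynomial.natDegree_mul_le _).trans ?_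
  rw [← hdeg, mul_add, mul_add]
  have : ∀ i, (γ i ^ s i).natDegree ≤ n * s i := fun i =>
    Polynomial.natDegree_pow_le.trans (by rw [mul_comm]; exact Nat.mul_le_mul_right _ (hγ i))
  exact Nat.add_le_add (Nat.add_le_add (this 0) (this 1)) (this 2)

theorem fin3_ne (r : Fin 3) : r + 1 ≠ r ∧ r + 2 ≠ r ∧ r + 1 ≠ r + 2 := by
  revert r; decide

theorem fin3_sum {M : Type*} [AddCommMonoid M] (f : Fin 3 → M) (r : Fin 3) :
    ∑ j, f j = f r + f (r + 1) + f (r + 2) := by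
  fin_cases r
  · exact Fin.sum_univ_three f
  · rw [Fin.sum_univ_three]; change f 0 + f 1 + f 2 = f 1 + f 2 + f 0; abel
  · rw [Fin.sum_univ_three]; change f 0 + f 1 + f 2 = f 2 + f 0 + f 1; abel

theorem fin3_forall {p : Fin 3 → Prop} (r : Fin 3) (h0 : p r) (h1 : p (r + 1)) (h2 : p (r + 2)) :
    ∀ i, p i := by
  intro i
  have : ∀ r i : Fin 3, i = r ∨ i = r + 1 ∨ i = r + 2 := by decide
  rcases this r i with rfl | rfl | rfl <;> assumption

/-- The conics. -/
def conic (l : K) (r : Fin 3) : MvPolynomial (Fin 3) K :=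
  MvPolynomial.C l * MvPolynomial.X r ^ 2 - MvPolynomial.X (r + 1) * MvPolynomial.X (r + 2)

theorem homog_conic (l : K) (r : Fin 3) : (conic l r).IsHomogeneous 2 := homog_aux l _ _ _

theorem conic_irred {l : K} (hl : l ≠ 0) (r : Fin 3) : Irreducible (conic l r) := by
  have e : conic l r = (- MvPolynomial.X (r + 2)) * MvPolynomial.X (r + 1) +
      MvPolynomial.C l * MvPolynomial.X r ^ 2 := by unfold conic; ring
  obtain ⟨h1, h2, h3⟩ := fin3_ne r
  rw [e]
  apply MvPolynomial.irreducible_mul_X_add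
  · simp
  · rw [MvPolynomial.vars_neg, MvPolynomial.vars_X]; simp [h3]
  · intro hm
    have := MvPolynomial.vars_mul _ _ hm
    rw [MvPolynomial.vars_C] at this
    have := MvPolynomial.vars_pow _ _ (by simpa using this)
    rw [MvPolynomial.vars_X] at this
    simp [h1] at this
  · have hpr : Irreducible (MvPolynomial.X (r + 2) : MvPolynomial (Fin 3) K) :=
      MvPolynomial.X_prime.irreducible
    rw [IsRelPrime.neg_left_iff]
    rw [hpr.isRelPrime_iff_not_dvd]
    intro hd
    have := map_dvd (MvPolynomial.eval (fun i => if i = r + 2 then (0 : K) else 1)) hd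
    simp [h2.symm, hl] at this

theorem unit_eq_C {u : MvPolynomial (Fin 3) K} (hu : IsUnit u) : ∃ a : K, a ≠ 0 ∧ u = MvPolynomial.C a := by
  obtain ⟨a, ha, e⟩ := MvPolynomial.isUnit_iff_eq_C_of_isReduced.1 hu
  exact ⟨a, ha.ne_zero, e⟩

/-- If `B` is irreducible and `H * Y` vanishes on the zero set of `B`, then `B` divides `H`. -/
theorem null_dvd [IsAlgClosed K] {B Y H : MvPolynomial (Fin 3) K} (hB : Irreducible B)
    (hY : ¬ B ∣ Y) (h : ∀ p, MvPolynomial.eval p B = 0 → MvPolynomial.eval p Y ≠ 0 →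
      MvPolynomial.eval p H = 0) : B ∣ H := by
  have hprime : Prime B := hB.prime
  have hI : (Ideal.span {B}).IsPrime := (Ideal.span_singleton_prime hprime.ne_zero).2 hprime
  have hmem : Y * H ∈ (Ideal.span {B} : Ideal (MvPolynomial (Fin 3) K)) := by
    rw [← MvPolynomial.IsPrime.vanishingIdeal_zeroLocus (K := K) (Ideal.span {B}) (h := hI),
      MvPolynomial.mem_vanishingIdeal_iff]
    intro p hp
    rw [MvPolynomial.zeroLocus_span] at hp
    have hp' : MvPolynomial.eval p B = 0 := by
      have := hp B rfl
      simpa [MvPolynomial.aeval_eq_eval] using this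
    have : MvPolynomial.eval p (Y * H) = 0 := by
      rw [map_mul]
      by_cases hy : MvPolynomial.eval p Y = 0
      · rw [hy, zero_mul]
      · rw [h p hp' hy, mul_zero]
    simpa [MvPolynomial.aeval_eq_eval] using this
  rw [Ideal.mem_span_singleton] at hmem
  exact (hprime.dvd_or_dvd hmem).resolve_left hY

theorem eval_smul_homog {H : MvPolynomial (Fin 3) K} {d : ℕ} (hH : H.IsHomogeneous d) (c : K)
    (p : Fin 3 → K) : MvPolynomial.eval (fun i => c * p i) H = c ^ d * MvPolynomial.eval p H := by
  rw [MvPolynomial.eval_eq', MvPolynomial.eval_eq', Finset.mul_sum]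
  apply Finset.sum_congr rfl
  intro s hs
  rw [MvPolynomial.mem_support_iff] at hs
  have hdeg : s 0 + s 1 + s 2 = d := by
    rw [← hH hs]
    simp [Finsupp.weight_apply, Finsupp.sum_fintype, Fin.sum_univ_three]
  simp only [mul_pow, Fin.prod_univ_three, ← hdeg]
  ring

theorem eval_aeval_poly (H : MvPolynomial (Fin 3) K) (γ : Fin 3 → Polynomial K) (t : K) :
    (MvPolynomial.aeval γ H).eval t = MvPolynomial.eval (fun i => (γ i).eval t) H := by
  have : ((Polynomial.aeval t).comp (MvPolynomial.aeval γ)) H = MvPolynomial.aeval (fun i => (γ i).eval t) H := by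
    rw [MvPolynomial.comp_aeval]; rfl
  rw [AlgHom.comp_apply] at this
  simpa [MvPolynomial.aeval_eq_eval] using this

/-- Parametrization of the conics (`μ = l`), or of the lines. -/
def par (a b c : Polynomial K) (r : Fin 3) : Fin 3 → Polynomial K := fun n =>
  if n = r then a else if n = r + 1 then b else c

@[simp] theorem par0 (a b c : Polynomial K) (r : Fin 3) : par a b c r r = a := by simp [par]
@[simp] theorem par1 (a b c : Polynomial K) (r : Fin 3) : par a b c r (r + 1) = b := by
  simp [par]
@[simp] theorem par2 (a b c : Polynomial K) (r : Fin 3) : par a b c r (r + 2) = c := by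
  simp [par, (fin3_ne r).2.2.symm]

theorem conic_dvd [IsAlgClosed K] {l : K} (hl : l ≠ 0) {H : MvPolynomial (Fin 3) K} {d : ℕ}
    (hH : H.IsHomogeneous d) (r : Fin 3)
    (h : MvPolynomial.aeval (par Polynomial.X 1 (Polynomial.C l * Polynomial.X ^ 2) r) H = 0) :
    conic l r ∣ H := by
  obtain ⟨n1, n2, n3⟩ := fin3_ne r
  apply null_dvd (conic_irred hl r) (Y := MvPolynomial.X (r + 1))
  · intro hd
    have := map_dvd (MvPolynomial.eval (fun i => if i = r + 1 then (1 : K) else 0)) hd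
    simp [conic, n1.symm, n3.symm] at this
  · intro p hp hy
    simp only [conic, map_sub, map_mul, MvPolynomial.eval_C, MvPolynomial.eval_X, map_pow] at hp
    rw [MvPolynomial.eval_X] at hy
    have e : p = fun i => p (r + 1) * (par Polynomial.X 1 (Polynomial.C l * Polynomial.X ^ 2) r i).eval
        (p r / p (r + 1)) := by
      funext i
      revert i
      refine fin3_forall r ?_ ?_ ?_
      · simp; field_simp
      · simp
      · simp; field_simp; linear_combination - hp
    rw [e, eval_smul_homog hH, ← eval_aeval_poly, h]
    simp

theorem line_dvd [IsAlgClosed K] {H : MvPolynomial (Fin 3) K} {d : ℕ}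
    (hH : H.IsHomogeneous d) (r : Fin 3)
    (h : MvPolynomial.aeval (par (0 : Polynomial K) 1 Polynomial.X r) H = 0) :
    MvPolynomial.X r ∣ H := by
  obtain ⟨n1, n2, n3⟩ := fin3_ne r
  apply null_dvd (MvPolynomial.X_prime (i := r)).irreducible (Y := MvPolynomial.X (r + 1))
  · intro hd
    have := map_dvd (MvPolynomial.eval (fun i => if i = r + 1 then (1 : K) else 0)) hd
    simp [n1.symm] at this
  · intro p hp hy
    rw [MvPolynomial.eval_X] at hp
    rw [MvPolynomial.eval_X] at hy
    have e : p = fun i => p (r + 1) * (par (0 : Polynomial K) 1 Polynomial.X r i).eval (p (r + 2) / p (r + 1)) := by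
      funext i
      revert i
      refine fin3_forall r ?_ ?_ ?_
      · simp [hp]
      · simp
      · simp; field_simp
    rw [e, eval_smul_homog hH, ← eval_aeval_poly, h]
    simp

/-- The nine inflection lines of the Hesse cubic. -/
def tau (l η : K) (j : Fin 3) : Fin 3 → K := fun n =>
  if n = j then l else if n = j + 1 then η else η ^ 2

@[simp] theorem tau0 (l η : K) (r : Fin 3) : tau l η r r = l := by simp [tau]
@[simp] theorem tau1 (l η : K) (r : Fin 3) : tau l η r (r + 1) = η := by simp [tau]
@[simp] theorem tau2 (l η : K) (r : Fin 3) : tau l η r (r + 2) = η ^ 2 := by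
  simp [tau, (fin3_ne r).2.2.symm]

theorem tau10 (l η : K) (r : Fin 3) : tau l η (r + 1) r = η ^ 2 := by
  have := tau2 l η (r + 1)
  rwa [add_assoc, show (1 : Fin 3) + 2 = 0 from rfl, add_zero] at this
theorem tau12 (l η : K) (r : Fin 3) : tau l η (r + 1) (r + 2) = η := by
  have := tau1 l η (r + 1)
  rwa [add_assoc, show (1 : Fin 3) + 1 = 2 from rfl] at this
theorem tau20 (l η : K) (r : Fin 3) : tau l η (r + 2) r = η := by
  have := tau1 l η (r + 2)
  rwa [add_assoc, show (2 : Fin 3) + 1 = 0 from rfl, add_zero] at this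
theorem tau21 (l η : K) (r : Fin 3) : tau l η (r + 2) (r + 1) = η ^ 2 := by
  have := tau2 l η (r + 2)
  rwa [add_assoc, show (2 : Fin 3) + 2 = 1 from rfl] at this

theorem inT_tau {l : K} {w : Fin 3 → K} (h : InT l w) :
    ∃ s η : K, ∃ j, s ≠ 0 ∧ η ^ 3 = 1 ∧ w = s • tau l η j := by
  obtain ⟨s, η, hs, hη, h⟩ := h
  rcases h with rfl | rfl | rfl
  · refine ⟨s, η, 0, hs, hη, ?_⟩
    ext i; fin_cases i <;> simp [tau]
  · refine ⟨s, η, 1, hs, hη, ?_⟩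
    ext i; fin_cases i <;> simp [tau]
  · refine ⟨s, η, 2, hs, hη, ?_⟩
    ext i; fin_cases i <;> simp [tau]

theorem pow_dvd_le {q : Polynomial K} (m n : ℕ) (h : Polynomial.X ^ m ∣ q) (hq : q.coeff n ≠ 0) :
    m ≤ n := by
  by_contra! hlt
  exact hq (Polynomial.X_pow_dvd_iff.1 h n hlt)

theorem coeff_conic (l a : K) (r : Fin 3) (w v : Fin 3 → K) :
    (lineRestrict (conic l r * MvPolynomial.C a) w v).coeff 0 =
      a * (l * w r ^ 2 - w (r + 1) * w (r + 2)) ∧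
    (lineRestrict (conic l r * MvPolynomial.C a) w v).coeff 1 =
      a * (2 * l * w r * v r - w (r + 1) * v (r + 2) - v (r + 1) * w (r + 2)) := by
  have e : lineRestrict (conic l r * MvPolynomial.C a) w v =
      Polynomial.C (a * (l * w r ^ 2 - w (r + 1) * w (r + 2))) +
      Polynomial.C (a * (2 * l * w r * v r - w (r + 1) * v (r + 2) - v (r + 1) * w (r + 2)))
        * Polynomial.X + Polynomial.C (a * (l * v r ^ 2 - v (r + 1) * v (r + 2)))
          * Polynomial.X ^ 2 := by
    simp only [lineRestrict, conic, map_mul, map_sub, map_pow, MvPolynomial.aeval_X,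
      MvPolynomial.aeval_C, Polynomial.algebraMap_eq, map_ofNat]
    ring
  have aux : ∀ A B D : K, (Polynomial.C A + Polynomial.C B * Polynomial.X +
      Polynomial.C D * Polynomial.X ^ 2).coeff 0 = A ∧ (Polynomial.C A +
      Polynomial.C B * Polynomial.X + Polynomial.C D * Polynomial.X ^ 2).coeff 1 = B := by
    intro A B D
    constructor
    · simp
    · simp [Polynomial.coeff_C, Polynomial.coeff_X_pow]
  rw [e]
  exact aux _ _ _

theorem nef0 [IsAlgClosed K] {l : K} (hl3 : l ^ 3 ≠ 1) {η : Fin 3 → K} (hη : ∀ i, η i ^ 3 = 1)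
    (hinj : Function.Injective η) {H : MvPolynomial (Fin 3) K} {d : ℕ} (hH : H.IsHomogeneous d)
    (hirr : Irreducible H) (M : Fin 3 → Fin 3 → ℕ)
    (hM : ∀ j i (γ : Fin 3 → Polynomial K) (t c : K),
      (∀ n, (γ n).eval t = c * tau l (η i) j n) →
      (Polynomial.X - Polynomial.C t) ^ M j i ∣ MvPolynomial.aeval γ H) :
    ∑ j, ∑ i, M j i ≤ 3 * d := by
  have hη0 : ∀ i, η i ≠ 0 := fun i h => by simpa [h] using hη i
  -- bounds along lines
  have hline : ∀ j i (v : Fin 3 → K) n,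
      (lineRestrict H (tau l (η i) j) v).coeff n ≠ 0 → M j i ≤ n := by
    intro j i v n hn
    refine pow_dvd_le _ _ ?_ hn
    have := hM j i (fun m => Polynomial.C (tau l (η i) j m) + Polynomial.C (v m) * Polynomial.X)
      0 1 (by intro m; simp)
    simpa [lineRestrict] using this
  have hdeg : ∀ {B : MvPolynomial (Fin 3) K} {n : ℕ}, B.IsHomogeneous n → Irreducible B → B ∣ H →
      n = d ∧ ∃ a : K, a ≠ 0 ∧ H = B * MvPolynomial.C a := by
    intro B n hB hBi hd
    obtain ⟨u, hu⟩ := (hBi.associated_of_dvd hirr hd)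
    obtain ⟨a, ha, e⟩ := unit_eq_C u.isUnit
    rw [e] at hu
    refine ⟨?_, a, ha, hu.symm⟩
    have h2 : H.IsHomogeneous n := by
      rw [← hu]; simpa using hB.mul (MvPolynomial.isHomogeneous_C (Fin 3) a)
    exact h2.inj_right hH hirr.ne_zero
  by_cases hl : l = 0
  · subst hl
    by_cases hex : ∃ r, MvPolynomial.aeval (par (0 : Polynomial K) 1 Polynomial.X r) H = 0
    · obtain ⟨r, hr⟩ := hex
      obtain ⟨rfl, a, ha, rfl⟩ := hdeg (MvPolynomial.isHomogeneous_X K r)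
        (MvPolynomial.X_prime (i := r)).irreducible (line_dvd hH r hr)
      have h0 : ∀ i, M r i ≤ 1 := fun i => by
        refine hline r i (fun n => if n = r then 1 else 0) 1 ?_
        simp [lineRestrict, ha]
      have h1 : ∀ i, M (r + 1) i ≤ 0 := fun i => by
        refine hline (r + 1) i 0 0 ?_
        simp [lineRestrict, tau10, ha, hη0, Polynomial.coeff_zero_eq_eval_zero]
      have h2 : ∀ i, M (r + 2) i ≤ 0 := fun i => by
        refine hline (r + 2) i 0 0 ?_
        simp [lineRestrict, tau20, ha, hη0]
      rw [fin3_sum _ r]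
      have e0 := Finset.sum_le_sum (fun i (_ : i ∈ Finset.univ) => h0 i)
      have e1 := Finset.sum_le_sum (fun i (_ : i ∈ Finset.univ) => h1 i)
      have e2 := Finset.sum_le_sum (fun i (_ : i ∈ Finset.univ) => h2 i)
      rw [Finset.sum_const, Finset.card_univ, Fintype.card_fin, smul_eq_mul] at e0 e1 e2
      omega
    · push Not at hex
      have hb : ∀ r, ∑ i, M r i ≤ d := by
        intro r
        have hN := natDegree_aeval_le hH (par (0 : Polynomial K) 1 Polynomial.X r) 1 (by
          exact fin3_forall r (by simp) (by simp) (by simp))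
        rw [one_mul] at hN
        refine sum_le_natDegree Finset.univ _ (hex r) η hinj (M r) ?_ hN
        intro i
        refine hM r i _ _ (η i)⁻¹ ?_
        refine fin3_forall r ?_ ?_ ?_
        · simp
        · simp [hη0]
        · simp; field_simp [hη0 i]
      have := Finset.sum_le_sum (fun r (_ : r ∈ Finset.univ) => hb r)
      simpa using this
  · by_cases hex : ∃ r, MvPolynomial.aeval
        (par Polynomial.X 1 (Polynomial.C l * Polynomial.X ^ 2) r) H = 0
    · obtain ⟨r, hr⟩ := hex
      obtain ⟨rfl, a, ha, rfl⟩ := hdeg (homog_conic l r) (conic_irred hl r) (conic_dvd hl hH r hr)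
      obtain ⟨n1, n2, n3⟩ := fin3_ne r
      have h0 : ∀ i, M r i ≤ 0 := fun i => by
        refine hline r i 0 0 ?_
        rw [(coeff_conic l a r _ _).1, tau0, tau1, tau2]
        refine mul_ne_zero ha (fun h => hl3 ?_)
        linear_combination h + hη i
      have h1 : ∀ i, M (r + 1) i ≤ 1 := fun i => by
        refine hline (r + 1) i (fun n => if n = r + 2 then 1 else 0) 1 ?_
        rw [(coeff_conic l a r _ _).2, tau0, tau10, tau12]
        simp [ha, hl, n2.symm, n3]
      have h2 : ∀ i, M (r + 2) i ≤ 1 := fun i => by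
        refine hline (r + 2) i (fun n => if n = r + 2 then 1 else 0) 1 ?_
        rw [(coeff_conic l a r _ _).2, tau0, tau20, tau21]
        simp [ha, hη0, n2.symm, n3]
      rw [fin3_sum _ r]
      have e0 := Finset.sum_le_sum (fun i (_ : i ∈ Finset.univ) => h0 i)
      have e1 := Finset.sum_le_sum (fun i (_ : i ∈ Finset.univ) => h1 i)
      have e2 := Finset.sum_le_sum (fun i (_ : i ∈ Finset.univ) => h2 i)
      rw [Finset.sum_const, Finset.card_univ, Fintype.card_fin, smul_eq_mul] at e0 e1 e2
      omega
    · push Not at hex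
      have hsq : ∀ i j, η i ^ 2 = η j ^ 2 → i = j := by
        intro i j h
        apply hinj
        have e1 : η i ^ 4 = η i := by linear_combination η i * hη i
        have e2 : η j ^ 4 = η j := by linear_combination η j * hη j
        rw [← e1, ← e2]
        linear_combination (η i ^ 2 + η j ^ 2) * h
      have hb : ∀ r, ∑ i, M (r + 1) i + ∑ i, M (r + 2) i ≤ 2 * d := by
        intro r
        have hN := natDegree_aeval_le hH
          (par Polynomial.X 1 (Polynomial.C l * Polynomial.X ^ 2) r) 2 (by
          refine fin3_forall r ?_ ?_ ?_
          · simp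
          · simp
          · simp [Polynomial.natDegree_C_mul_X_pow_le])
        have := sum_le_natDegree Finset.univ _ (hex r)
          (Sum.elim (fun i => η i ^ 2 / l) (fun i => η i ^ 2)) ?_
          (Sum.elim (M (r + 1)) (M (r + 2))) ?_ hN
        · simpa using this
        · rintro (i | i) (j | j) h
          · simp [hl] at h
            rw [hsq i j h]
          · exfalso
            simp only [Sum.elim_inl, Sum.elim_inr] at h
            have h' : η i ^ 2 = l * η j ^ 2 := by rw [← h]; field_simp
            apply hl3
            have := congrArg (· ^ 3) h'
            have a1 := hη i
            have a2 := hη j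
            grind
          · exfalso
            simp only [Sum.elim_inl, Sum.elim_inr] at h
            have h' : η j ^ 2 = l * η i ^ 2 := by rw [h]; field_simp
            apply hl3
            have := congrArg (· ^ 3) h'
            have a1 := hη i
            have a2 := hη j
            grind
          · simp at h
            rw [hsq i j h]
        · rintro (i | i)
          · simp only [Sum.elim_inl]
            refine hM (r + 1) i _ _ l⁻¹ ?_
            refine fin3_forall r ?_ ?_ ?_
            · simp [tau10]; field_simp
            · simp [hl]
            · simp [tau12]; field_simp; linear_combination η i * hη i
          · simp only [Sum.elim_inr]
            refine hM (r + 2) i _ _ (η i) ?_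
            refine fin3_forall r ?_ ?_ ?_
            · simp [tau20]; ring
            · simp [tau21]; linear_combination - hη i
            · simp; linear_combination l * η i * hη i
      have b0 := hb 0
      have b1 := hb 1
      have b2 := hb 2
      simp only [zero_add, show (1 : Fin 3) + 1 = 2 from rfl, show (1 : Fin 3) + 2 = 0 from rfl,
        show (2 : Fin 3) + 1 = 0 from rfl, show (2 : Fin 3) + 2 = 1 from rfl] at b0 b1 b2
      rw [Fin.sum_univ_three]
      omega

theorem infl_iff {F : MvPolynomial (Fin 3) K} (h3 : (3 : K) ≠ 0)
    {g h : Matrix (Fin 3) (Fin 3) K} {l c : K} (hg : h * g = 1) (hc : c ≠ 0) (hl : l ^ 3 ≠ 1)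
    (e : transformPoly g F = c • hesse l) (w : Fin 3 → K) :
    IsInflLine F w ↔ InT l (g.transpose.mulVec w) := by
  rw [← infl_transform_iff hg, e, infl_smul_iff hc]
  exact ⟨inT_of_infl h3 hl, infl_of_inT hl⟩

theorem exists_eta [IsAlgClosed K] (h3 : (3 : K) ≠ 0) : ∃ η : Fin 3 → K, (∀ i, η i ^ 3 = 1) ∧
    Function.Injective η ∧ ∀ x : K, x ^ 3 = 1 → ∃ i, x = η i := by
  obtain ⟨w, hw⟩ := exists_omega (K := K)
  have w3 : w ^ 3 = 1 := by linear_combination (w - 1) * hw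
  have w1 : w ≠ 1 := by
    rintro rfl; apply h3; linear_combination hw
  have w0 : w ≠ 0 := by rintro rfl; simp at hw
  refine ⟨![1, w, w ^ 2], ?_, ?_, ?_⟩
  · intro i
    fin_cases i
    · simp
    · simpa using w3
    · simp; linear_combination (w ^ 3 + 1) * w3
  · have a1 : (1 : K) ≠ w ^ 2 := by
      intro h; apply w1; linear_combination w3 + w * h
    have a2 : w ≠ w ^ 2 := by
      intro h; apply w1
      have : w * (w - 1) = 0 := by linear_combination - h
      simpa [w0, sub_eq_zero] using this
    intro i j hij
    fin_cases i <;> fin_cases j <;> simp at hij ⊢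
    · exact w1 hij.symm
    · exact a1 hij
    · exact w1 hij
    · exact a2 hij
    · exact a1 (by grind)
    · exact a2 hij.symm
  · intro x hx
    have : (x - 1) * ((x - w) * (x - w ^ 2)) = 0 := by
      linear_combination hx + (-x ^ 2 + x * w) * hw + (-1) * w3
    rcases mul_eq_zero.1 this with h | h
    · exact ⟨0, by simpa [sub_eq_zero] using h⟩
    · rcases mul_eq_zero.1 h with h | h
      · exact ⟨1, by simpa [sub_eq_zero] using h⟩
      · exact ⟨2, by simpa [sub_eq_zero] using h⟩

theorem tau_ne_zero {l η : K} (hη : η ^ 3 = 1) (j : Fin 3) : tau l η j ≠ 0 := by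
  intro h
  have := congrFun h (j + 1)
  rw [tau1] at this
  rw [this] at hη
  simp at hη

theorem irred_transform {g h : Matrix (Fin 3) (Fin 3) K} (hg : h * g = 1)
    {H : MvPolynomial (Fin 3) K} (hH : Irreducible H) : Irreducible (transformPoly g H) := by
  have hgh : g * h = 1 := mul_eq_one_comm.1 hg
  let e : MvPolynomial (Fin 3) K ≃ₐ[K] MvPolynomial (Fin 3) K :=
    AlgEquiv.ofAlgHom (MvPolynomial.aeval (fun i => ∑ j, MvPolynomial.C (g i j) * MvPolynomial.X j))
      (MvPolynomial.aeval (fun i => ∑ j, MvPolynomial.C (h i j) * MvPolynomial.X j))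
      (by
        apply AlgHom.ext
        intro P
        have := transformPoly_mul h g P
        rw [hg, transformPoly_one] at this
        exact this)
      (by
        apply AlgHom.ext
        intro P
        have := transformPoly_mul g h P
        rw [hgh, transformPoly_one] at this
        exact this)
  exact (MulEquiv.irreducible_iff e).2 hH

open Classical in
theorem nef_final [IsAlgClosed K] (h3 : (3 : K) ≠ 0) {F : MvPolynomial (Fin 3) K}
    (hF : IsSmoothCurve F 3) (H : MvPolynomial (Fin 3) K) (d : ℕ) (hirr : Irreducible H)
    (hH : H.IsHomogeneous d) :
    (∑ᶠ l : Projectivization K (Fin 3 → K),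
        if IsInflLine F l.rep then multAt H l.rep else 0) ≤ 3 * d := by
  obtain ⟨g, h, l, c, hg, hc, hl3, -, hgF⟩ := normal_form h3 hF
  have hinf := infl_iff h3 hg hc hl3 hgF
  obtain ⟨η, hη, hinj, hall⟩ := exists_eta h3
  have hgh : g * h = 1 := mul_eq_one_comm.1 hg
  have ht : h.transpose * g.transpose = 1 := by rw [← Matrix.transpose_mul, hgh, Matrix.transpose_one]
  have ht' : g.transpose * h.transpose = 1 := mul_eq_one_comm.1 ht
  let M : Fin 3 → Fin 3 → ℕ := fun j i => multAt H (h.transpose.mulVec (tau l (η i) j))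
  have hbound : ∑ j, ∑ i, M j i ≤ 3 * d := by
    refine nef0 hl3 hη hinj (transformPoly_homog h.transpose hH) (irred_transform ht' hirr) M ?_
    intro j i γ t c' hγ
    rw [aeval_transformPoly]
    refine multAt_dvd hH (mulVec_ne_zero ht' (tau_ne_zero (hη i) j)) _ t c' ?_
    intro n
    simp only [Polynomial.eval_finsetSum, Polynomial.eval_mul, Polynomial.algebraMap_eq,
      Polynomial.eval_C, hγ, Matrix.mulVec, dotProduct, Finset.mul_sum]
    apply Finset.sum_congr rfl
    intro m _
    ring
  let S := {q : Projectivization K (Fin 3 → K) // IsInflLine F q.rep}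
  have hrep : ∀ q : S, ∃ ji : Fin 3 × Fin 3, ∃ s : K, s ≠ 0 ∧
      q.1.rep = s • h.transpose.mulVec (tau l (η ji.2) ji.1) := by
    rintro ⟨q, hq⟩
    rw [hinf] at hq
    obtain ⟨s, x, j, hs, hx, e⟩ := inT_tau hq
    obtain ⟨i, rfl⟩ := hall x hx
    refine ⟨(j, i), s, hs, ?_⟩
    have := congrArg h.transpose.mulVec e
    rw [Matrix.mulVec_mulVec, ht, Matrix.one_mulVec, Matrix.mulVec_smul] at this
    exact this
  choose f s hs hf using hrep
  have hfinj : Function.Injective f := by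
    intro q q' hqq
    apply Subtype.ext
    rw [← q.1.mk_rep, ← q'.1.mk_rep, Projectivization.mk_eq_mk_iff']
    refine ⟨s q / s q', ?_⟩
    rw [hf q, hf q', hqq, smul_smul, div_mul_cancel₀ _ (hs q')]
  have hfin : Finite S := Finite.of_injective f hfinj
  have := Fintype.ofFinite S
  have e1 : (∑ᶠ q : Projectivization K (Fin 3 → K),
      if IsInflLine F q.rep then multAt H q.rep else 0) = ∑ᶠ q : S, multAt H q.1.rep := by
    refine Eq.trans ?_ (finsum_subtype_eq_finsum_cond
      (f := fun q : Projectivization K (Fin 3 → K) => multAt H q.rep)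
      (fun q : Projectivization K (Fin 3 → K) => IsInflLine F q.rep)).symm
    apply finsum_congr
    intro q
    by_cases hq : IsInflLine F q.rep <;> simp [hq]
  rw [e1, finsum_eq_sum_of_fintype]
  have e2 : ∀ q : S, multAt H q.1.rep = M (f q).1 (f q).2 := by
    intro q
    rw [hf q, multAt_smul hH _ (hs q)]
  rw [Finset.sum_congr rfl (fun q _ => e2 q)]
  rw [← Fintype.sum_prod_type'] at hbound
  refine le_trans ?_ hbound
  rw [← Finset.sum_image (s := Finset.univ) (g := f) (f := fun x => M x.1 x.2)
    (fun a _ b _ hab => hfinj hab)]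
  exact Finset.sum_le_sum_of_subset (Finset.subset_univ _)

theorem sing_transform {A : Matrix (Fin 3) (Fin 3) K} {P : MvPolynomial (Fin 3) K}
    {w : Fin 3 → K} (h : SingAt P (A.mulVec w)) : SingAt (transformPoly A P) w := by
  rw [singAt_iff] at h ⊢
  intro v
  rw [lr_transformPoly]
  exact h _

theorem pG_eq (l : K) : pG l = conic l 0 * conic l 1 * conic l 2 := rfl

theorem transformPoly_mul_poly (A : Matrix (Fin 3) (Fin 3) K) (P Q : MvPolynomial (Fin 3) K) :
    transformPoly A (P * Q) = transformPoly A P * transformPoly A Q := by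
  unfold transformPoly; rw [map_mul]

theorem part5 [IsAlgClosed K] (h3 : (3 : K) ≠ 0) {F : MvPolynomial (Fin 3) K}
    {g h : Matrix (Fin 3) (Fin 3) K} {l c : K} (hg : h * g = 1) (hc : c ≠ 0) (hl3 : l ^ 3 ≠ 1)
    (hl : l ≠ 0) (hgF : transformPoly g F = c • hesse l) :
    ∃ G : MvPolynomial (Fin 3) K, G ≠ 0 ∧ G.IsHomogeneous 6 ∧
        (∀ w : Fin 3 → K, IsInflLine F w → SingAt G w) ∧
        Squarefree G ∧
        (∀ G₁ G₂ : MvPolynomial (Fin 3) K, G = G₁ * G₂ →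
          G₁.totalDegree ≠ 0 → G₂.totalDegree ≠ 0 →
          ∃ z : Fin 3 → K, z ≠ 0 ∧ MvPolynomial.eval z G₁ = 0 ∧ MvPolynomial.eval z G₂ = 0 ∧
            ¬ IsInflLine F z) := by
  have hinf := infl_iff h3 hg hc hl3 hgF
  have hgh : g * h = 1 := mul_eq_one_comm.1 hg
  have ht : h.transpose * g.transpose = 1 := by rw [← Matrix.transpose_mul, hgh, Matrix.transpose_one]
  have ht' : g.transpose * h.transpose = 1 := mul_eq_one_comm.1 ht
  let B : Fin 3 → MvPolynomial (Fin 3) K := fun r => transformPoly g.transpose (conic l r)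
  have hB : ∀ r, Irreducible (B r) := fun r => irred_transform ht (conic_irred hl r)
  let q : Fin 3 → Fin 3 → K := fun m => h.transpose.mulVec (Pi.single m 1)
  have hgq : ∀ m, g.transpose.mulVec (q m) = Pi.single m 1 := by
    intro m
    simp only [q]
    rw [Matrix.mulVec_mulVec, ht', Matrix.one_mulVec]
  have hBq : ∀ r m, MvPolynomial.eval (q m) (B r) = if m = r then l else 0 := by
    intro r m
    simp only [B]
    rw [eval_transformPoly, hgq]
    fin_cases r <;> fin_cases m <;> simp [conic]
  have hnd : ∀ r s, r ≠ s → ¬ B r ∣ B s := by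
    intro r s hrs hd
    have := map_dvd (MvPolynomial.eval (q s)) hd
    rw [hBq, hBq, if_neg hrs.symm, if_pos rfl, zero_dvd_iff] at this
    exact hl this
  have hG : transformPoly g.transpose (pG l) = B 0 * B 1 * B 2 := by
    rw [pG_eq, transformPoly_mul_poly, transformPoly_mul_poly]
  have hrel : ∀ r s, r ≠ s → IsRelPrime (B r) (B s) := fun r s hrs =>
    ((hB r).isRelPrime_iff_not_dvd).2 (hnd r s hrs)
  have hsq : Squarefree (B 0 * B 1 * B 2) := by
    rw [squarefree_mul_iff, squarefree_mul_iff]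
    exact ⟨(hrel 0 2 (by decide)).mul_left (hrel 1 2 (by decide)),
      ⟨hrel 0 1 (by decide), (hB 0).squarefree, (hB 1).squarefree⟩, (hB 2).squarefree⟩
  refine ⟨transformPoly g.transpose (pG l), ?_, transformPoly_homog _ (homog_pG l), ?_, ?_, ?_⟩
  · rw [hG]; exact hsq.ne_zero
  · intro w hw
    exact sing_transform (sing_pG ((hinf w).1 hw))
  · rw [hG]; exact hsq
  · intro G₁ G₂ e d1 d2
    rw [hG] at e
    have hfac : ∀ P : MvPolynomial (Fin 3) K, P ∣ B 0 * B 1 * B 2 → P.totalDegree ≠ 0 →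
        ∃ i, B i ∣ P := by
      intro P hP hd
      have hP0 : P ≠ 0 := by rintro rfl; simp at hd
      have hPu : ¬ IsUnit P := by
        intro hu
        obtain ⟨a, -, rfl⟩ := unit_eq_C hu
        simp at hd
      obtain ⟨p, hp, hpP⟩ := WfDvdMonoid.exists_irreducible_factor hPu hP0
      have hpp := hp.prime
      have : ∃ i, p ∣ B i := by
        rcases hpp.dvd_or_dvd (hpP.trans hP) with h' | h'
        · rcases hpp.dvd_or_dvd h' with h' | h'
          · exact ⟨0, h'⟩
          · exact ⟨1, h'⟩
        · exact ⟨2, h'⟩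
      obtain ⟨i, hi⟩ := this
      exact ⟨i, ((hp.associated_of_dvd (hB i) hi).dvd').trans hpP⟩
    obtain ⟨i, hi⟩ := hfac G₁ (e ▸ Dvd.intro _ rfl) d1
    obtain ⟨j, hj⟩ := hfac G₂ (e ▸ Dvd.intro_left _ rfl) d2
    have : ∀ i j : Fin 3, ∃ m, m ≠ i ∧ m ≠ j := by decide
    obtain ⟨m, hmi, hmj⟩ := this i j
    refine ⟨q m, ?_, ?_, ?_, ?_⟩
    · apply mulVec_ne_zero ht'
      simp
    · obtain ⟨R, rfl⟩ := hi
      rw [map_mul, hBq, if_neg hmi, zero_mul]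
    · obtain ⟨R, rfl⟩ := hj
      rw [map_mul, hBq, if_neg hmj, zero_mul]
    · rw [hinf, hgq]
      intro hT
      obtain ⟨s, η, j, hs, hη, e⟩ := inT_tau hT
      have hη0 : η ≠ 0 := by rintro rfl; simp at hη
      have hne : ∀ n, (s • tau l η j) n ≠ 0 := by
        refine fin3_forall j ?_ ?_ ?_ <;> simp [hs, hl, hη0]
      apply hne (m + 1)
      rw [← e]
      simp

theorem fermat_aux {R : Type*} [CommRing R] (x y z w : R) (h2 : (2 : R) = 0)
    (hw : w ^ 2 + w + 1 = 0) :
    x ^ 3 + (y + w * z) ^ 3 + (y + w ^ 2 * z) ^ 3 = y ^ 2 * z + y * z ^ 2 - x ^ 3 := by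
  linear_combination (x ^ 3 + y ^ 3 - 2 * y ^ 2 * z - 2 * y * z ^ 2 + z ^ 3) * h2 +
    (3 * y ^ 2 * z + 3 * (w ^ 2 - w + 1) * y * z ^ 2 + (w - 1) * (w ^ 3 + 2) * z ^ 3) * hw

theorem hasJZero_of {k : Type*} [Field k] (h3 : (3 : AlgebraicClosure k) ≠ 0)
    (h2 : (2 : AlgebraicClosure k) = 0) {F : MvPolynomial (Fin 3) k}
    {g h : Matrix (Fin 3) (Fin 3) (AlgebraicClosure k)} {c : AlgebraicClosure k}
    (hg : h * g = 1) (hc : c ≠ 0) (hgF : transformPoly g (bar F) = c • hesse 0) : HasJZero F := by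
  obtain ⟨w, hw⟩ := exists_omega (K := AlgebraicClosure k)
  obtain ⟨w0, w1⟩ := omega_ne h3 hw
  let A : Matrix (Fin 3) (Fin 3) (AlgebraicClosure k) := !![1, 0, 0; 0, 1, w; 0, 1, w ^ 2]
  have hA : A.det ≠ 0 := by
    have : A.det = w * (w - 1) := by
      simp [A, Matrix.det_fin_three]; ring
    rw [this]
    exact mul_ne_zero w0 (sub_ne_zero.2 w1)
  have hgd : g.det ≠ 0 := by
    intro h0
    have := congrArg Matrix.det hg
    rw [Matrix.det_mul, h0, mul_zero, Matrix.det_one] at this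
    exact zero_ne_one this
  let W : WeierstrassCurve (AlgebraicClosure k) := ⟨0, 0, 1, 0, 0⟩
  have hW : W.IsElliptic := by
    refine ⟨?_⟩
    have : W.Δ = - (3 * 3 * 3) := by
      simp [W, WeierstrassCurve.Δ, WeierstrassCurve.b₂, WeierstrassCurve.b₄, WeierstrassCurve.b₆,
        WeierstrassCurve.b₈]
      norm_num
    rw [this]
    exact (neg_ne_zero.2 (mul_ne_zero (mul_ne_zero h3 h3) h3)).isUnit
  refine ⟨W, hW, Matrix.GeneralLinearGroup.mkOfDetNeZero (g * A)
    (by rw [Matrix.det_mul]; exact mul_ne_zero hgd hA), Units.mk0 c hc, ?_, ?_⟩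
  · simp [WeierstrassCurve.j, WeierstrassCurve.c₄, WeierstrassCurve.b₂, WeierstrassCurve.b₄, W]
  · change transformPoly (g * A) (bar F) = c • wpoly W
    rw [← transformPoly_mul, hgF, transformPoly_smul]
    suffices hs : transformPoly A (hesse 0) = wpoly W by rw [hs]
    have h2' : (2 : MvPolynomial (Fin 3) (AlgebraicClosure k)) = 0 := by
      have := congrArg (MvPolynomial.C (σ := Fin 3)) h2
      rw [map_zero, map_ofNat] at this
      exact this
    have hw' : (MvPolynomial.C w : MvPolynomial (Fin 3) (AlgebraicClosure k)) ^ 2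
        + MvPolynomial.C w + 1 = 0 := by
      have := congrArg (MvPolynomial.C (σ := Fin 3)) hw
      simpa using this
    simp [hesse, cubic, transformPoly, wpoly, W, A, Fin.sum_univ_three]
    refine (fermat_aux _ _ _ (MvPolynomial.C w) h2' hw')

theorem line_mem {E : Type*} [Field E] {a b v : Fin 3 → E} {i j : Fin 3} (ai : a i = 1) (bi : b i = 0)
    (bj : b j = 1) (vi : v i = 0)
    (hd : (a 1 * b 2 - a 2 * b 1) * v 0 + (a 2 * b 0 - a 0 * b 2) * v 1
      + (a 0 * b 1 - a 1 * b 0) * v 2 = 0) : ∀ n, v n = v j * b n := by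
  intro n
  fin_cases i <;> fin_cases j <;> fin_cases n <;> simp at ai bi bj vi ⊢ <;> grind

theorem line_eq {E : Type*} [Field E] {a b v n : Fin 3 → E} {i j : Fin 3} (ai : a i = 1)
    (bi : b i = 0) (bj : b j = 1) (hn : n 0 ≠ 0 ∨ n 1 ≠ 0 ∨ n 2 ≠ 0)
    (ha : n 0 * a 0 + n 1 * a 1 + n 2 * a 2 = 0) (hb : n 0 * b 0 + n 1 * b 1 + n 2 * b 2 = 0)
    (hv : n 0 * v 0 + n 1 * v 1 + n 2 * v 2 = 0) (vi : v i = 0) : ∀ m, v m = v j * b m := by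
  apply line_mem ai bi bj vi
  rcases hn with hn | hn | hn
  · apply mul_left_cancel₀ hn; grind
  · apply mul_left_cancel₀ hn; grind
  · apply mul_left_cancel₀ hn; grind

theorem deriv_core {k E : Type*} [Field k] [Field E] [Algebra k E] (h3 : (3 : E) ≠ 0)
    (D : Derivation k E E) {A B C d e f g h i m : E} (hA : D A = 0) (hB : D B = 0) (hC : D C = 0)
    (hd : D d = 0) (he : D e = 0) (hf : D f = 0) (hg : D g = 0) (hh : D h = 0) (hi : D i = 0)
    (hm : D m = 0) {p v : Fin 3 → E} {r s : Fin 3} (pr : p r = 1) (vr : v r = 0) (vs : v s = 1)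
    (n : Fin 3 → E)
    (n0 : n 0 = 3*A*p 0^2+2*d*p 0*p 1+2*e*p 0*p 2+f*p 1^2+h*p 2^2+m*p 1*p 2)
    (n1 : n 1 = 3*B*p 1^2+2*f*p 0*p 1+2*g*p 1*p 2+d*p 0^2+i*p 2^2+m*p 0*p 2)
    (n2 : n 2 = 3*C*p 2^2+2*h*p 0*p 2+2*i*p 1*p 2+e*p 0^2+g*p 1^2+m*p 0*p 1)
    (hn : n 0 ≠ 0 ∨ n 1 ≠ 0 ∨ n 2 ≠ 0)
    (e0 : A * p 0 ^ 3 + B * p 1 ^ 3 + C * p 2 ^ 3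
      + d * p 0 ^ 2 * p 1 + e * p 0 ^ 2 * p 2 + f * p 1 ^ 2 * p 0 + g * p 1 ^ 2 * p 2
      + h * p 2 ^ 2 * p 0 + i * p 2 ^ 2 * p 1 + m * p 0 * p 1 * p 2 = 0)
    (e1 : n 0 * v 0 + n 1 * v 1 + n 2 * v 2 = 0)
    (e2 : (3*A*p 0+d*p 1+e*p 2)*v 0^2 + (3*B*p 1+f*p 0+g*p 2)*v 1^2
        + (3*C*p 2+h*p 0+i*p 1)*v 2^2 + (2*d*p 0+2*f*p 1+m*p 2)*v 0*v 1
        + (2*e*p 0+2*h*p 2+m*p 1)*v 0*v 2 + (2*g*p 1+2*i*p 2+m*p 0)*v 1*v 2 = 0)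
    (e3 : A * v 0 ^ 3 + B * v 1 ^ 3 + C * v 2 ^ 3
      + d * v 0 ^ 2 * v 1 + e * v 0 ^ 2 * v 2 + f * v 1 ^ 2 * v 0 + g * v 1 ^ 2 * v 2
      + h * v 2 ^ 2 * v 0 + i * v 2 ^ 2 * v 1 + m * v 0 * v 1 * v 2 ≠ 0) :
    (∀ n, D (p n) = 0) ∧ ∀ n, D (v n) = 0 := by
  have D2 : D (2 : E) = 0 := by simpa using D.map_natCast 2
  have D3 : D (3 : E) = 0 := by simpa using D.map_natCast 3
  have d0 := congrArg D e0
  have d1 := congrArg D e1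
  have d2 := congrArg D e2
  rw [n0, n1, n2] at d1
  simp only [map_add, Derivation.leibniz, Derivation.leibniz_pow, hA, hB, hC, hd, he, hf, hg, hh,
    hi, hm, D2, D3, smul_eq_mul, map_zero, nsmul_eq_mul, mul_zero, add_zero, zero_add] at d0 d1 d2
  push_cast at d0 d1 d2
  norm_num at d0 d1 d2
  have hp : ∀ m, D (p m) = D (p s) * v m := by
    refine line_eq (v := fun m => D (p m)) pr vr vs hn ?_ e1 ?_ (by simp [pr])
    · rw [n0, n1, n2]; linear_combination 3 * e0
    · rw [n0, n1, n2]; linear_combination d0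
  have hv : ∀ m, D (v m) = D (v s) * v m := by
    refine line_eq (v := fun m => D (v m)) pr vr vs hn ?_ e1 ?_ (by simp [vr])
    · rw [n0, n1, n2]; linear_combination 3 * e0
    · rw [hp 0, hp 1, hp 2] at d1
      rw [n0, n1, n2]; linear_combination d1 - 2 * D (p s) * e2
  have hv0 : ∀ m, D (v m) = 0 := by
    intro m; rw [hv, vs]; simp
  refine ⟨?_, hv0⟩
  rw [hp 0, hp 1, hp 2, hv0, hv0, hv0] at d2
  have : D (p s) = 0 := by
    have h' := mul_ne_zero h3 e3
    apply (mul_eq_zero.1 (?_ : _ * D (p s) = 0)).resolve_left h'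
    linear_combination d2
  intro m; rw [hp, this, zero_mul]

theorem flex_normal [Infinite K] {F : MvPolynomial (Fin 3) K} {w a b : Fin 3 → K}
    (hwa : dotv w a = 0) (hwb : dotv w b = 0) (hab : LinearIndependent K ![a, b]) {c : K}
    (hc : c ≠ 0) (hf : ∀ x y : K, MvPolynomial.eval (x • a + y • b) F = y ^ 3 * c) :
    ∃ (p v : Fin 3 → K) (i j : Fin 3), p i = 1 ∧ v i = 0 ∧ v j = 1 ∧ dotv w p = 0 ∧ dotv w v = 0 ∧
      ∃ c', c' ≠ 0 ∧ lineRestrict F p v = Polynomial.C c' * Polynomial.X ^ 3 := by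
  have ha : a ≠ 0 := by simpa using hab.ne_zero 0
  obtain ⟨i, hi⟩ := Function.ne_iff.1 ha
  simp only [Pi.zero_apply] at hi
  have hb : b - (b i / a i) • a ≠ 0 := by
    intro h0
    have := LinearIndependent.pair_iff.1 hab (-(b i / a i)) 1 (by rw [← h0]; simp [sub_eq_add_neg, add_comm])
    exact one_ne_zero this.2
  obtain ⟨j, hj⟩ := Function.ne_iff.1 hb
  simp only [Pi.sub_apply, Pi.smul_apply, smul_eq_mul, Pi.zero_apply] at hj
  obtain ⟨s, hs⟩ : ∃ s, s = b j - b i / a i * a j := ⟨_, rfl⟩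
  rw [← hs] at hj
  have hdot : ∀ x y : K, dotv w (x • a + y • b) = 0 := by
    intro x y
    have : dotv w (x • a + y • b) = x * dotv w a + y * dotv w b := by
      simp [dotv, Fin.sum_univ_three]; ring
    rw [this, hwa, hwb]; simp
  refine ⟨(a i)⁻¹ • a + (0 : K) • b, (-(s⁻¹ * (b i / a i))) • a + s⁻¹ • b, i, j, by simp [hi], ?_, ?_,
    hdot _ _, hdot _ _, (s⁻¹) ^ 3 * c, mul_ne_zero (pow_ne_zero _ (inv_ne_zero hj)) hc, ?_⟩
  · simp; field_simp; ring
  · simp only [Pi.add_apply, Pi.smul_apply, smul_eq_mul]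
    have : s * s⁻¹ = 1 := mul_inv_cancel₀ hj
    rw [hs] at this ⊢
    linear_combination this
  · apply Polynomial.funext
    intro t
    rw [lr_eval]
    have := hf ((a i)⁻¹ + t * (-(s⁻¹ * (b i / a i)))) (t * s⁻¹)
    have e : (fun n => ((a i)⁻¹ • a + (0 : K) • b) n +
      ((-(s⁻¹ * (b i / a i))) • a + s⁻¹ • b) n * t) =
        ((a i)⁻¹ + t * (-(s⁻¹ * (b i / a i)))) • a + (t * s⁻¹) • b := by
      ext n; simp; ring
    rw [e, this]; simp; ring

theorem bar_cubic {k : Type*} [Field k] (A B C d e f g h i m : k) :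
    bar (cubic A B C d e f g h i m) = cubic (algebraMap k (AlgebraicClosure k) A)
      (algebraMap k (AlgebraicClosure k) B) (algebraMap k (AlgebraicClosure k) C)
      (algebraMap k (AlgebraicClosure k) d) (algebraMap k (AlgebraicClosure k) e)
      (algebraMap k (AlgebraicClosure k) f) (algebraMap k (AlgebraicClosure k) g)
      (algebraMap k (AlgebraicClosure k) h) (algebraMap k (AlgebraicClosure k) i)
      (algebraMap k (AlgebraicClosure k) m) := by
  simp [bar, cubic]

theorem infl_binary {A B C d e f g h i m : K} {a b : Fin 3 → K}
    (h0 : lineRestrict (cubic A B C d e f g h i m) a b ≠ 0)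
    (h3 : 3 ≤ contactAt (cubic A B C d e f g h i m) a b) :
    ∃ c, c ≠ 0 ∧ ∀ x y : K,
      MvPolynomial.eval (x • a + y • b) (cubic A B C d e f g h i m) = y ^ 3 * c := by
  have hc := infl_coeffs h3
  have c0 := hc 0 (by norm_num)
  have c1 := hc 1 (by norm_num)
  have c2 := hc 2 (by norm_num)
  rw [lr_cubic, cf0] at c0
  rw [lr_cubic, cf1] at c1
  rw [lr_cubic, cf2] at c2
  refine ⟨MvPolynomial.eval b (cubic A B C d e f g h i m), ?_, ?_⟩
  · intro c3
    apply h0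
    rw [lr_cubic, c0, c1, c2, c3]
    simp
  · intro x y
    rw [eval_cubic] at c0 ⊢
    rw [eval_cubic]
    simp only [Pi.add_apply, Pi.smul_apply, smul_eq_mul]
    linear_combination x ^ 3 * c0 + x ^ 2 * y * c1 + x * y ^ 2 * c2

theorem sep_of_deriv.{u} {k E : Type u} [Field k] [Field E] [Algebra k E] [FiniteDimensional k E]
    (h : ∀ D : Derivation k E E, D = 0) : Algebra.IsSeparable k E := by
  have : Algebra.FormallyUnramified k E := by
    refine ⟨?_⟩
    rw [← Module.subsingleton_dual_iff E]
    refine ⟨fun x y => ?_⟩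
    apply (KaehlerDifferential.linearMapEquivDerivation k E).injective
    rw [h ((KaehlerDifferential.linearMapEquivDerivation k E) x), h ((KaehlerDifferential.linearMapEquivDerivation k E) y)]
  exact Algebra.FormallyUnramified.isSeparable k E

theorem flex_sep {k : Type*} [Field k] (h3 : (3 : k) ≠ 0)
    {F : MvPolynomial (Fin 3) k} (hF : IsSmoothCurve (bar F) 3) {w : Fin 3 → AlgebraicClosure k}
    (hw : IsInflLine (bar F) w) :
    ∃ (s : AlgebraicClosure k) (w' : Fin 3 → separableClosure k (AlgebraicClosure k)),
      s ≠ 0 ∧ w = s • fun i => (w' i : AlgebraicClosure k) := by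
  have hFh : F.IsHomogeneous 3 :=
    MvPolynomial.IsHomogeneous.of_map (algebraMap k (AlgebraicClosure k)).injective hF.1
  obtain ⟨A, B, C, d, e, f, g, h, i, m, rfl⟩ := exists_cubic hFh
  rw [bar_cubic] at hF hw
  obtain ⟨hw0, a, b, hwa, hwb, hab, hne, hct⟩ := hw
  obtain ⟨c, hc, hbin⟩ := infl_binary hne hct
  obtain ⟨p, v, r, s, pr, vr, vs, hwp, hwv, c', hc', hlr⟩ := flex_normal hwa hwb hab hc hbin
  have hpv : LinearIndependent (AlgebraicClosure k) ![p, v] := by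
    refine linInd_of r (by rw [pr]; exact one_ne_zero) vr ?_
    rintro rfl
    simp at vs
  have c0 := congrArg (fun q => Polynomial.coeff q 0) hlr
  have c1 := congrArg (fun q => Polynomial.coeff q 1) hlr
  have c2 := congrArg (fun q => Polynomial.coeff q 2) hlr
  have c3 := congrArg (fun q => Polynomial.coeff q 3) hlr
  rw [lr_cubic, cf0] at c0
  rw [lr_cubic, cf1] at c1
  rw [lr_cubic, cf2] at c2
  rw [lr_cubic, cf3] at c3
  rw [eval_cubic] at c0 c3
  simp [Polynomial.coeff_X_pow] at c0 c1 c2 c3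
  let S : Set (AlgebraicClosure k) := Set.range p ∪ Set.range v
  have hS : S.Finite := (Set.finite_range p).union (Set.finite_range v)
  let E := IntermediateField.adjoin k S
  have : Finite S := hS
  have hfd : FiniteDimensional k E :=
    IntermediateField.finiteDimensional_adjoin fun x _ => Algebra.IsIntegral.isIntegral x
  let p' : Fin 3 → E := fun n => ⟨p n, IntermediateField.subset_adjoin k S (Or.inl ⟨n, rfl⟩)⟩
  let v' : Fin 3 → E := fun n => ⟨v n, IntermediateField.subset_adjoin k S (Or.inr ⟨n, rfl⟩)⟩
  have hsep : Algebra.IsSeparable k E := by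
    apply sep_of_deriv
    intro D
    have hD := deriv_core (D := D) (A := algebraMap k E A) (B := algebraMap k E B)
      (C := algebraMap k E C) (d := algebraMap k E d) (e := algebraMap k E e)
      (f := algebraMap k E f) (g := algebraMap k E g) (h := algebraMap k E h)
      (i := algebraMap k E i) (m := algebraMap k E m) (p := p') (v := v') (r := r) (s := s)
      (by rw [← map_ofNat (algebraMap k E)]; exact (_root_.map_ne_zero _).2 h3)
      (D.map_algebraMap _) (D.map_algebraMap _) (D.map_algebraMap _) (D.map_algebraMap _)
      (D.map_algebraMap _) (D.map_algebraMap _) (D.map_algebraMap _) (D.map_algebraMap _)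
      (D.map_algebraMap _) (D.map_algebraMap _)
      (Subtype.ext pr) (Subtype.ext vr) (Subtype.ext vs) ![_, _, _] rfl rfl rfl ?_
      (Subtype.ext c0) (Subtype.ext c1) (Subtype.ext c2) ?_
    · have hzero : ∀ x : E, (0 : Derivation k E E) x = 0 := fun _ => rfl
      apply Derivation.ext
      rintro ⟨x, hx⟩
      rw [hzero]
      induction hx using IntermediateField.adjoin_induction with
      | mem x hx =>
        rcases hx with ⟨n, rfl⟩ | ⟨n, rfl⟩
        · exact hD.1 n
        · exact hD.2 n
      | algebraMap x => exact D.map_algebraMap x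
      | add x y hx hy h1 h2 =>
        have e : (⟨x + y, add_mem hx hy⟩ : E) = ⟨x, hx⟩ + ⟨y, hy⟩ := rfl
        rw [e, map_add, h1, h2, add_zero]
      | inv x hx h1 =>
        have e : (⟨x⁻¹, inv_mem hx⟩ : E) = (⟨x, hx⟩ : E)⁻¹ := rfl
        rw [e, D.leibniz_inv, h1, smul_zero]
      | mul x y hx hy h1 h2 =>
        have e : (⟨x * y, mul_mem hx hy⟩ : E) = ⟨x, hx⟩ * ⟨y, hy⟩ := rfl
        rw [e, D.leibniz, h1, h2, smul_zero, smul_zero, add_zero]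
    · by_contra hcon
      push Not at hcon
      obtain ⟨g0, g1, g2⟩ := hcon
      have g0' := congrArg (algebraMap E (AlgebraicClosure k)) g0
      have g1' := congrArg (algebraMap E (AlgebraicClosure k)) g1
      have g2' := congrArg (algebraMap E (AlgebraicClosure k)) g2
      refine smooth_cubic_false hF (p 0) (p 1) (p 2) ?_ c0 g0' g1' g2'
      by_contra hcon
      push Not at hcon
      have : p r = 0 := fin3_forall (p := fun n => p n = 0) 0 hcon.1 hcon.2.1 hcon.2.2 r
      rw [pr] at this
      exact one_ne_zero this
    · intro h0
      apply hc'
      rw [← c3]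
      exact congrArg (algebraMap E (AlgebraicClosure k)) h0
  have hmem : ∀ x : E, (x : AlgebraicClosure k) ∈ separableClosure k (AlgebraicClosure k) := by
    intro x
    rw [mem_separableClosure_iff]
    exact IsSeparable.map E.val E.val.injective (Algebra.IsSeparable.isSeparable k x)
  obtain ⟨t, t0, t1, t2⟩ := perp_cross hpv hwp hwv
  refine ⟨t, ![⟨_, hmem (p' 1 * v' 2 - p' 2 * v' 1)⟩, ⟨_, hmem (p' 2 * v' 0 - p' 0 * v' 2)⟩,
    ⟨_, hmem (p' 0 * v' 1 - p' 1 * v' 0)⟩], ?_, ?_⟩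
  · rintro rfl
    apply hw0
    ext n
    refine fin3_forall (p := fun n => w n = 0) 0 ?_ ?_ ?_ n
    · rw [t0, zero_mul]
    · show w 1 = 0
      rw [t1, zero_mul]
    · show w 2 = 0
      rw [t2, zero_mul]
  · ext n
    refine fin3_forall (p := fun n => w n = _) 0 ?_ ?_ ?_ n
    · exact t0
    · exact t1
    · exact t2

def cw (r : K →+ K) (G : MvPolynomial (Fin 3) K) : MvPolynomial (Fin 3) K :=
  ∑ m ∈ G.support, MvPolynomial.monomial m (r (MvPolynomial.coeff m G))

theorem coeff_cw (r : K →+ K) (G : MvPolynomial (Fin 3) K) (m : Fin 3 →₀ ℕ) :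
    MvPolynomial.coeff m (cw r G) = r (MvPolynomial.coeff m G) := by
  classical
  unfold cw
  rw [MvPolynomial.coeff_sum]
  simp only [MvPolynomial.coeff_monomial]
  rw [Finset.sum_ite_eq']
  split_ifs with h
  · rfl
  · rw [MvPolynomial.notMem_support_iff] at h
    rw [h, map_zero]

theorem cw_add (r : K →+ K) (G H : MvPolynomial (Fin 3) K) : cw r (G + H) = cw r G + cw r H := by
  ext m
  simp [coeff_cw]

theorem cw_monomial (r : K →+ K) (m : Fin 3 →₀ ℕ) (c : K) :
    cw r (MvPolynomial.monomial m c) = MvPolynomial.monomial m (r c) := by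
  classical
  ext n
  simp only [coeff_cw, MvPolynomial.coeff_monomial]
  split_ifs <;> simp

theorem cw_homog (r : K →+ K) {G : MvPolynomial (Fin 3) K} {n : ℕ} (hG : G.IsHomogeneous n) :
    (cw r G).IsHomogeneous n := by
  intro m hm
  apply hG
  rw [coeff_cw] at hm
  intro h0
  rw [h0, map_zero] at hm
  exact hm rfl

theorem min_supp (V : Submodule K (MvPolynomial (Fin 3) K)) (φ : MvPolynomial (Fin 3) K →ₗ[K] K)
    {G : MvPolynomial (Fin 3) K} (hG : G ∈ V) (hφ : φ G ≠ 0) :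
    ∃ v ∈ V, φ v ≠ 0 ∧ ∀ r : K →+ K, r 1 = 1 → cw r v ∈ V → cw r v = v := by
  classical
  obtain ⟨v, ⟨hv, hv0⟩, hmin⟩ := WellFounded.has_min
    (measure (fun v : MvPolynomial (Fin 3) K => v.support.card)).wf {v | v ∈ V ∧ φ v ≠ 0}
    ⟨G, hG, hφ⟩
  have hmin' : ∀ u ∈ V, u.support.card < v.support.card → φ u = 0 := by
    intro u hu hlt
    by_contra h
    exact hmin u ⟨hu, h⟩ hlt
  have key : ∀ u ∈ V, u.support ⊂ v.support → u = 0 := by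
    intro u hu hlt
    by_contra hne
    obtain ⟨m, hm⟩ := MvPolynomial.support_nonempty.2 hne
    have hm' := MvPolynomial.mem_support_iff.1 hm
    have h1 := hmin' u hu (Finset.card_lt_card hlt)
    have h2 := hmin' (v - (MvPolynomial.coeff m v / MvPolynomial.coeff m u) • u)
      (V.sub_mem hv (V.smul_mem _ hu)) ?_
    · rw [map_sub, map_smul, h1, smul_zero, sub_zero] at h2
      exact hv0 h2
    · apply Finset.card_lt_card
      rw [Finset.ssubset_iff_of_subset]
      · refine ⟨m, hlt.1 hm, ?_⟩
        rw [MvPolynomial.notMem_support_iff]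
        simp [hm']
      · intro n hn
        by_contra hnv
        have hnu : n ∉ u.support := fun h => hnv (hlt.1 h)
        rw [MvPolynomial.notMem_support_iff] at hnv hnu
        rw [MvPolynomial.mem_support_iff] at hn
        simp [hnv, hnu] at hn
  have hvne : v ≠ 0 := by rintro rfl; simp at hv0
  obtain ⟨m, hm⟩ := MvPolynomial.support_nonempty.2 hvne
  have hm' := MvPolynomial.mem_support_iff.1 hm
  refine ⟨(MvPolynomial.coeff m v)⁻¹ • v, V.smul_mem _ hv, ?_, ?_⟩
  · rw [map_smul, smul_eq_mul]
    exact mul_ne_zero (inv_ne_zero hm') hv0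
  · intro r hr hrV
    have := key _ (V.sub_mem hrV (V.smul_mem (MvPolynomial.coeff m v)⁻¹ hv)) ?_
    · exact sub_eq_zero.1 this
    · rw [Finset.ssubset_iff_of_subset]
      · refine ⟨m, hm, ?_⟩
        rw [MvPolynomial.notMem_support_iff, MvPolynomial.coeff_sub, coeff_cw]
        simp [hm', hr]
      · intro n hn
        by_contra hnv
        rw [MvPolynomial.notMem_support_iff] at hnv
        rw [MvPolynomial.mem_support_iff, MvPolynomial.coeff_sub, coeff_cw] at hn
        simp [hnv] at hn

def opd (o : Option (Fin 3)) (G : MvPolynomial (Fin 3) K) : MvPolynomial (Fin 3) K :=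
  match o with
  | none => G
  | some i => pderiv i G

theorem opd_add (o : Option (Fin 3)) (G H : MvPolynomial (Fin 3) K) :
    opd o (G + H) = opd o G + opd o H := by
  cases o <;> simp [opd]

theorem opd_smul (o : Option (Fin 3)) (c : K) (H : MvPolynomial (Fin 3) K) :
    opd o (c • H) = c • opd o H := by
  cases o <;> simp [opd]

theorem opd_homog (o : Option (Fin 3)) {G : MvPolynomial (Fin 3) K} {n : ℕ}
    (hG : G.IsHomogeneous n) : ∃ d, (opd o G).IsHomogeneous d := by
  cases o
  · exact ⟨n, hG⟩
  · exact ⟨_, hG.pderiv⟩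

theorem opd_cw (r : K →+ K) (o : Option (Fin 3)) (G : MvPolynomial (Fin 3) K) :
    opd o (cw r G) = cw r (opd o G) := by
  cases o with
  | none => rfl
  | some i =>
    simp only [opd]
    induction G using MvPolynomial.induction_on' with
    | add p q h1 h2 => rw [cw_add, map_add, map_add, cw_add, h1, h2]
    | monomial m b =>
      rw [cw_monomial, pderiv_monomial, pderiv_monomial, cw_monomial]
      congr 2
      rw [mul_comm, mul_comm b, ← nsmul_eq_mul, ← nsmul_eq_mul, map_nsmul]

theorem opd_map {k : Type*} [Field k] (f : k →+* K) (o : Option (Fin 3))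
    (G : MvPolynomial (Fin 3) k) :
    opd o (MvPolynomial.map f G) = MvPolynomial.map f (opd o G) := by
  cases o with
  | none => rfl
  | some i => exact pderiv_map

theorem singAt_opd (G : MvPolynomial (Fin 3) K) (w : Fin 3 → K) :
    SingAt G w ↔ ∀ o ∈ (Set.univ : Set (Option (Fin 3))), MvPolynomial.eval w (opd o G) = 0 := by
  constructor
  · rintro ⟨h1, h2⟩ (_ | i) -
    · exact h1
    · exact h2 i
  · intro h
    exact ⟨h none trivial, fun i => h (some i) trivial⟩

theorem eval_cw (r : K →+ K) (w : Fin 3 → K) (hr : ∀ i c, r (c * w i) = r c * w i)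
    (G : MvPolynomial (Fin 3) K) :
    MvPolynomial.eval w (cw r G) = r (MvPolynomial.eval w G) := by
  have hp : ∀ i (n : ℕ) c, r (c * w i ^ n) = r c * w i ^ n := by
    intro i n
    induction n with
    | zero => simp
    | succ n ih => intro c; rw [pow_succ, ← mul_assoc, hr, ih, mul_assoc]
  have hm : ∀ (m : Fin 3 →₀ ℕ) (c : K), MvPolynomial.eval w (MvPolynomial.monomial m (r c)) =
      r (MvPolynomial.eval w (MvPolynomial.monomial m c)) := by
    intro m c
    simp only [MvPolynomial.eval_monomial, Finsupp.prod_fintype, pow_zero, implies_true,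
      Fin.prod_univ_three]
    rw [← mul_assoc, ← mul_assoc, ← mul_assoc, ← mul_assoc, hp, hp, hp]
  induction G using MvPolynomial.induction_on' with
  | add p q h1 h2 => rw [cw_add, map_add, map_add, h1, h2, map_add]
  | monomial m b => rw [cw_monomial, hm]

theorem infl_aut {k : Type*} [Field k] (σ : AlgebraicClosure k ≃ₐ[k] AlgebraicClosure k)
    (F : MvPolynomial (Fin 3) k) {w : Fin 3 → AlgebraicClosure k} (hw : IsInflLine (bar F) w) :
    IsInflLine (bar F) (fun i => σ (w i)) := by
  obtain ⟨hw0, a, b, hwa, hwb, hab, hne, hct⟩ := hw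
  have hlr : lineRestrict (bar F) (fun i => σ (a i)) (fun i => σ (b i)) =
      (lineRestrict (bar F) a b).map (σ : AlgebraicClosure k →+* AlgebraicClosure k) := by
    unfold lineRestrict bar
    rw [MvPolynomial.aeval_map_algebraMap, MvPolynomial.aeval_map_algebraMap,
      ← Polynomial.coe_mapRingHom, MvPolynomial.map_aeval]
    rw [MvPolynomial.aeval_def, ← MvPolynomial.coe_eval₂Hom]
    congr 2
    · ext x
      simp [Polynomial.algebraMap_apply]
    · ext i : 1
      simp
  have hdot : ∀ x y : Fin 3 → AlgebraicClosure k,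
      dotv (fun i => σ (x i)) (fun i => σ (y i)) = σ (dotv x y) := by
    intro x y
    simp [dotv]
  refine ⟨?_, fun i => σ (a i), fun i => σ (b i), ?_, ?_, ?_, ?_, ?_⟩
  · intro h
    apply hw0
    ext i
    have := congrFun h i
    simpa using this
  · rw [hdot, hwa, map_zero]
  · rw [hdot, hwb, map_zero]
  · rw [LinearIndependent.pair_iff] at hab ⊢
    intro s t hst
    have := hab (σ.symm s) (σ.symm t) (by
      ext i
      have := congrArg σ.symm (congrFun hst i)
      simpa using this)
    simpa using this
  · rw [hlr]
    exact (Polynomial.map_ne_zero_iff σ.injective).2 hne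
  · apply infl_of_coeffs
    · rw [hlr]
      exact (Polynomial.map_ne_zero_iff σ.injective).2 hne
    · intro n hn
      rw [hlr, Polynomial.coeff_map, infl_coeffs hct n hn, map_zero]

theorem map_eval_hom {k : Type*} [Field k]
    (σ : AlgebraicClosure k ≃ₐ[k] AlgebraicClosure k) (x : Fin 3 → AlgebraicClosure k)
    (H : MvPolynomial (Fin 3) (AlgebraicClosure k)) :
    σ (MvPolynomial.eval x H) = MvPolynomial.eval (fun i => σ (x i))
      (MvPolynomial.map (σ : AlgebraicClosure k →+* AlgebraicClosure k) H) := by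
  induction H using MvPolynomial.induction_on with
  | C a => simp
  | add p q hp hq => simp [hp, hq]
  | mul_X p i hp => simp [hp]

theorem fixed_mem {k : Type*} [Field k] {x : AlgebraicClosure k}
    (hx : x ∈ separableClosure k (AlgebraicClosure k))
    (h : ∀ σ : AlgebraicClosure k ≃ₐ[k] AlgebraicClosure k, σ x = x) :
    ∃ y, algebraMap k (AlgebraicClosure k) y = x := by
  have : (⟨x, hx⟩ : separableClosure k (AlgebraicClosure k)) ∈
      (⊥ : IntermediateField k (separableClosure k (AlgebraicClosure k))) := by
    rw [InfiniteGalois.mem_bot_iff_fixed]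
    intro τ
    have h1 := τ.liftNormal_commutes (AlgebraicClosure k) ⟨x, hx⟩
    apply Subtype.ext
    have h2 := h (τ.liftNormal (AlgebraicClosure k))
    exact h1.symm.trans h2
  obtain ⟨y, hy⟩ := IntermediateField.mem_bot.1 this
  exact ⟨y, congrArg Subtype.val hy⟩

theorem exists_proj {k : Type*} [Field k] : ∃ r : AlgebraicClosure k →+ AlgebraicClosure k,
    r 1 = 1 ∧ (∀ x, r x ∈ separableClosure k (AlgebraicClosure k)) ∧
    ∀ (y : separableClosure k (AlgebraicClosure k)) (c : AlgebraicClosure k),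
      r (c * y) = r c * y := by
  obtain ⟨f, hf⟩ := (Algebra.linearMap (separableClosure k (AlgebraicClosure k))
    (AlgebraicClosure k)).exists_leftInverse_of_injective
      (LinearMap.ker_eq_bot.2 fun x y hxy => Subtype.ext hxy)
  refine ⟨((separableClosure k (AlgebraicClosure k)).subtype : _ →+ _).comp f.toAddMonoidHom,
    ?_, ?_, ?_⟩
  · have := LinearMap.congr_fun hf 1
    simp only [LinearMap.coe_comp, Function.comp_apply, Algebra.linearMap_apply, map_one,
      LinearMap.id_apply] at this
    exact congrArg Subtype.val this
  · intro x
    exact (f x).2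
  · intro y c
    have : c * y = y • c := mul_comm _ _
    rw [this]
    simp [mul_comm]
    exact Or.inl rfl

theorem descent {k : Type*} [Field k] (h3 : (3 : k) ≠ 0) {F : MvPolynomial (Fin 3) k}
    (hF : IsSmoothCurve (bar F) 3) (S : Set (Option (Fin 3))) (n : ℕ)
    (φ : MvPolynomial (Fin 3) (AlgebraicClosure k) →ₗ[AlgebraicClosure k] AlgebraicClosure k)
    {G : MvPolynomial (Fin 3) (AlgebraicClosure k)} (hG : G.IsHomogeneous n)
    (hv : ∀ w, IsInflLine (bar F) w → ∀ o ∈ S, MvPolynomial.eval w (opd o G) = 0) (hφ : φ G ≠ 0) :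
    ∃ G' : MvPolynomial (Fin 3) k, G'.IsHomogeneous n ∧
      (∀ w, IsInflLine (bar F) w → ∀ o ∈ S, MvPolynomial.eval w (opd o (bar G')) = 0) ∧
      φ (bar G') ≠ 0 := by
  let V : Submodule (AlgebraicClosure k) (MvPolynomial (Fin 3) (AlgebraicClosure k)) :=
    { carrier := {G | G.IsHomogeneous n ∧
        ∀ w, IsInflLine (bar F) w → ∀ o ∈ S, MvPolynomial.eval w (opd o G) = 0}
      add_mem' := by
        rintro a b ⟨h1, h2⟩ ⟨h3, h4⟩
        refine ⟨h1.add h3, fun w hw o ho => ?_⟩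
        rw [opd_add, map_add, h2 w hw o ho, h4 w hw o ho, add_zero]
      zero_mem' := by
        refine ⟨MvPolynomial.isHomogeneous_zero _ _ _, fun w hw o ho => ?_⟩
        have := opd_smul o 0 (0 : MvPolynomial (Fin 3) (AlgebraicClosure k))
        rw [zero_smul, zero_smul] at this
        rw [this, map_zero]
      smul_mem' := by
        rintro c a ⟨h1, h2⟩
        refine ⟨(MvPolynomial.homogeneousSubmodule _ _ n).smul_mem c h1, fun w hw o ho => ?_⟩
        rw [opd_smul, MvPolynomial.smul_eval, h2 w hw o ho, mul_zero] }
  obtain ⟨v, hvV, hvφ, hr⟩ := min_supp V φ (G := G) ⟨hG, hv⟩ hφ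
  have hfix : ∀ (σ : AlgebraicClosure k ≃ₐ[k] AlgebraicClosure k) m,
      σ (MvPolynomial.coeff m v) = MvPolynomial.coeff m v := by
    intro σ m
    have := hr (σ : AlgebraicClosure k →+ AlgebraicClosure k) (map_one σ) ⟨cw_homog _ hvV.1, ?_⟩
    · have := congrArg (MvPolynomial.coeff m) this
      rw [coeff_cw] at this
      exact this
    · intro w hw o ho
      have hcw : ∀ H, cw (σ : AlgebraicClosure k →+ AlgebraicClosure k) H =
          MvPolynomial.map (σ : AlgebraicClosure k →+* AlgebraicClosure k) H := by
        intro H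
        ext m
        rw [coeff_cw, MvPolynomial.coeff_map]
        rfl
      have h1 := hvV.2 _ (infl_aut σ.symm F hw) o ho
      rw [opd_cw, hcw]
      have h2 := congrArg σ h1
      rw [map_zero] at h2
      rw [← h2, map_eval_hom]
      congr 2
      ext i
      exact (σ.apply_symm_apply _).symm
  have hsep : ∀ m, MvPolynomial.coeff m v ∈ separableClosure k (AlgebraicClosure k) := by
    intro m
    obtain ⟨r, r1, rm, rl⟩ := exists_proj (k := k)
    have := hr r r1 ⟨cw_homog _ hvV.1, ?_⟩
    · have := congrArg (MvPolynomial.coeff m) this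
      rw [coeff_cw] at this
      rw [← this]
      exact rm _
    · intro w hw o ho
      obtain ⟨s, w', hs, e⟩ := flex_sep h3 hF hw
      have h1 := hvV.2 w hw o ho
      obtain ⟨d, hd⟩ := opd_homog o hvV.1
      have e' : w = fun i => s * (w' i : AlgebraicClosure k) := e
      rw [e', eval_smul_homog hd] at h1
      have h2 := (mul_eq_zero.1 h1).resolve_left (pow_ne_zero _ hs)
      rw [opd_cw, e', eval_smul_homog (cw_homog r hd), eval_cw r _ (fun i c => rl _ _), h2,
        map_zero, mul_zero]
  have hex : ∀ m, ∃ y, algebraMap k (AlgebraicClosure k) y = MvPolynomial.coeff m v :=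
    fun m => fixed_mem (hsep m) fun σ => hfix σ m
  choose y hy using hex
  obtain ⟨G', hG'⟩ : ∃ G' : MvPolynomial (Fin 3) k, bar G' = v := by
    refine ⟨∑ m ∈ v.support, MvPolynomial.monomial m (y m), ?_⟩
    unfold bar
    rw [map_sum]
    simp only [MvPolynomial.map_monomial, hy]
    exact v.support_sum_monomial_coeff
  subst hG'
  exact ⟨G', MvPolynomial.IsHomogeneous.of_map (algebraMap k (AlgebraicClosure k)).injective hvV.1,
    hvV.2, hvφ⟩

theorem eval_homComp (n : ℕ) (P : MvPolynomial (Fin 2) K) :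
    MvPolynomial.eval (![1, 0] : Fin 2 → K) (homogeneousComponent n P) =
      (MvPolynomial.aeval (![Polynomial.X, 0] : Fin 2 → Polynomial K) P).coeff n := by
  induction P using MvPolynomial.induction_on' with
  | add p q h1 h2 => rw [map_add, map_add, map_add, Polynomial.coeff_add, h1, h2]
  | monomial m c =>
    rw [homogeneousComponent_of_mem (n := m.degree) (isHomogeneous_monomial c rfl)]
    have hd : m.degree = m 0 + m 1 := by
      rw [Finsupp.degree_eq_sum, Fin.sum_univ_two]
    rw [hd, MvPolynomial.aeval_monomial, Finsupp.prod_fintype _ _ (fun _ => pow_zero _),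
      Fin.prod_univ_two, Polynomial.algebraMap_eq]
    have he : MvPolynomial.eval (![1, 0] : Fin 2 → K) (MvPolynomial.monomial m c) =
        c * 0 ^ m 1 := by
      rw [MvPolynomial.eval_monomial, Finsupp.prod_fintype _ _ (fun _ => pow_zero _),
        Fin.prod_univ_two]
      simp
    simp only [Matrix.cons_val_zero, Matrix.cons_val_one]
    by_cases h1 : m 1 = 0
    · rw [h1, add_zero, pow_zero, mul_one, Polynomial.coeff_C_mul_X_pow]
      split_ifs with h
      · rw [he, h1, pow_zero, mul_one]
      · simp
    · rw [zero_pow h1, mul_zero, mul_zero, Polynomial.coeff_zero]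
      split_ifs
      · rw [he, zero_pow h1, mul_zero]
      · simp

theorem eval_planeSubst (G : MvPolynomial (Fin 3) K) (w v u : Fin 3 → K) (n : ℕ) :
    MvPolynomial.eval (![1, 0] : Fin 2 → K) (homogeneousComponent n (planeSubst G w v u)) =
      (lineRestrict G w v).coeff n := by
  rw [eval_homComp]
  unfold planeSubst lineRestrict
  rw [← AlgHom.comp_apply, MvPolynomial.comp_aeval]
  congr 3
  ext i : 1
  simp

open Classical in
theorem anticanonical_of_blowup_at_inflection_lines
    (k : Type*) [Field k] (h3 : (3 : k) ≠ 0)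
    (F : MvPolynomial (Fin 3) k) (hF : IsSmoothCurve (bar F) 3) :
    -- `−K_{S_C}` is linearly equivalent to an effective divisor:
    (∃ G : MvPolynomial (Fin 3) k, G ≠ 0 ∧ G.IsHomogeneous 3 ∧
      ∀ w : Fin 3 → AlgebraicClosure k, IsInflLine (bar F) w → eval w (bar G) = 0) ∧
    -- `−K_{S_C}` is nef: every irreducible curve of degree `d` in `(ℙ²)∨` (over the
    -- algebraic closure) has total multiplicity at most `3d` along `T_C`:
    (∀ (H : MvPolynomial (Fin 3) (AlgebraicClosure k)) (d : ℕ), Irreducible H →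
      H.IsHomogeneous d →
      (∑ᶠ l : Projectivization (AlgebraicClosure k) (Fin 3 → AlgebraicClosure k),
        if IsInflLine (bar F) l.rep then multAt H l.rep else 0) ≤ 3 * d) ∧
    -- `|−2K_{S_C}|` is base-point free: no common zero outside `T_C`, …
    (∀ z : Fin 3 → AlgebraicClosure k, z ≠ 0 → ¬ IsInflLine (bar F) z →
      ∃ G : MvPolynomial (Fin 3) k, InAntiBicanonical F G ∧ eval z (bar G) ≠ 0) ∧
    -- … and no common (infinitely near) base point on the exceptional curves:
    (∀ w v : Fin 3 → AlgebraicClosure k, IsInflLine (bar F) w →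
      LinearIndependent (AlgebraicClosure k) ![w, v] →
      ∃ (G : MvPolynomial (Fin 3) k) (u : Fin 3 → AlgebraicClosure k),
        InAntiBicanonical F G ∧ LinearIndependent (AlgebraicClosure k) ![w, v, u] ∧
        eval (![1, 0] : Fin 2 → AlgebraicClosure k)
          (homogeneousComponent 2 (planeSubst (bar G) w v u)) ≠ 0) ∧
    -- finally, unless `char k = 2` and `j(C) = 0`, after extending the ground field
    -- `|−2K_{S_C}|` contains a connected and reduced divisor:
    (¬ ((2 : k) = 0 ∧ HasJZero F) →
      ∃ G : MvPolynomial (Fin 3) (AlgebraicClosure k), G ≠ 0 ∧ G.IsHomogeneous 6 ∧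
        (∀ w : Fin 3 → AlgebraicClosure k, IsInflLine (bar F) w → SingAt G w) ∧
        Squarefree G ∧
        (∀ G₁ G₂ : MvPolynomial (Fin 3) (AlgebraicClosure k), G = G₁ * G₂ →
          G₁.totalDegree ≠ 0 → G₂.totalDegree ≠ 0 →
          ∃ z : Fin 3 → AlgebraicClosure k, z ≠ 0 ∧ eval z G₁ = 0 ∧ eval z G₂ = 0 ∧
            ¬ IsInflLine (bar F) z)) := by
  have h3K : (3 : AlgebraicClosure k) ≠ 0 := by
    rw [← map_ofNat (algebraMap k (AlgebraicClosure k))]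
    exact (_root_.map_ne_zero _).2 h3
  obtain ⟨g, h, l, c, hg, hc, hl3, hl2, hgF⟩ := normal_form h3K hF
  have hinf := infl_iff h3K hg hc hl3 hgF
  have ht : h.transpose * g.transpose = 1 := by
    rw [← Matrix.transpose_mul, mul_eq_one_comm.1 hg, Matrix.transpose_one]
  have ht' : g.transpose * h.transpose = 1 := mul_eq_one_comm.1 ht
  have anti : ∀ (φ : MvPolynomial (Fin 3) (AlgebraicClosure k) →ₗ[AlgebraicClosure k]
      AlgebraicClosure k) (P : MvPolynomial (Fin 3) (AlgebraicClosure k)), P.IsHomogeneous 6 →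
      (∀ w, InT l w → SingAt P w) → φ (transformPoly g.transpose P) ≠ 0 →
      ∃ G : MvPolynomial (Fin 3) k, InAntiBicanonical F G ∧ φ (bar G) ≠ 0 := by
    intro φ P hP hs hφ
    obtain ⟨G, hG, hGs, hGφ⟩ := descent h3 hF Set.univ 6 φ (transformPoly_homog g.transpose hP)
      (fun w hw => (singAt_opd _ _).1 (sing_transform (hs _ ((hinf w).1 hw)))) hφ
    refine ⟨G, ⟨?_, hG, fun w hw => (singAt_opd _ _).2 (hGs w hw)⟩, hGφ⟩
    rintro rfl
    apply hGφ
    simp [bar]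
  refine ⟨?_, fun H d hirr hH => nef_final h3K hF H d hirr hH, ?_, ?_, ?_⟩
  · obtain ⟨G₀, hG0, hGh, hGT⟩ := exists_cubic_T l
    obtain ⟨z, hz⟩ : ∃ z, MvPolynomial.eval z G₀ ≠ 0 := by
      by_contra! hcon
      exact hG0 (MvPolynomial.funext fun x => by rw [hcon x, map_zero])
    obtain ⟨G, hG, hGs, hGφ⟩ := descent h3 hF {none} 3
      (MvPolynomial.aeval (h.transpose.mulVec z)).toLinearMap
      (transformPoly_homog g.transpose hGh)
      (fun w hw o ho => by
        rw [Set.mem_singleton_iff] at ho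
        subst ho
        change MvPolynomial.eval w (transformPoly g.transpose G₀) = 0
        rw [eval_transformPoly]
        exact hGT _ ((hinf w).1 hw))
      (by
        change MvPolynomial.eval (h.transpose.mulVec z) (transformPoly g.transpose G₀) ≠ 0
        rw [eval_transformPoly, Matrix.mulVec_mulVec, ht', Matrix.one_mulVec]
        exact hz)
    refine ⟨G, ?_, hG, fun w hw => hGs w hw none rfl⟩
    rintro rfl
    apply hGφ
    simp [bar]
  · intro z hz hzi
    rw [hinf] at hzi
    have hne := mulVec_ne_zero ht hz
    have key : MvPolynomial.eval (g.transpose.mulVec z) (pD l) ≠ 0 ∨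
        MvPolynomial.eval (g.transpose.mulVec z) (pG l) ≠ 0 := by
      by_contra! hcon
      apply hzi
      obtain ⟨h1, h2⟩ := hcon
      rw [eval_pD] at h1
      rw [eval_pG] at h2
      have := base_points ?_ h1 h2
      · convert this using 1
        ext i
        fin_cases i <;> rfl
      · rintro ⟨a0, a1, a2⟩
        apply hne
        ext i
        fin_cases i
        · exact a0
        · exact a1
        · exact a2
    rcases key with hk | hk
    · exact anti (MvPolynomial.aeval z).toLinearMap (pD l) (homog_pD l) (fun w hw => sing_pD hw)
        (by
          change MvPolynomial.eval z (transformPoly g.transpose (pD l)) ≠ 0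
          rwa [eval_transformPoly])
    · exact anti (MvPolynomial.aeval z).toLinearMap (pG l) (homog_pG l) (fun w hw => sing_pG hw)
        (by
          change MvPolynomial.eval z (transformPoly g.transpose (pG l)) ≠ 0
          rwa [eval_transformPoly])
  · intro w v hw hwv
    obtain ⟨u, hu⟩ := exists_third hwv
    let φ : MvPolynomial (Fin 3) (AlgebraicClosure k) →ₗ[AlgebraicClosure k] AlgebraicClosure k :=
      (Polynomial.lcoeff (AlgebraicClosure k) 2).comp (MvPolynomial.aeval (R := AlgebraicClosure k)
        (fun i => Polynomial.C (w i) + Polynomial.C (v i) * Polynomial.X)).toLinearMap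
    have hφ : ∀ G, φ G = (lineRestrict G w v).coeff 2 := fun G => rfl
    have fin : ∃ G : MvPolynomial (Fin 3) k, InAntiBicanonical F G ∧ φ (bar G) ≠ 0 := by
      rcases tangent h3K hl3 ((hinf w).1 hw) (mulVec_linInd2 ht hwv) with hk | hk
      · exact anti φ (pD l) (homog_pD l) (fun w hw => sing_pD hw)
          (by rw [hφ, lr_transformPoly]; exact hk)
      · exact anti φ (pG l) (homog_pG l) (fun w hw => sing_pG hw)
          (by rw [hφ, lr_transformPoly]; exact hk)
    obtain ⟨G, hG, hGφ⟩ := fin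
    refine ⟨G, u, hG, hu, ?_⟩
    rw [eval_planeSubst, ← hφ]
    exact hGφ
  · intro hnot
    by_cases hl : l = 0
    · exfalso
      subst hl
      have h2 : (2 : AlgebraicClosure k) = 0 := hl2.resolve_left (fun hh => hh rfl)
      apply hnot
      refine ⟨?_, hasJZero_of h3K h2 hg hc hgF⟩
      apply (algebraMap k (AlgebraicClosure k)).injective
      rw [map_ofNat, map_zero]
      exact h2
    · exact part5 h3K hg hc hl3 hl hgF

end Infl
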